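/- arXiv:1608.01464 — 2 statements merged into one kernel-verified Lean document; each statement's English description precedes it below -/
import Mathlib

section
/- Let R(n) denote the number of isomorphism classes of vertex-rooted connected distance-hereditary simple graphs on n vertices, where a vertex-rooted graph is a pair (G, v) with v a vertex of G, and (G, v) and (G', v') are identified when there is a graph isomorphism from G to G' sending v to v'. There exist real constants c > 0, C > 0 and a natural number N such that for all n ≥ N, c · 7.249^n · n^(−3/2) ≤ R(n) ≤ C · 7.25^n · n^(−3/2). -/
/-- A simple graph is distance-hereditary if in every connected induced subgraph,
distances agree with those in the ambient graph. -/
def DistanceHereditary {V : Type} (G : SimpleGraph V) : Prop :=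
  ∀ S : Set V, (G.induce S).Connected →
    ∀ u v : S, (G.induce S).dist u v = G.dist u.val v.val

/-- The number of isomorphism classes of connected distance-hereditary simple graphs
on `n` vertices. -/
noncomputable def numConnDH (n : ℕ) : ℕ :=
  Nat.card (Quot (fun (G G' : {G : SimpleGraph (Fin n) // G.Connected ∧ DistanceHereditary G}) =>
    Nonempty (G.val ≃g G'.val)))

/-- The number of isomorphism classes of vertex-rooted connected distance-hereditary
simple graphs on `n` vertices: pairs `(G, v)` identified under isomorphisms sending root
to root. -/
noncomputable def numRootedConnDH (n : ℕ) : ℕ :=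
  Nat.card (Quot
    (fun (p q : {x : SimpleGraph (Fin n) × Fin n // x.1.Connected ∧ DistanceHereditary x.1}) =>
      ∃ φ : p.val.1 ≃g q.val.1, φ p.val.2 = q.val.2))

/-! ### Bounded reachability inside a vertex set -/

/-- `Rch G S n x y`: there is a walk of length at most `n` from `x` to `y` inside `S`. -/
inductive Rch {W : Type} (G : SimpleGraph W) (S : Set W) : ℕ → W → W → Prop
  | refl {n : ℕ} {x : W} : x ∈ S → Rch G S n x x
  | step {n : ℕ} {x y z : W} : x ∈ S → G.Adj x y → Rch G S n y z → Rch G S (n + 1) x z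

/-- The vertex set `S` induces a connected (or empty) subgraph. -/
def Conn {W : Type} (G : SimpleGraph W) (S : Set W) : Prop :=
  ∀ x ∈ S, ∀ y ∈ S, ∃ n, Rch G S n x y

/-- The subgraph induced on `T` is connected and distance-hereditary. -/
def DHOn {W : Type} (G : SimpleGraph W) (T : Set W) : Prop :=
  Conn G T ∧ ∀ S ⊆ T, Conn G S → ∀ x ∈ S, ∀ y ∈ S, ∀ n, Rch G T n x y → Rch G S n x y

namespace Rch

variable {W W' : Type} {G : SimpleGraph W} {G' : SimpleGraph W'} {S T : Set W} {m n : ℕ}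
  {x y z u w : W}

lemma mem_left (h : Rch G S n x y) : x ∈ S := by cases h <;> assumption

lemma mono (h : Rch G S n x y) (hST : S ⊆ T) : Rch G T n x y := by
  induction h with
  | refl h => exact .refl (hST h)
  | step h1 h2 _ ih => exact .step (hST h1) h2 ih

lemma le (h : Rch G S m x y) (hmn : m ≤ n) : Rch G S n x y := by
  induction h generalizing n with
  | refl h => exact .refl h
  | step h1 h2 _ ih =>
    obtain ⟨k, rfl⟩ : ∃ k, n = k + 1 := ⟨n - 1, by omega⟩
    exact .step h1 h2 (ih (by omega))

lemma trans (h : Rch G S m x y) (h' : Rch G S n y z) : Rch G S (m + n) x z := by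
  induction h with
  | refl h => exact h'.le (by omega)
  | step h1 h2 _ ih => exact (Rch.step h1 h2 (ih h')).le (by omega)

lemma symm (h : Rch G S n x y) : Rch G S n y x := by
  induction h with
  | refl h => exact .refl h
  | step h1 h2 h3 ih =>
    exact ih.trans (Rch.step (n := 0) h3.mem_left h2.symm (.refl h1))

/-- The first step of a walk between different vertices. -/
lemma first (h : Rch G S n x y) (hxy : x ≠ y) :
    ∃ k c, n = k + 1 ∧ c ∈ S ∧ G.Adj x c ∧ Rch G S k c y := by
  cases h with
  | refl h => exact absurd rfl hxy
  | step h1 h2 h3 => exact ⟨_, _, rfl, h3.mem_left, h2, h3⟩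

lemma fold {S' : Set W'} (f : W → W') (hf : ∀ a ∈ S, f a ∈ S')
    (hadj : ∀ a ∈ S, ∀ b ∈ S, G.Adj a b → f a = f b ∨ G'.Adj (f a) (f b))
    (h : Rch G S n x y) : Rch G' S' n (f x) (f y) := by
  induction h with
  | refl h => exact .refl (hf _ h)
  | step h1 h2 h3 ih =>
    rcases hadj _ h1 _ h3.mem_left h2 with h | h
    · exact h ▸ ih.le (by omega)
    · exact .step (hf _ h1) h ih

/-- Pulling back a walk along an induced embedding. -/
lemma of_image {f : W → W'} (hST : S ⊆ T) (hf : Set.InjOn f T)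
    (hadj : ∀ a ∈ T, ∀ b ∈ T, G.Adj a b ↔ G'.Adj (f a) (f b)) {x' y' : W'}
    (h : Rch G' (f '' S) n x' y') (hx : x ∈ S) (hy : y ∈ S) (hx' : x' = f x) (hy' : y' = f y) :
    Rch G S n x y := by
  induction h generalizing x with
  | refl h =>
    obtain rfl : x = y := hf (hST hx) (hST hy) (hx'.symm.trans hy')
    exact .refl hx
  | step h1 h2 h3 ih =>
    obtain ⟨c, hc, rfl⟩ := h3.mem_left
    subst hx'
    exact .step hx ((hadj _ (hST hx) _ (hST hc)).2 h2) (ih hc rfl hy')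

end Rch

section Transport

variable {W W' : Type} {G : SimpleGraph W} {G' : SimpleGraph W'} {S T : Set W}

lemma Rch.image {f : W → W'} (hST : S ⊆ T)
    (hadj : ∀ a ∈ T, ∀ b ∈ T, G.Adj a b ↔ G'.Adj (f a) (f b)) {n : ℕ} {x y : W}
    (h : Rch G S n x y) : Rch G' (f '' S) n (f x) (f y) :=
  h.fold f (fun a ha => ⟨a, ha, rfl⟩)
    fun a ha b hb hab => Or.inr ((hadj a (hST ha) b (hST hb)).1 hab)

lemma conn_image {f : W → W'} (hST : S ⊆ T) (hf : Set.InjOn f T)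
    (hadj : ∀ a ∈ T, ∀ b ∈ T, G.Adj a b ↔ G'.Adj (f a) (f b)) :
    Conn G' (f '' S) ↔ Conn G S := by
  constructor
  · intro h x hx y hy
    obtain ⟨n, hn⟩ := h (f x) ⟨x, hx, rfl⟩ (f y) ⟨y, hy, rfl⟩
    exact ⟨n, hn.of_image hST hf hadj hx hy rfl rfl⟩
  · rintro h _ ⟨x, hx, rfl⟩ _ ⟨y, hy, rfl⟩
    obtain ⟨n, hn⟩ := h x hx y hy
    exact ⟨n, hn.image hST hadj⟩

lemma dhOn_image {f : W → W'} (hf : Set.InjOn f T)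
    (hadj : ∀ a ∈ T, ∀ b ∈ T, G.Adj a b ↔ G'.Adj (f a) (f b)) :
    DHOn G' (f '' T) ↔ DHOn G T := by
  constructor
  · rintro ⟨h1, h2⟩
    refine ⟨(conn_image subset_rfl hf hadj).1 h1, fun S hS hc x hx y hy n hn => ?_⟩
    exact (h2 (f '' S) (Set.image_mono hS) ((conn_image hS hf hadj).2 hc) _ ⟨x, hx, rfl⟩ _
      ⟨y, hy, rfl⟩ n (hn.image subset_rfl hadj)).of_image hS hf hadj hx hy rfl rfl
  · rintro ⟨h1, h2⟩
    refine ⟨(conn_image subset_rfl hf hadj).2 h1, fun S' hS' hc => ?_⟩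
    obtain ⟨S, hS, rfl⟩ := Set.subset_image_iff.1 hS'
    rintro _ ⟨x, hx, rfl⟩ _ ⟨y, hy, rfl⟩ n hn
    exact (h2 S hS ((conn_image hS hf hadj).1 hc) x hx y hy n
      (hn.of_image subset_rfl hf hadj (hS hx) (hS hy) rfl rfl)).image hS hadj

end Transport

section Connectivity

variable {W : Type} {G : SimpleGraph W} {S T : Set W} {a b : W}

lemma conn_singleton (a : W) : Conn G {a} := by
  rintro x rfl y rfl
  exact ⟨0, .refl rfl⟩

lemma Conn.union (hS : Conn G S) (hT : Conn G T) (ha : a ∈ S) (hb : b ∈ T)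
    (hab : G.Adj a b) : Conn G (S ∪ T) := by
  have key : ∀ x ∈ S ∪ T, ∃ n, Rch G (S ∪ T) n x a := by
    rintro x (hx | hx)
    · obtain ⟨n, hn⟩ := hS x hx a ha
      exact ⟨n, hn.mono Set.subset_union_left⟩
    · obtain ⟨n, hn⟩ := hT x hx b hb
      exact ⟨_, (hn.mono Set.subset_union_right).trans
        (.step (n := 0) (Or.inr hb) hab.symm (.refl (Or.inl ha)))⟩
  intro x hx y hy
  obtain ⟨n, hn⟩ := key x hx
  obtain ⟨m, hm⟩ := key y hy
  exact ⟨_, hn.trans hm.symm⟩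

lemma Conn.insert (hS : Conn G S) (ha : a ∈ S) (hab : G.Adj b a) : Conn G (insert b S) := by
  rw [Set.insert_eq]
  exact (conn_singleton b).union hS rfl ha hab

lemma DHOn.mono (h : DHOn G T) (hST : S ⊆ T) (hS : Conn G S) : DHOn G S :=
  ⟨hS, fun R hR hc x hx y hy n hn => h.2 R (hR.trans hST) hc x hx y hy n (hn.mono hST)⟩

end Connectivity

section Distance

variable {W : Type} {G : SimpleGraph W}

lemma rch_univ_iff (hG : Conn G Set.univ) {n : ℕ} {x y : W} :
    Rch G Set.univ n x y ↔ G.dist x y ≤ n := by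
  have key : ∀ {n x y}, Rch G Set.univ n x y → ∃ p : G.Walk x y, p.length ≤ n := by
    intro n x y h
    induction h with
    | refl h => exact ⟨.nil, by simp⟩
    | step h1 h2 h3 ih =>
      obtain ⟨p, hp⟩ := ih
      exact ⟨.cons h2 p, by simpa using hp⟩
  constructor
  · intro h
    obtain ⟨p, hp⟩ := key h
    exact (SimpleGraph.dist_le p).trans hp
  · intro h
    obtain ⟨m, hm⟩ := hG x trivial y trivial
    obtain ⟨p, -⟩ := key hm
    obtain ⟨q, hq⟩ := p.reachable.exists_walk_length_eq_dist
    have : ∀ {x y : W} (q : G.Walk x y), Rch G Set.univ q.length x y := by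
      intro x y q
      induction q with
      | nil => exact .refl trivial
      | cons h q ih => exact .step trivial h ih
    exact (this q).le (by omega)

lemma conn_univ_iff [Nonempty W] : Conn G Set.univ ↔ G.Connected := by
  constructor
  · intro h
    refine ⟨fun x y => ?_⟩
    obtain ⟨n, hn⟩ := h x trivial y trivial
    generalize Set.univ = S at hn
    induction hn with
    | refl h => exact .refl _
    | step h1 h2 h3 ih => exact h2.reachable.trans ih
  · intro h x _ y _
    obtain ⟨p⟩ := h x y
    induction p with
    | nil => exact ⟨0, .refl trivial⟩
    | cons h q ih =>
      obtain ⟨n, hn⟩ := ih trivial trivial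
      exact ⟨n + 1, .step trivial h hn⟩

lemma conn_iff_induce {S : Set W} (hS : S.Nonempty) : Conn G S ↔ (G.induce S).Connected := by
  have : Nonempty S := hS.to_subtype
  rw [← conn_univ_iff, ← conn_image (G' := G) (f := Subtype.val) subset_rfl
    Subtype.val_injective.injOn (by simp)]
  simp

lemma dhOn_univ_iff [Nonempty W] :
    DHOn G Set.univ ↔ G.Connected ∧ DistanceHereditary G := by
  rw [← conn_univ_iff]
  refine and_congr_right fun hG => ?_
  have key : ∀ (S : Set W) (hS : Conn G S) (x y : S) (n : ℕ),
      Rch G S n x y ↔ (G.induce S).dist x y ≤ n := by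
    intro S hS x y n
    have hadj : ∀ a ∈ (Set.univ : Set S), ∀ b ∈ (Set.univ : Set S),
      (G.induce S).Adj a b ↔ G.Adj (Subtype.val a) (Subtype.val b) := by simp
    have hi : Set.InjOn (Subtype.val : S → W) Set.univ := Subtype.val_injective.injOn
    have e : (Subtype.val : S → W) '' Set.univ = S := by simp
    have hc : Conn (G.induce S) Set.univ := by
      rw [← conn_image subset_rfl hi hadj, e]; exact hS
    rw [← rch_univ_iff hc]
    constructor
    · intro h
      exact Rch.of_image subset_rfl hi hadj (by rwa [e]) trivial trivial rfl rfl
    · intro h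
      have := h.image subset_rfl hadj
      rwa [e] at this
  constructor
  · intro h S hS u v
    have hc : Conn G S := (conn_iff_induce ⟨u.1, u.2⟩).2 hS
    refine le_antisymm ((key S hc u v _).1 (h S (Set.subset_univ S) hc _ u.2 _ v.2 _
      ((rch_univ_iff hG).2 le_rfl))) ?_
    exact (rch_univ_iff hG).1 (((key S hc u v _).2 le_rfl).mono (Set.subset_univ S))
  · intro h S _ hc x hx y hy n hn
    have := h S ((conn_iff_induce ⟨x, hx⟩).1 hc) ⟨x, hx⟩ ⟨y, hy⟩
    rw [key S hc ⟨x, hx⟩ ⟨y, hy⟩, this]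
    exact (rch_univ_iff hG).1 hn

end Distance

/-! ### Adding a pendant vertex or a twin -/

/-- Inside `T`, the vertex `u` is pendant at `w`. -/
def IsPendant {W : Type} (G : SimpleGraph W) (T : Set W) (u w : W) : Prop :=
  ∀ c ∈ T, G.Adj u c ↔ c = w

/-- Inside `T`, the vertices `u` and `w` are (true or false) twins. -/
def IsTwin {W : Type} (G : SimpleGraph W) (T : Set W) (u w : W) : Prop :=
  ∀ c ∈ T, c ≠ u → c ≠ w → (G.Adj u c ↔ G.Adj w c)

section Extension

variable {W : Type} {G : SimpleGraph W} {S T : Set W} {u w x y : W} {n : ℕ}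

lemma IsTwin.symm (h : IsTwin G T u w) : IsTwin G T w u :=
  fun c hc h1 h2 => (h c hc h2 h1).symm

lemma IsPendant.mono (h : IsPendant G T u w) (hST : S ⊆ T) : IsPendant G S u w :=
  fun c hc => h c (hST hc)

lemma IsTwin.mono (h : IsTwin G T u w) (hST : S ⊆ T) : IsTwin G S u w :=
  fun c hc => h c (hST hc)

open Classical in
/-- Folding `u` onto `w` shortens walks. -/
lemma Rch.fold_vertex (h : Rch G S n x y) (hw : w ∈ S) (huw : u ≠ w)
    (hext : IsPendant G S u w ∨ IsTwin G S u w) (hx : x ≠ u) (hy : y ≠ u) :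
    Rch G (S \ {u}) n x y := by
  have key : ∀ b ∈ S, G.Adj u b → w = b ∨ G.Adj w b := by
    intro b hb hub
    by_cases hbw : w = b
    · exact .inl hbw
    · rcases hext with hp | ht
      · exact .inl ((hp b hb).1 hub).symm
      · exact .inr ((ht b hb hub.ne' (Ne.symm hbw)).1 hub)
  have := h.fold (G' := G) (S' := S \ {u}) (fun a => if a = u then w else a)
    (by
      intro a ha
      split_ifs with h
      · exact ⟨hw, huw.symm⟩
      · exact ⟨ha, h⟩)
    (by
      intro a ha b hb hab
      by_cases h1 : a = u <;> by_cases h2 : b = u <;> simp only [h1, h2, if_true, if_false]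
      · exact .inl trivial
      · exact key b hb (h1 ▸ hab)
      · rcases key a ha (h2 ▸ hab.symm) with h | h
        · exact .inl h.symm
        · exact .inr h.symm
      · exact .inr hab)
  simpa [hx, hy] using this

lemma Conn.fold_vertex (h : Conn G S) (hw : w ∈ S) (huw : u ≠ w)
    (hext : IsPendant G S u w ∨ IsTwin G S u w) : Conn G (S \ {u}) := by
  intro x hx y hy
  obtain ⟨n, hn⟩ := h x hx.1 y hy.1
  exact ⟨n, hn.fold_vertex hw huw hext hx.2 hy.2⟩

lemma DHOn.remove (h : DHOn G T) (hw : w ∈ T) (huw : u ≠ w)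
    (hext : IsPendant G T u w ∨ IsTwin G T u w) : DHOn G (T \ {u}) :=
  h.mono Set.sdiff_subset (h.1.fold_vertex hw huw hext)

/-- A twin of the start of a walk can replace it. -/
lemma Rch.twin_left (h : Rch G S n w y) (hu : u ∈ S) (ht : IsTwin G S u w) (hy : y ≠ w)
    : Rch G S n u y := by
  obtain ⟨k, c, rfl, hc, hwc, hk⟩ := h.first hy.symm
  by_cases hcu : c = u
  · exact hcu ▸ hk.le (by omega)
  · exact .step hu ((ht c hc hcu hwc.ne').2 hwc) hk

lemma conn_of_diff (h : Conn G (T \ {u})) {a : W} (ha : a ∈ T \ {u}) (hua : G.Adj u a) :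
    Conn G (insert u (T \ {u})) := h.insert ha hua

/-- Isometry for subsets containing both vertices of a pendant or twin pair. -/
lemma isometric_of_mem_mem (hT : DHOn G (T \ {u})) (hu : u ∈ T) (huw : u ≠ w)
    (hext : IsPendant G T u w ∨ IsTwin G T u w) (hST : S ⊆ T) (hS : Conn G S) (huS : u ∈ S)
    (hwS : w ∈ S) (hx : x ∈ S) (hy : y ∈ S) (h : Rch G T n x y) : Rch G S n x y := by
  have hextS : IsPendant G S u w ∨ IsTwin G S u w := hext.imp (·.mono hST) (·.mono hST)
  have hS' := hS.fold_vertex hwS huw hextS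
  have main : ∀ {m a b}, a ∈ S → b ∈ S → a ≠ u → b ≠ u → Rch G T m a b → Rch G S m a b := by
    intro m a b ha hb hau hbu hm
    exact (hT.2 _ (Set.sdiff_subset_sdiff_left hST) hS' a ⟨ha, hau⟩ b ⟨hb, hbu⟩ m
      (hm.fold_vertex (hST hwS) huw hext hau hbu)).mono Set.sdiff_subset
  have fromU : ∀ {m b}, b ∈ S → b ≠ u → Rch G T m u b → Rch G S m u b := by
    intro m b hb hbu hm
    obtain ⟨k, c, rfl, hc, huc, hk⟩ := hm.first hbu.symm
    by_cases hcw : c = w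
    · subst hcw
      exact .step huS huc (main hwS hb huw.symm hbu hk)
    · have ht : IsTwin G T u w := by
        rcases hext with hp | ht
        · exact absurd ((hp c hc).1 huc) hcw
        · exact ht
      by_cases hbw : b = w
      · subst hbw
        obtain ⟨k0, c0, hk0, -⟩ := hk.first hcw
        obtain ⟨m', hm'⟩ := hS u huS b hb
        obtain ⟨_, e, _, he, hue, _⟩ := hm'.first huw
        by_cases hew : e = b
        · exact .step huS hue (hew ▸ .refl he)
        · have hbe : G.Adj b e := (ht e (hST he) hue.ne' hew).1 hue
          have h2 : Rch G S 2 u b := .step huS hue (.step he hbe.symm (.refl hb))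
          exact h2.le (by omega)
      · have hwb : Rch G T (k + 1) w b :=
          .step (hST hwS) ((ht c hc huc.ne' hcw).1 huc) hk
        exact (main hwS hb huw.symm hbu hwb).twin_left huS (ht.mono hST) hbw
  by_cases hxu : x = u
  · by_cases hyu : y = u
    · subst hxu; subst hyu; exact .refl hx
    · subst hxu; exact fromU hy hyu h
  · by_cases hyu : y = u
    · subst hyu; exact (fromU hx hxu h.symm).symm
    · exact main hx hy hxu hyu h

/-- Adding a pendant vertex or a twin preserves being connected and distance-hereditary. -/
lemma DHOn.extend (hT : DHOn G (T \ {u})) (hu : u ∈ T) (hw : w ∈ T) (huw : u ≠ w)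
    (hext : IsPendant G T u w ∨ IsTwin G T u w) (hr : ∃ r ∈ T, r ≠ u ∧ r ≠ w) : DHOn G T := by
  have hwT : w ∈ T \ {u} := ⟨hw, huw.symm⟩
  have hTu : insert u (T \ {u}) = T := by
    rw [Set.insert_sdiff_singleton, Set.insert_eq_of_mem hu]
  refine ⟨?_, ?_⟩
  · rw [← hTu]
    rcases hext with hp | ht
    · exact conn_of_diff hT.1 hwT ((hp w hw).2 rfl)
    · obtain ⟨r, hrT, hru, hrw⟩ := hr
      obtain ⟨n, hn⟩ := hT.1 w hwT r ⟨hrT, hru⟩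
      obtain ⟨_, c, _, hc, hwc, _⟩ := hn.first hrw.symm
      exact conn_of_diff hT.1 hc ((ht c hc.1 hc.2 hwc.ne').2 hwc)
  · intro S hST hS x hx y hy n hn
    by_cases huS : u ∈ S
    · by_cases hwS : w ∈ S
      · exact isometric_of_mem_mem hT hu huw hext hST hS huS hwS hx hy hn
      · by_cases hSu : ∃ c ∈ S, c ≠ u
        · obtain ⟨c, hc, hcu⟩ := hSu
          obtain ⟨m, hm⟩ := hS u huS c hc
          obtain ⟨_, e, _, he, hue, _⟩ := hm.first hcu.symm
          have hew : e ≠ w := fun h => hwS (h ▸ he)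
          rcases hext with hp | ht
          · exact absurd ((hp e (hST he)).1 hue) hew
          · have hwe : G.Adj w e := (ht e (hST he) hue.ne' hew).1 hue
            have hST' : insert w S ⊆ T := Set.insert_subset hw hST
            have h1 := isometric_of_mem_mem hT hu huw (.inr ht) hST' (hS.insert he hwe)
              (Or.inr huS) (Or.inl rfl) (Or.inr hx) (Or.inr hy) hn
            have h2 := h1.fold_vertex (u := w) (w := u) (Or.inr huS) huw.symm
              (.inr (ht.symm.mono hST')) (fun h => hwS (h ▸ hx)) (fun h => hwS (h ▸ hy))
            refine h2.mono ?_
            rintro a ⟨rfl | ha, hne⟩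
            · exact absurd rfl hne
            · exact ha
        · push Not at hSu
          rw [hSu x hx, hSu y hy]
          exact .refl huS
    · have hS' : S ⊆ T \ {u} := fun a ha => ⟨hST ha, fun h => huS (h ▸ ha)⟩
      exact hT.2 S hS' hS x hx y hy n (hn.fold_vertex hw huw hext (hS' hx).2 (hS' hy).2)

end Extension

/-! ### Twins in graphs without induced paths on four vertices -/

section Cograph

variable {W : Type}

/-- No induced path on four vertices inside `S`. -/
def PFourFree (G : SimpleGraph W) (S : Set W) : Prop :=
  ∀ a ∈ S, ∀ b ∈ S, ∀ c ∈ S, ∀ d ∈ S, G.Adj a b → G.Adj b c → G.Adj c d →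
    ¬ G.Adj a c → ¬ G.Adj a d → ¬ G.Adj b d → False

/-- `S` splits into two nonempty parts with no edges between them. -/
def Splits (G : SimpleGraph W) (S : Set W) : Prop :=
  ∃ A B, A.Nonempty ∧ B.Nonempty ∧ A ∪ B = S ∧ Disjoint A B ∧ ∀ a ∈ A, ∀ b ∈ B, ¬ G.Adj a b

lemma PFourFree.compl {G : SimpleGraph W} {S : Set W} (h : PFourFree G S) : PFourFree Gᶜ S := by
  intro a ha b hb c hc d hd hab hbc hcd hac had hbd
  simp only [SimpleGraph.compl_adj, not_and, not_not] at *
  have h1 : a ≠ c := by rintro rfl; exact hcd.2 (had hcd.1)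
  have h2 : a ≠ d := by rintro rfl; exact hcd.2 (hac hcd.1.symm).symm
  have h3 : b ≠ d := by rintro rfl; exact hab.2 (had hab.1)
  exact h b hb d hd a ha c hc (hbd h3) (had h2).symm (hac h1) (fun h => hab.2 h.symm) hbc.2
    (fun h => hcd.2 h.symm)

lemma Splits.insert_vertex {G : SimpleGraph W} {S : Set W} {w : W} (hw : w ∉ S)
    (hP : PFourFree G (insert w S)) (h : Splits G S) :
    Splits G (insert w S) ∨ Splits Gᶜ (insert w S) := by
  by_cases hall : ∀ b ∈ S, G.Adj w b
  · obtain ⟨A, B, hA, hB, hAB, hdis, -⟩ := h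
    refine .inr ⟨{w}, S, ⟨w, rfl⟩, ?_, rfl, by simpa using hw, ?_⟩
    · rw [← hAB]; exact hA.inl
    · rintro a rfl b hb hab
      exact hab.2 (hall b hb)
  · push Not at hall
    obtain ⟨b, hbS, hwb⟩ := hall
    left
    -- a nonempty part with a vertex not adjacent to `w`
    obtain ⟨A, B, hB, hAB, hdis, hno, hbA⟩ : ∃ A B : Set W, B.Nonempty ∧ A ∪ B = S ∧
        Disjoint A B ∧ (∀ a ∈ A, ∀ b ∈ B, ¬ G.Adj a b) ∧ b ∈ A := by
      obtain ⟨A, B, hA, hB, hAB, hdis, hno⟩ := h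
      rw [← hAB] at hbS
      rcases hbS with hb | hb
      · exact ⟨A, B, hB, hAB, hdis, hno, hb⟩
      · exact ⟨B, A, hA, by rw [Set.union_comm, hAB], hdis.symm,
          fun a ha b hb h => hno b hb a ha h.symm, hb⟩
    have hAS : A ⊆ S := hAB ▸ Set.subset_union_left
    have hBS : B ⊆ S := hAB ▸ Set.subset_union_right
    by_cases hwB : ∀ c ∈ B, ¬ G.Adj w c
    · refine ⟨B, insert w A, hB, ⟨w, .inl rfl⟩, ?_, ?_, ?_⟩
      · rw [Set.union_insert, Set.union_comm, hAB]
      · rw [Set.disjoint_insert_right]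
        exact ⟨fun h => hw (hBS h), hdis.symm⟩
      · rintro c hc x (rfl | hx) hcx
        · exact hwB c hc hcx.symm
        · exact hno x hx c hc hcx.symm
    · push Not at hwB
      obtain ⟨c, hcB, hwc⟩ := hwB
      refine ⟨{x ∈ A | ¬ G.Adj w x}, insert w ({x ∈ A | G.Adj w x} ∪ B), ⟨b, hbA, hwb⟩,
        ⟨w, .inl rfl⟩, ?_, ?_, ?_⟩
      · rw [← hAB]
        ext x
        simp only [Set.mem_union, Set.mem_insert_iff, Set.mem_ofPred_eq]
        tauto
      · rw [Set.disjoint_left]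
        rintro x ⟨hx, hwx⟩ (rfl | ⟨-, h⟩ | h)
        · exact hw (hAS hx)
        · exact hwx h
        · exact Set.disjoint_left.1 hdis hx h
      · rintro x ⟨hx, hwx⟩ y (rfl | ⟨hy, hwy⟩ | hy) hxy
        · exact hwx hxy.symm
        · exact hP x (.inr (hAS hx)) y (.inr (hAS hy)) w (.inl rfl) c (.inr (hBS hcB)) hxy
            hwy.symm hwc (fun h => hwx h.symm) (hno x hx c hcB) (hno y hy c hcB)
        · exact hno x hx y hy hxy

lemma PFourFree.splits {G : SimpleGraph W} {S : Set W} (hS : S.Finite) :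
    PFourFree G S → S.Nontrivial → Splits G S ∨ Splits Gᶜ S := by
  induction S, hS using Set.Finite.induction_on with
  | empty => intro _ h; exact absurd h (by simp)
  | @insert w S hw _ ih =>
    intro hP hnt
    by_cases hSn : S.Nontrivial
    · rcases ih (fun a ha b hb c hc d hd => hP a (.inr ha) b (.inr hb) c (.inr hc) d (.inr hd))
        hSn with h | h
      · exact h.insert_vertex hw hP
      · have := h.insert_vertex hw hP.compl
        rwa [compl_compl, or_comm] at this
    · rw [Set.not_nontrivial_iff] at hSn
      rcases hSn.eq_empty_or_singleton with rfl | ⟨b, rfl⟩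
      · simp at hnt
      · have hwb : w ≠ b := hw
        by_cases hab : G.Adj w b
        · refine .inr ⟨{w}, {b}, ⟨w, rfl⟩, ⟨b, rfl⟩, rfl, by simpa using hwb, ?_⟩
          rintro _ rfl _ rfl h
          exact h.2 hab
        · refine .inl ⟨{w}, {b}, ⟨w, rfl⟩, ⟨b, rfl⟩, rfl, by simpa using hwb, ?_⟩
          rintro _ rfl _ rfl h
          exact hab h

lemma PFourFree.exists_twins {G : SimpleGraph W} {S : Set W} (hS : S.Finite)
    (hP : PFourFree G S) (hnt : S.Nontrivial) :
    ∃ u ∈ S, ∃ w ∈ S, u ≠ w ∧ IsTwin G S u w := by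
  induction hn : S.ncard using Nat.strong_induction_on generalizing S with
  | _ n ih =>
  subst hn
  obtain ⟨A, B, hA, hB, rfl, hdis, hunif⟩ : ∃ A B, A.Nonempty ∧ B.Nonempty ∧ A ∪ B = S ∧
      Disjoint A B ∧ ∃ p : Prop, ∀ a ∈ A, ∀ b ∈ B, (G.Adj a b ↔ p) := by
    rcases hP.splits hS hnt with ⟨A, B, hA, hB, hAB, hdis, h⟩ | ⟨A, B, hA, hB, hAB, hdis, h⟩
    · exact ⟨A, B, hA, hB, hAB, hdis, False, fun a ha b hb => by simpa using h a ha b hb⟩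
    · refine ⟨A, B, hA, hB, hAB, hdis, True, fun a ha b hb => ?_⟩
      have hne : a ≠ b := fun e => Set.disjoint_left.1 hdis ha (e ▸ hb)
      have := h a ha b hb
      simp only [SimpleGraph.compl_adj, not_and, not_not] at this
      simpa using this hne
  obtain ⟨p, hunif⟩ := hunif
  have hfA := hS.subset Set.subset_union_left
  have hfB := hS.subset Set.subset_union_right
  have hcard : (A ∪ B).ncard = A.ncard + B.ncard := Set.ncard_union_eq hdis hfA hfB
  have hA0 := (Set.ncard_pos hfA).2 hA
  have hB0 := (Set.ncard_pos hfB).2 hB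
  by_cases hAn : A.Nontrivial
  · obtain ⟨u, hu, w, hw, huw, ht⟩ := ih A.ncard (by omega) hfA
      (fun a ha b hb c hc d hd => hP a (.inl ha) b (.inl hb) c (.inl hc) d (.inl hd)) hAn rfl
    refine ⟨u, .inl hu, w, .inl hw, huw, ?_⟩
    rintro c (hc | hc) h1 h2
    · exact ht c hc h1 h2
    · rw [hunif u hu c hc, hunif w hw c hc]
  by_cases hBn : B.Nontrivial
  · obtain ⟨u, hu, w, hw, huw, ht⟩ := ih B.ncard (by omega) hfB
      (fun a ha b hb c hc d hd => hP a (.inr ha) b (.inr hb) c (.inr hc) d (.inr hd)) hBn rfl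
    refine ⟨u, .inr hu, w, .inr hw, huw, ?_⟩
    rintro c (hc | hc) h1 h2
    · rw [G.adj_comm, G.adj_comm w, hunif c hc u hu, hunif c hc w hw]
    · exact ht c hc h1 h2
  · rw [Set.not_nontrivial_iff] at hAn hBn
    obtain ⟨a, ha⟩ := hA
    obtain ⟨b, hb⟩ := hB
    refine ⟨a, .inl ha, b, .inr hb, fun e => Set.disjoint_left.1 hdis ha (e ▸ hb), ?_⟩
    rintro c (hc | hc) h1 h2
    · exact absurd (hAn hc ha) h1
    · exact absurd (hBn hc hb) h2

end Cograph

/-! ### A connected distance-hereditary graph has a twin or pendant vertex besides the root -/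

section Pruning

variable {W : Type} {G : SimpleGraph W} {S R : Set W} {v : W}

lemma dist_le_of_adj (hG : DHOn G Set.univ) (v : W) {x y : W} (h : G.Adj x y) :
    G.dist x v ≤ G.dist y v + 1 := by
  rw [← rch_univ_iff hG.1]
  exact .step trivial h ((rch_univ_iff hG.1).2 le_rfl)

lemma eq_root_of_dist (hG : DHOn G Set.univ) {x : W} (h : G.dist x v = 0) : x = v := by
  have := (rch_univ_iff hG.1).2 h.le
  cases this
  rfl

lemma exists_closer (hG : DHOn G Set.univ) (hS : Conn G S) (hv : v ∈ S) {x : W} (hx : x ∈ S)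
    (hxv : x ≠ v) : ∃ c ∈ S, G.Adj x c ∧ G.dist x v = G.dist c v + 1 := by
  have h := hG.2 S (Set.subset_univ S) hS x hx v hv _ ((rch_univ_iff hG.1).2 le_rfl)
  obtain ⟨k, c, hk, hc, hxc, hcv⟩ := h.first hxv
  have := (rch_univ_iff hG.1).1 (hcv.mono (Set.subset_univ S))
  have := dist_le_of_adj hG v hxc
  exact ⟨c, hc, hxc, by omega⟩

lemma exists_common_neighbor (hG : DHOn G Set.univ) (hS : Conn G S) {x y e : W} (hx : x ∈ S)
    (hy : y ∈ S) (hxy : x ≠ y) (hadj : ¬ G.Adj x y) (h1 : G.Adj x e) (h2 : G.Adj e y) :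
    ∃ c ∈ S, G.Adj x c ∧ G.Adj c y := by
  have h : Rch G Set.univ 2 x y := .step trivial h1 (.step trivial h2 (.refl trivial))
  obtain ⟨k, c, hk, hc, hxc, hcy⟩ := (hG.2 S (Set.subset_univ S) hS x hx y hy _ h).first hxy
  obtain rfl : k = 1 := by omega
  have hne : c ≠ y := fun e => hadj (e ▸ hxc)
  obtain ⟨k, c', hk, hc', hcc', hcy⟩ := hcy.first hne
  obtain rfl : k = 0 := by omega
  cases hcy
  exact ⟨c, hc, hxc, hcc'⟩

/-- A vertex set of a geodesic to the root. -/
lemma exists_geodesic (hG : DHOn G Set.univ) (v x : W) :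
    ∃ S, x ∈ S ∧ v ∈ S ∧ Conn G S ∧ ∀ c ∈ S, c = x ∨ G.dist c v < G.dist x v := by
  induction hn : G.dist x v using Nat.strong_induction_on generalizing x with
  | _ n ih =>
  subst hn
  by_cases hxv : x = v
  · subst hxv
    exact ⟨{x}, rfl, rfl, conn_singleton x, fun c hc => .inl hc⟩
  · obtain ⟨c, -, hxc, hd⟩ := exists_closer hG hG.1 (v := v) trivial (x := x) trivial hxv
    obtain ⟨S, hcS, hvS, hS, h⟩ := ih _ (by omega) c rfl
    refine ⟨insert x S, .inl rfl, .inr hvS, hS.insert hcS hxc, ?_⟩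
    rintro a (rfl | ha)
    · exact .inl rfl
    · rcases h a ha with rfl | h <;> right <;> omega

/-- Vertices of equal level in a connected set of no lower level have the same neighbours
one level below. -/
lemma adj_of_level (hG : DHOn G Set.univ) {k : ℕ} (hR : Conn G R)
    (hRk : ∀ c ∈ R, k + 1 ≤ G.dist c v) {x y z : W} (hx : x ∈ R) (hy : y ∈ R)
    (hyk : G.dist y v = k + 1) (hz : G.dist z v = k) (hxz : G.Adj x z) : G.Adj y z := by
  obtain ⟨S, hzS, hvS, hS, hSd⟩ := exists_geodesic hG v z
  have hyv : y ≠ v := by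
    rintro rfl
    simp at hyk
  obtain ⟨c, hc, hyc, hd⟩ := exists_closer hG (hS.union hR hzS hx hxz.symm) (.inl hvS)
    (.inr hy) hyv
  rcases hc with hc | hc
  · rcases hSd c hc with rfl | h
    · exact hyc
    · omega
  · have := hRk c hc
    omega

lemma conn_pair {a b : W} (h : G.Adj a b) : Conn G {a, b} := (conn_singleton b).insert rfl h

/-- Two vertices below a common upper neighbour have the same neighbours further down. -/
lemma adj_of_common_up (hG : DHOn G Set.univ) {k : ℕ} {u a b z : W}
    (hu : G.dist u v = k + 2) (ha : G.dist a v = k + 1) (hb : G.dist b v = k + 1)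
    (hua : G.Adj u a) (hub : G.Adj u b) (hz : G.dist z v = k) (haz : G.Adj a z) : G.Adj b z := by
  refine adj_of_level hG (R := {a, u, b}) ((conn_pair hub).insert (.inl rfl) hua.symm) ?_
    (.inl rfl) (.inr (.inr rfl)) hb hz haz
  rintro c (rfl | rfl | rfl) <;> omega

lemma false_of_path_four (hG : DHOn G Set.univ) {a b c d e : W} (hab : G.Adj a b)
    (hbc : G.Adj b c) (hcd : G.Adj c d) (hac : ¬ G.Adj a c) (had : ¬ G.Adj a d)
    (hbd : ¬ G.Adj b d) (hae : G.Adj a e) (hde : G.Adj d e) : False := by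
  have hne : a ≠ d := by rintro rfl; exact hbd hab.symm
  have hC : Conn G {a, b, c, d} := by
    exact ((conn_pair hcd).insert (.inl rfl) hbc).insert (.inl rfl) hab
  obtain ⟨x, hx, h1, h2⟩ := exists_common_neighbor hG hC (x := a) (y := d) (by simp) (by simp)
    hne had hae hde.symm
  rcases hx with rfl | rfl | rfl | rfl
  · exact had h2
  · exact hbd h2
  · exact hac h1
  · exact had h1

lemma pFourFree_of_common (hG : DHOn G Set.univ) {e : W} (h : ∀ x ∈ S, G.Adj x e) :
    PFourFree G S :=
  fun a ha _ _ _ _ d hd hab hbc hcd hac had hbd =>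
    false_of_path_four hG hab hbc hcd hac had hbd (h a ha) (h d hd)

lemma exists_twins_of_module [Finite W] (hG : DHOn G Set.univ) {e : W}
    (hS : S.Nontrivial) (he : ∀ x ∈ S, G.Adj x e)
    (hmod : ∀ c ∉ S, ∀ a ∈ S, ∀ b ∈ S, G.Adj c a → G.Adj c b) :
    ∃ u ∈ S, ∃ w ∈ S, u ≠ w ∧ IsTwin G Set.univ u w := by
  obtain ⟨u, hu, w, hw, huw, ht⟩ := (pFourFree_of_common hG he).exists_twins S.toFinite hS
  refine ⟨u, hu, w, hw, huw, fun c _ h1 h2 => ?_⟩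
  by_cases hc : c ∈ S
  · exact ht c hc h1 h2
  · rw [G.adj_comm, G.adj_comm w]
    exact ⟨hmod c hc u hu w hw, hmod c hc w hw u hu⟩

/-- The neighbourhood of a vertex of the (independent) last level with the fewest neighbours is
a module. -/
lemma module_of_min [Finite W] (hG : DHOn G Set.univ) {k : ℕ} {u : W}
    (hmax : ∀ x, G.dist x v ≤ k + 2) (hu : G.dist u v = k + 2)
    (hind : ∀ x y, G.dist x v = k + 2 → G.dist y v = k + 2 → ¬ G.Adj x y)
    (hmin : ∀ y, G.dist y v = k + 2 → (G.neighborSet u).ncard ≤ (G.neighborSet y).ncard) :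
    ∀ c ∉ G.neighborSet u, ∀ a ∈ G.neighborSet u, ∀ b ∈ G.neighborSet u,
      G.Adj c a → G.Adj c b := by
  have hup : ∀ y x, G.dist y v = k + 2 → G.Adj y x → G.dist x v = k + 1 := by
    intro y x hy hyx
    have h1 := dist_le_of_adj hG v hyx
    have h2 := hmax x
    have h3 : G.dist x v ≠ k + 2 := fun h => hind y x hy h hyx
    omega
  have hdown : ∀ a, G.dist a v = k + 1 → ∃ e, G.Adj a e ∧ G.dist e v = k := by
    intro a ha
    obtain ⟨e, -, h1, h2⟩ := exists_closer hG hG.1 (v := v) trivial (x := a) trivial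
      (by rintro rfl; simp at ha)
    exact ⟨e, h1, by omega⟩
  have hlev : ∀ {x y}, G.dist x v + 2 ≤ G.dist y v → ¬ G.Adj x y := by
    intro x y h hxy
    have := dist_le_of_adj hG v hxy.symm
    omega
  -- neighbours in the same level
  have same : ∀ {u y a b}, G.dist u v = k + 2 → G.dist y v = k + 1 → ¬ G.Adj u y →
      G.Adj u a → G.Adj u b → G.Adj y a → G.Adj y b := by
    intro u y a b hu hy huy hua hub hya
    by_contra hyb
    have ha := hup u a hu hua
    have hb := hup u b hu hub
    obtain ⟨e, hae, he⟩ := hdown a ha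
    have hbe := adj_of_common_up hG hu ha hb hua hub he hae
    have hye : G.Adj y e := by
      refine adj_of_level hG (R := {y, a}) (conn_pair hya) ?_ (.inr rfl) (.inl rfl) hy he hae
      rintro c (rfl | rfl) <;> omega
    have hue : ¬ G.Adj u e := fun h => hlev (by omega) h.symm
    by_cases hab : G.Adj a b
    · exact false_of_path_four hG hub hbe hye.symm hue huy (fun h => hyb h.symm) hua hya
    · exact false_of_path_four hG hya hua.symm hub (fun h => huy h.symm) hyb hab hye hbe
  intro y hyu a hua b hub hya
  change G.Adj u a at hua
  change G.Adj u b at hub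
  change ¬ G.Adj u y at hyu
  have ha := hup u a hu hua
  have hb := hup u b hu hub
  have h1 := dist_le_of_adj hG v hya.symm
  have h2 := hmax y
  obtain hy | hy | hy : G.dist y v = k ∨ G.dist y v = k + 1 ∨ G.dist y v = k + 2 := by omega
  · exact (adj_of_common_up hG hu ha hb hua hub hy hya.symm).symm
  · exact same hu hy hyu hua hub hya
  · by_contra hyb
    obtain ⟨d, hyd, hud⟩ : ∃ d, G.Adj y d ∧ ¬ G.Adj u d := by
      by_contra! h
      have hss : G.neighborSet y ⊂ G.neighborSet u :=
        ⟨fun d hd => h d hd, fun hs => hyb (hs hub)⟩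
      exact absurd (Set.ncard_lt_ncard hss) (not_lt.2 (hmin y hy))
    have hd := hup y d hy hyd
    obtain ⟨e, hae, he⟩ := hdown a ha
    have hbe := adj_of_common_up hG hu ha hb hua hub he hae
    have hde := adj_of_common_up hG hy ha hd hya hyd he hae
    have huy : ¬ G.Adj u y := hind u y hu hy
    have hdab : G.Adj d a ↔ G.Adj d b :=
      ⟨same hu hd hud hua hub, same hu hd hud hub hua⟩
    have hbad : G.Adj b a ↔ G.Adj b d :=
      ⟨same hy hb hyb hya hyd, same hy hb hyb hyd hya⟩
    by_cases had : G.Adj d a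
    · exact false_of_path_four hG hub (hdab.1 had).symm hyd.symm hud huy
        (fun h => hyb h.symm) hua hya
    · have hbd : ¬ G.Adj b d := fun h => had (hdab.2 h.symm)
      have hue : ¬ G.Adj u e := fun h => hlev (by omega) h.symm
      have hye : ¬ G.Adj y e := fun h => hlev (by omega) h.symm
      have hC : Conn G {u, b, e, d, y} := by
        exact (((conn_pair hyd.symm).insert (.inl rfl) hde.symm).insert (.inl rfl) hbe).insert
          (.inl rfl) hub
      have huy' : u ≠ y := by
        rintro rfl
        exact hyb hub
      obtain ⟨x, hx, hx1, hx2⟩ := exists_common_neighbor hG hC (x := u) (y := y) (by simp)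
        (by simp) huy' huy hua hya.symm
      rcases hx with rfl | rfl | rfl | rfl | rfl
      · exact huy hx2
      · exact hyb hx2.symm
      · exact hue hx1
      · exact hud hx1
      · exact huy hx1

/-- A finite connected distance-hereditary graph has, besides a given root, a vertex that is
pendant or a twin of another vertex. -/
theorem exists_pendant_or_twin [Finite W] (hG : DHOn G Set.univ) (v : W) (hv : ∃ x, x ≠ v) :
    ∃ u w, u ≠ v ∧ u ≠ w ∧ (IsPendant G Set.univ u w ∨ IsTwin G Set.univ u w) := by
  have : Nonempty W := ⟨v⟩
  obtain ⟨x0, hx0⟩ := Finite.exists_max (fun x => G.dist x v)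
  obtain ⟨k, hk⟩ : ∃ k, G.dist x0 v = k + 1 := by
    obtain ⟨x, hx⟩ := hv
    refine ⟨G.dist x0 v - 1, ?_⟩
    have h1 := hx0 x
    have h2 : G.dist x v ≠ 0 := fun h => hx (eq_root_of_dist hG h)
    omega
  have hmax : ∀ x, G.dist x v ≤ k + 1 := fun x => hk ▸ hx0 x
  have hne : ∀ {x j}, G.dist x v = j + 1 → x ≠ v := by
    rintro x j h rfl
    simp at h
  by_cases hind : ∀ x y, G.dist x v = k + 1 → G.dist y v = k + 1 → ¬ G.Adj x y
  · obtain ⟨u, hu, hmin⟩ := Set.exists_min_image {x | G.dist x v = k + 1}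
      (fun x => (G.neighborSet x).ncard) (Set.toFinite _) ⟨x0, hk⟩
    change G.dist u v = k + 1 at hu
    obtain ⟨w, -, huw, hw⟩ := exists_closer hG hG.1 (v := v) trivial (x := u) trivial (hne hu)
    by_cases hN : (G.neighborSet u).Nontrivial
    · have hk1 : ∀ a, G.Adj u a → G.dist a v = k := by
        intro a ha
        have h1 := dist_le_of_adj hG v ha
        have h2 := hmax a
        have h3 : G.dist a v ≠ k + 1 := fun h => hind u a hu h ha
        omega
      obtain ⟨j, rfl⟩ : ∃ j, k = j + 1 := by
        obtain ⟨a, ha, b, hb, hab⟩ := hN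
        refine ⟨k - 1, ?_⟩
        have : k ≠ 0 := by
          rintro rfl
          exact hab ((eq_root_of_dist hG (hk1 a ha)).trans (eq_root_of_dist hG (hk1 b hb)).symm)
        omega
      obtain ⟨a, ha, b, hb, hab, ht⟩ := exists_twins_of_module hG hN (e := u)
        (fun x hx => SimpleGraph.Adj.symm hx) (module_of_min hG hmax hu hind hmin)
      exact ⟨a, b, hne (hk1 a ha), hab, .inr ht⟩
    · rw [Set.not_nontrivial_iff] at hN
      refine ⟨u, w, hne hu, huw.ne, .inl fun c _ => ⟨fun h => hN h huw, ?_⟩⟩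
      rintro rfl
      exact huw
  · push Not at hind
    obtain ⟨x, y, hx, hy, hxy⟩ := hind
    obtain ⟨e, -, hxe, he⟩ := exists_closer hG hG.1 (v := v) trivial (x := x) trivial (hne hx)
    have hedge : ∀ {a b z}, G.dist a v = k + 1 → G.dist b v = k + 1 → G.Adj a b →
        G.dist z v = k → G.Adj a z → G.Adj b z := by
      intro a b z ha hb hab hz haz
      refine adj_of_level hG (R := {a, b}) (conn_pair hab) ?_ (.inl rfl) (.inr rfl) hb hz haz
      rintro c (rfl | rfl) <;> omega
    have hdown : ∀ z, G.dist z v = k → ∀ {n c x}, Rch G {c | G.dist c v = k + 1} n c x →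
        (G.Adj c z ↔ G.Adj x z) := by
      intro z hz n c x h
      induction h with
      | refl h => rfl
      | step h1 h2 h3 ih =>
        rw [← ih]
        exact ⟨hedge h1 h3.mem_left h2 hz, hedge h3.mem_left h1 h2.symm hz⟩
    let S : Set W := {c | ∃ n, Rch G {c | G.dist c v = k + 1} n c x}
    have hSk : ∀ c ∈ S, G.dist c v = k + 1 := fun c ⟨n, hn⟩ => hn.mem_left
    have hxS : x ∈ S := ⟨0, .refl hx⟩
    have hyS : y ∈ S := ⟨1, .step hy hxy.symm (.refl hx)⟩
    obtain ⟨a, ha, b, -, hab, ht⟩ := exists_twins_of_module hG (S := S) (e := e)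
      ⟨x, hxS, y, hyS, hxy.ne⟩ (fun c ⟨n, hn⟩ => (hdown e (by omega) hn).2 hxe) (by
        intro c hc a ha b hb hca
        have h1 := dist_le_of_adj hG v hca.symm
        have h2 := hmax c
        have h3 := hSk a ha
        obtain hck | hck : G.dist c v = k ∨ G.dist c v = k + 1 := by omega
        · obtain ⟨n, hn⟩ := ha
          obtain ⟨m, hm⟩ := hb
          exact ((hdown c hck hm).2 ((hdown c hck hn).1 hca.symm)).symm
        · obtain ⟨n, hn⟩ := ha
          exact absurd ⟨n + 1, .step hck hca hn⟩ hc)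
    exact ⟨a, b, hne (hSk a ha), hab, .inr ht⟩

end Pruning

/-! ### Marked graphs up to isomorphism -/

/-- A finite graph with a set of marked vertices (the neighbours of an external root). -/
structure MGraph : Type 1 where
  /-- the vertices -/
  V : Type
  [fin : Finite V]
  /-- the edges -/
  graph : SimpleGraph V
  /-- the marked vertices -/
  mark : Set V

attribute [instance] MGraph.fin

/-- Isomorphism of marked graphs. -/
def MGraph.Iso (X Y : MGraph) : Prop :=
  ∃ e : X.V ≃ Y.V, (∀ a b, Y.graph.Adj (e a) (e b) ↔ X.graph.Adj a b) ∧
    ∀ a, e a ∈ Y.mark ↔ a ∈ X.mark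

instance MGraph.setoid : Setoid MGraph where
  r := MGraph.Iso
  iseqv :=
    { refl := fun X => ⟨Equiv.refl _, fun _ _ => Iff.rfl, fun _ => Iff.rfl⟩
      symm := fun {X Y} ⟨e, h1, h2⟩ => ⟨e.symm, fun a b => by simp [← h1], fun a => by simp [← h2]⟩
      trans := fun {X Y Z} ⟨e, h1, h2⟩ ⟨e', h1', h2'⟩ =>
        ⟨e.trans e', fun a b => by simp [h1, h1'], fun a => by simp [h2, h2']⟩ }

/-- Isomorphism classes of marked graphs. -/
def MClass : Type 1 := Quotient MGraph.setoid

/-- The class of the subgraph of `G` induced on `S`, with the vertices in `A` marked. -/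
def cls {W : Type} [Finite W] (G : SimpleGraph W) (S A : Set W) : MClass :=
  Quotient.mk MGraph.setoid ⟨S, G.induce S, {x | x.1 ∈ A}⟩

/-- Disjoint union of two marked graphs (`c` false), or the graph obtained by joining the marked
vertices of the first to those of the second and keeping only the former marked (`c` true). -/
def MGraph.glue (c : Prop) (X Y : MGraph) : MGraph where
  V := X.V ⊕ Y.V
  graph :=
    { Adj := fun a b =>
        match a, b with
        | .inl a, .inl b => X.graph.Adj a b
        | .inr a, .inr b => Y.graph.Adj a b
        | .inl a, .inr b => c ∧ a ∈ X.mark ∧ b ∈ Y.mark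
        | .inr b, .inl a => c ∧ a ∈ X.mark ∧ b ∈ Y.mark
      symm := ⟨by
        rintro (a | a) (b | b) h
        · exact SimpleGraph.Adj.symm h
        · exact h
        · exact h
        · exact SimpleGraph.Adj.symm h⟩
      loopless := ⟨by rintro (a | a) h <;> exact SimpleGraph.irrefl _ h⟩ }
  mark := {a | Sum.elim (fun a => a ∈ X.mark) (fun b => ¬ c ∧ b ∈ Y.mark) a}

/-- Complement the graph inside the set `A`. -/
def flipGraph {W : Type} (G : SimpleGraph W) (A : Set W) : SimpleGraph W where
  Adj a b := a ≠ b ∧ (G.Adj a b ↔ ¬ (a ∈ A ∧ b ∈ A))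
  symm := ⟨fun a b h => ⟨h.1.symm, by rw [G.adj_comm, h.2, and_comm]⟩⟩
  loopless := ⟨fun a h => h.1 rfl⟩

lemma flipGraph_flipGraph {W : Type} (G : SimpleGraph W) (A : Set W) :
    flipGraph (flipGraph G A) A = G := by
  ext a b
  by_cases hab : a = b
  · subst hab; simp [flipGraph]
  · simp only [flipGraph, ne_eq, hab, not_false_iff, true_and]; tauto

namespace MClass

variable {W : Type} [Finite W] {G G' : SimpleGraph W} {S S' S₁ S₂ A A' B : Set W} {c : Prop}
  {x y z w : MClass}

/-- The operation `MGraph.glue` on classes. -/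
def glue (c : Prop) : MClass → MClass → MClass :=
  Quotient.map₂ (MGraph.glue c) (by
    rintro X X' ⟨e, h1, h2⟩ Y Y' ⟨f, h3, h4⟩
    refine ⟨Equiv.sumCongr e f, ?_, ?_⟩
    · rintro (a | a) (b | b)
      · exact h1 a b
      · exact and_congr_right fun _ => and_congr (h2 a) (h4 b)
      · exact and_congr_right fun _ => and_congr (h2 b) (h4 a)
      · exact h3 a b
    · rintro (a | a)
      · exact h2 a
      · exact and_congr_right fun _ => h4 a)

/-- Complementation among the marked vertices. -/
def tau : MClass → MClass :=
  Quotient.map (fun X => ⟨X.V, flipGraph X.graph X.mark, X.mark⟩) (by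
    rintro X X' ⟨e, h1, h2⟩
    exact ⟨e, fun a b => by simp [flipGraph, h1, h2], h2⟩)

/-- The number of vertices. -/
noncomputable def size : MClass → ℕ :=
  Quotient.lift (fun X => Nat.card X.V) (fun _ _ ⟨e, _⟩ => Nat.card_congr e)

instance : Zero MClass := ⟨Quotient.mk MGraph.setoid ⟨Empty, ⊥, ∅⟩⟩
instance : One MClass := ⟨Quotient.mk MGraph.setoid ⟨Unit, ⊥, Set.univ⟩⟩
instance : Add MClass := ⟨glue False⟩
/-- Multiplication is the join along marked vertices. -/
instance : Mul MClass := ⟨glue True⟩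

lemma add_def : x + y = glue False x y := rfl
lemma mul_def : x * y = glue True x y := rfl

lemma cls_eq_mk {X : MGraph} (f : X.V → W) (hf : Function.Injective f) (hS : Set.range f = S)
    (hG : ∀ a b, G.Adj (f a) (f b) ↔ X.graph.Adj a b) (hA : ∀ a, f a ∈ A ↔ a ∈ X.mark) :
    cls G S A = Quotient.mk MGraph.setoid X := by
  subst hS
  refine Eq.symm (Quotient.sound ⟨Equiv.ofInjective f hf, fun a b => ?_, fun a => ?_⟩)
  · simpa using hG a b
  · simpa using hA a

lemma exists_cls (x : MClass) : ∃ (W : Type) (_ : Finite W) (G : SimpleGraph W) (A : Set W),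
    x = cls G Set.univ A := by
  induction x using Quotient.inductionOn with
  | _ X =>
    exact ⟨X.V, X.fin, X.graph, X.mark, (cls_eq_mk id Function.injective_id (by simp)
      (fun _ _ => Iff.rfl) (fun _ => Iff.rfl)).symm⟩

lemma cls_congr (hG : ∀ a ∈ S, ∀ b ∈ S, G.Adj a b ↔ G'.Adj a b) (hA : ∀ a ∈ S, a ∈ A ↔ a ∈ A') :
    cls G S A = cls G' S A' :=
  cls_eq_mk Subtype.val Subtype.val_injective Subtype.range_val
    (fun a b => hG a a.2 b b.2) (fun a => hA a a.2)

lemma cls_congr_mark (hA : ∀ a ∈ S, a ∈ A ↔ a ∈ A') : cls G S A = cls G S A' :=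
  cls_congr (fun _ _ _ _ => Iff.rfl) hA

@[simp] lemma size_cls : size (cls G S A) = S.ncard := rfl

lemma cls_eq_zero : cls G S A = 0 ↔ S = ∅ := by
  constructor
  · intro h
    have := congrArg size h
    rw [size_cls] at this
    rw [← Set.ncard_eq_zero, this]
    simp [size, OfNat.ofNat, Zero.zero]
  · rintro rfl
    exact cls_eq_mk (fun a : Empty => a.elim) (fun a => a.elim) (by ext; simp) (fun a => a.elim)
      (fun a => a.elim)

lemma cls_ne_zero : cls G S A ≠ 0 ↔ S.Nonempty := by
  rw [Ne, cls_eq_zero, Set.nonempty_iff_ne_empty]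

lemma cls_singleton {u : W} (hu : u ∈ A) : cls G {u} A = 1 :=
  cls_eq_mk (fun _ : Unit => u) (fun _ _ _ => rfl) (by simp) (fun a b => by simp)
    (fun a => by simp [hu])

lemma cls_eq_one : cls G S A = 1 → ∃ u ∈ A, S = {u} := by
  intro h
  obtain ⟨e, h1, h2⟩ := Quotient.exact h
  refine ⟨(e.symm ()).1, ?_, ?_⟩
  · have := h2 (e.symm ())
    exact this.1 trivial
  · ext a
    constructor
    · intro ha
      have : (⟨a, ha⟩ : S) = e.symm () := e.injective rfl
      simp [← this]
    · rintro rfl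
      exact (e.symm ()).2

lemma size_eq_zero : size x = 0 ↔ x = 0 := by
  obtain ⟨W, _, G, A, rfl⟩ := x.exists_cls
  rw [size_cls, cls_eq_zero, Set.ncard_eq_zero]

@[simp] lemma size_zero : size 0 = 0 := size_eq_zero.2 rfl
@[simp] lemma size_one : size 1 = 1 := by
  rw [← cls_singleton (G := (⊥ : SimpleGraph Unit)) (Set.mem_univ ()), size_cls,
    Set.ncard_singleton]

/-- `S` splits into `S₁` and `S₂` according to `MGraph.glue`. -/
structure Split (c : Prop) (G : SimpleGraph W) (S A S₁ S₂ B : Set W) : Prop where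
  union : S₁ ∪ S₂ = S
  disj : Disjoint S₁ S₂
  adj : ∀ a ∈ S₁, ∀ b ∈ S₂, G.Adj a b ↔ c ∧ a ∈ A ∧ b ∈ B
  mark : ∀ b ∈ S₂, b ∈ A ↔ ¬ c ∧ b ∈ B

lemma Split.cls_eq (h : Split c G S A S₁ S₂ B) : cls G S A = glue c (cls G S₁ A) (cls G S₂ B) := by
  refine cls_eq_mk (X := MGraph.glue c ⟨S₁, G.induce S₁, {x | x.1 ∈ A}⟩
    ⟨S₂, G.induce S₂, {x | x.1 ∈ B}⟩) (Sum.elim Subtype.val Subtype.val) ?_ ?_ ?_ ?_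
  · refine Function.Injective.sumElim Subtype.val_injective Subtype.val_injective ?_
    intro a b hab
    exact Set.disjoint_left.1 h.disj a.2 (hab ▸ b.2)
  · refine (Set.Sum.elim_range _ _).trans ?_
    rw [Subtype.range_val, Subtype.range_val, h.union]
  · rintro (a | a) (b | b)
    · exact Iff.rfl
    · exact h.adj a a.2 b b.2
    · exact (G.adj_comm _ _).trans (h.adj b b.2 a a.2)
    · exact Iff.rfl
  · rintro (a | a)
    · exact Iff.rfl
    · exact h.mark a a.2

lemma exists_split (h : cls G S A = glue c x y) :
    ∃ S₁ S₂ B, Split c G S A S₁ S₂ B ∧ cls G S₁ A = x ∧ cls G S₂ B = y := by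
  induction x using Quotient.inductionOn with
  | _ X =>
  induction y using Quotient.inductionOn with
  | _ Y =>
  obtain ⟨e, h1, h2⟩ := Quotient.exact h.symm
  have inj1 : Function.Injective fun a => (e (.inl a)).1 :=
    Subtype.val_injective.comp (e.injective.comp Sum.inl_injective)
  have inj2 : Function.Injective fun a => (e (.inr a)).1 :=
    Subtype.val_injective.comp (e.injective.comp Sum.inr_injective)
  refine ⟨Set.range fun a => (e (.inl a)).1, Set.range fun a => (e (.inr a)).1,
    (fun a => (e (.inr a)).1) '' Y.mark, ⟨?_, ?_, ?_, ?_⟩, ?_, ?_⟩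
  · ext a
    constructor
    · rintro (⟨b, rfl⟩ | ⟨b, rfl⟩) <;> exact (e _).2
    · intro ha
      obtain ⟨b | b, hb⟩ := e.surjective ⟨a, ha⟩
      · exact .inl ⟨b, by simp only [hb]⟩
      · exact .inr ⟨b, by simp only [hb]⟩
  · rw [Set.disjoint_left]
    rintro _ ⟨a, rfl⟩ ⟨b, hb⟩
    exact Sum.inl_ne_inr (e.injective (Subtype.val_injective hb.symm))
  · rintro _ ⟨a, rfl⟩ _ ⟨b, rfl⟩
    rw [inj2.mem_set_image]
    refine (h1 (.inl a) (.inr b)).trans ?_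
    exact and_congr_right fun _ => and_congr_left fun _ => (h2 (.inl a)).symm
  · rintro _ ⟨b, rfl⟩
    rw [inj2.mem_set_image]
    exact h2 (.inr b)
  · exact cls_eq_mk _ inj1 rfl (fun a b => h1 (.inl a) (.inl b)) (fun a => h2 (.inl a))
  · exact cls_eq_mk _ inj2 rfl (fun a b => h1 (.inr a) (.inr b))
      (fun a => inj2.mem_set_image)

lemma tau_cls : tau (cls G S A) = cls (flipGraph G A) S A :=
  Eq.symm (cls_eq_mk Subtype.val Subtype.val_injective Subtype.range_val
    (fun a b => by simp [flipGraph, Subtype.ext_iff]) (fun a => Iff.rfl))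

@[simp] lemma tau_tau : tau (tau x) = x := by
  obtain ⟨W, _, G, A, rfl⟩ := x.exists_cls
  rw [tau_cls, tau_cls, flipGraph_flipGraph]

lemma tau_injective : Function.Injective tau := Function.LeftInverse.injective fun _ => tau_tau

@[simp] lemma size_tau : size (tau x) = size x := by
  obtain ⟨W, _, G, A, rfl⟩ := x.exists_cls
  rw [tau_cls, size_cls, size_cls]

@[simp] lemma size_glue : size (glue c x y) = size x + size y := by
  obtain ⟨W, _, G, A, h⟩ := (glue c x y).exists_cls
  obtain ⟨S₁, S₂, B, hs, rfl, rfl⟩ := exists_split h.symm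
  rw [h, size_cls, size_cls, size_cls, ← hs.union, Set.ncard_union_eq hs.disj]

end MClass

/-! ### Algebra of marked graphs -/

namespace MClass

variable {W : Type} [Finite W] {G : SimpleGraph W} {S S₁ S₂ A B : Set W} {x y z w : MClass}

lemma cls_union (hd : Disjoint S₁ S₂) (h : ∀ a ∈ S₁, ∀ b ∈ S₂, ¬ G.Adj a b) :
    cls G (S₁ ∪ S₂) A = cls G S₁ A + cls G S₂ A :=
  Split.cls_eq ⟨rfl, hd, fun a ha b hb => by simp [h a ha b hb], by simp⟩

lemma cls_join (hd : Disjoint S₁ S₂) (h : ∀ a ∈ S₁, ∀ b ∈ S₂, G.Adj a b ↔ a ∈ A ∧ b ∈ B)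
    (hA : ∀ b ∈ S₂, b ∉ A) : cls G (S₁ ∪ S₂) A = cls G S₁ A * cls G S₂ B :=
  Split.cls_eq ⟨rfl, hd, fun a ha b hb => by simp [h a ha b hb], by simpa using hA⟩

lemma exists_split_add (h : cls G S A = x + y) : ∃ S₁ S₂, S₁ ∪ S₂ = S ∧ Disjoint S₁ S₂ ∧
    (∀ a ∈ S₁, ∀ b ∈ S₂, ¬ G.Adj a b) ∧ cls G S₁ A = x ∧ cls G S₂ A = y := by
  obtain ⟨S₁, S₂, B, hs, h1, h2⟩ := exists_split h
  refine ⟨S₁, S₂, hs.union, hs.disj, fun a ha b hb => by simp [hs.adj a ha b hb], h1, ?_⟩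
  rw [← h2]
  exact cls_congr_mark fun b hb => by simp [hs.mark b hb]

lemma exists_split_mul (h : cls G S A = x * y) : ∃ S₁ S₂ B, S₁ ∪ S₂ = S ∧ Disjoint S₁ S₂ ∧
    (∀ a ∈ S₁, ∀ b ∈ S₂, G.Adj a b ↔ a ∈ A ∧ b ∈ B) ∧ (∀ b ∈ S₂, b ∉ A) ∧
    cls G S₁ A = x ∧ cls G S₂ B = y := by
  obtain ⟨S₁, S₂, B, hs, h1, h2⟩ := exists_split h
  exact ⟨S₁, S₂, B, hs.union, hs.disj, fun a ha b hb => by simp [hs.adj a ha b hb],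
    fun b hb => by simp [hs.mark b hb], h1, h2⟩

lemma size_add : size (x + y) = size x + size y := size_glue
lemma size_mul : size (x * y) = size x + size y := size_glue

instance : AddCommMonoid MClass where
  add_assoc x y z := by
    obtain ⟨W, _, G, A, h⟩ := (x + y + z).exists_cls
    obtain ⟨S, S₃, hS, hd, hG, h', rfl⟩ := exists_split_add h.symm
    obtain ⟨S₁, S₂, rfl, hd', hG', rfl, rfl⟩ := exists_split_add h'
    rw [Set.disjoint_union_left] at hd
    rw [h, ← hS, Set.union_assoc, cls_union, cls_union hd.2]
    · exact fun a ha => hG a (.inr ha)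
    · exact hd'.union_right hd.1
    · rintro a ha b (hb | hb)
      · exact hG' a ha b hb
      · exact hG a (.inl ha) b hb
  zero_add x := by
    obtain ⟨W, _, G, A, rfl⟩ := x.exists_cls
    rw [← (cls_eq_zero (G := G) (A := A)).2 rfl, ← cls_union (Set.empty_disjoint _) (by simp), Set.empty_union]
  add_zero x := by
    obtain ⟨W, _, G, A, rfl⟩ := x.exists_cls
    rw [← (cls_eq_zero (G := G) (A := A)).2 rfl, ← cls_union (Set.disjoint_empty _) (by simp), Set.union_empty]
  add_comm x y := by
    obtain ⟨W, _, G, A, h⟩ := (x + y).exists_cls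
    obtain ⟨S₁, S₂, hS, hd, hG, rfl, rfl⟩ := exists_split_add h.symm
    rw [h, ← hS, Set.union_comm,
      cls_union hd.symm fun a ha b hb hab => hG b hb a ha hab.symm]
  nsmul := nsmulRec

lemma mul_zero' : x * 0 = x := by
  obtain ⟨W, _, G, A, rfl⟩ := x.exists_cls
  rw [← (cls_eq_zero (G := G) (A := ∅)).2 rfl, ← cls_join (B := ∅) (Set.disjoint_empty _) (by simp) (by simp),
    Set.union_empty]

lemma mul_mul_eq : x * y * z = x * (y + z) := by
  obtain ⟨W, _, G, A, h⟩ := (x * y * z).exists_cls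
  obtain ⟨S, S₃, B, hS, hd, hG, hA, h', rfl⟩ := exists_split_mul h.symm
  obtain ⟨S₁, S₂, B', rfl, hd', hG', hA', rfl, rfl⟩ := exists_split_mul h'
  rw [Set.disjoint_union_left] at hd
  have h2 : cls G S₂ B' = cls G S₂ ((B' ∩ S₂) ∪ (B ∩ S₃)) := cls_congr_mark fun a ha => by
    have := Set.disjoint_left.1 hd.2 ha
    simp [ha, this]
  have h3 : cls G S₃ B = cls G S₃ ((B' ∩ S₂) ∪ (B ∩ S₃)) := cls_congr_mark fun a ha => by
    have := Set.disjoint_right.1 hd.2 ha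
    simp [ha, this]
  rw [h, ← hS, Set.union_assoc, h2, h3, ← cls_union hd.2, cls_join (hd'.union_right hd.1)]
  · rintro a ha b (hb | hb)
    · have := Set.disjoint_left.1 hd.2 hb
      simp [hb, this, hG' a ha b hb]
    · have := Set.disjoint_right.1 hd.2 hb
      simp [hb, this, hG a (.inl ha) b hb]
  · rintro b (hb | hb)
    · exact hA' b hb
    · exact hA b hb
  · intro a ha b hb
    simp [hG a (.inr ha) b hb, hA' a ha]

lemma tau_mul : tau (x * y) = tau x * y := by
  obtain ⟨W, _, G, A, h⟩ := (x * y).exists_cls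
  obtain ⟨S₁, S₂, B, hS, hd, hG, hA, rfl, rfl⟩ := exists_split_mul h.symm
  have h2 : cls G S₂ B = cls (flipGraph G A) S₂ B := by
    refine cls_congr (fun a ha b hb => ?_) fun _ _ => Iff.rfl
    simp only [flipGraph, hA a ha, false_and, not_false_iff, iff_true]
    exact ⟨fun h => ⟨h.ne, h⟩, fun h => h.2⟩
  rw [h, ← hS, tau_cls, tau_cls, h2, ← cls_join hd _ hA]
  intro a ha b hb
  have hab : a ≠ b := fun hab => Set.disjoint_left.1 hd ha (hab ▸ hb)
  simp [flipGraph, hab, hA b hb, hG a ha b hb]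

/-- Two decompositions of a sum have a common refinement. -/
lemma add_eq_add (h : x + y = z + w) :
    ∃ e f g k, x = e + f ∧ y = g + k ∧ z = e + g ∧ w = f + k := by
  obtain ⟨W, _, G, A, h'⟩ := (x + y).exists_cls
  obtain ⟨S₁, S₂, hS, hd, hG, rfl, rfl⟩ := exists_split_add h'.symm
  obtain ⟨S₃, S₄, hT, hd', hG', rfl, rfl⟩ := exists_split_add (h'.symm.trans h)
  have e1 : S₁ = S₁ ∩ S₃ ∪ S₁ ∩ S₄ := by
    rw [← Set.inter_union_distrib_left, hT, Set.inter_univ]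
  have e2 : S₂ = S₂ ∩ S₃ ∪ S₂ ∩ S₄ := by
    rw [← Set.inter_union_distrib_left, hT, Set.inter_univ]
  have e3 : S₃ = S₁ ∩ S₃ ∪ S₂ ∩ S₃ := by
    rw [← Set.union_inter_distrib_right, hS, Set.univ_inter]
  have e4 : S₄ = S₁ ∩ S₄ ∪ S₂ ∩ S₄ := by
    rw [← Set.union_inter_distrib_right, hS, Set.univ_inter]
  refine ⟨cls G (S₁ ∩ S₃) A, cls G (S₁ ∩ S₄) A, cls G (S₂ ∩ S₃) A, cls G (S₂ ∩ S₄) A,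
    ?_, ?_, ?_, ?_⟩
  · conv_lhs => rw [e1]
    exact cls_union (hd'.mono Set.inter_subset_right Set.inter_subset_right)
      fun a ha b hb => hG' a ha.2 b hb.2
  · conv_lhs => rw [e2]
    exact cls_union (hd'.mono Set.inter_subset_right Set.inter_subset_right)
      fun a ha b hb => hG' a ha.2 b hb.2
  · conv_lhs => rw [e3]
    exact cls_union (hd.mono Set.inter_subset_left Set.inter_subset_left)
      fun a ha b hb => hG a ha.1 b hb.1
  · conv_lhs => rw [e4]
    exact cls_union (hd.mono Set.inter_subset_left Set.inter_subset_left)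
      fun a ha b hb => hG a ha.1 b hb.1

/-- The class has at least one marked vertex. -/
def HasMark (x : MClass) : Prop :=
  ∀ (W : Type) (_ : Finite W) (G : SimpleGraph W) (S A : Set W), cls G S A = x → ∃ a ∈ S, a ∈ A

/-- Two decompositions of a product have a common refinement. -/
lemma mul_eq_mul (h : x * y = z * w) (hx : HasMark x) :
    ∃ e f g k, x = e * f ∧ z = e * g ∧ y = g + k ∧ w = f + k := by
  obtain ⟨W, _, G, A, h'⟩ := (x * y).exists_cls
  obtain ⟨S₁, S₂, B, hS, hd, hG, hA, rfl, rfl⟩ := exists_split_mul h'.symm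
  obtain ⟨S₃, S₄, B', hT, hd', hG', hA', rfl, rfl⟩ := exists_split_mul (h'.symm.trans h)
  have e1 : S₁ = S₁ ∩ S₃ ∪ S₁ ∩ S₄ := by
    rw [← Set.inter_union_distrib_left, hT, Set.inter_univ]
  have e2 : S₂ = S₂ ∩ S₃ ∪ S₂ ∩ S₄ := by
    rw [← Set.inter_union_distrib_left, hT, Set.inter_univ]
  have e3 : S₃ = S₁ ∩ S₃ ∪ S₂ ∩ S₃ := by
    rw [← Set.union_inter_distrib_right, hS, Set.univ_inter]
  have e4 : S₄ = S₁ ∩ S₄ ∪ S₂ ∩ S₄ := by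
    rw [← Set.union_inter_distrib_right, hS, Set.univ_inter]
  obtain ⟨m, hm1, hm⟩ := hx _ _ _ _ _ rfl
  have hm3 : m ∈ S₃ := by
    have : m ∈ S₃ ∪ S₄ := hT ▸ trivial
    exact this.resolve_right fun h => hA' m h hm
  have hBB : cls G (S₂ ∩ S₄) B' = cls G (S₂ ∩ S₄) B := cls_congr_mark fun b hb => by
    have h1 := hG m hm1 b hb.1
    have h2 := hG' m hm3 b hb.2
    rw [h2] at h1
    simpa [hm] using h1
  refine ⟨cls G (S₁ ∩ S₃) A, cls G (S₁ ∩ S₄) B', cls G (S₂ ∩ S₃) B, cls G (S₂ ∩ S₄) B,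
    ?_, ?_, ?_, ?_⟩
  · conv_lhs => rw [e1]
    exact cls_join (hd'.mono Set.inter_subset_right Set.inter_subset_right)
      (fun a ha b hb => hG' a ha.2 b hb.2) fun b hb => hA' b hb.2
  · conv_lhs => rw [e3]
    exact cls_join (hd.mono Set.inter_subset_left Set.inter_subset_left)
      (fun a ha b hb => hG a ha.1 b hb.1) fun b hb => hA b hb.1
  · conv_lhs => rw [e2]
    refine cls_union (hd'.mono Set.inter_subset_right Set.inter_subset_right)
      fun a ha b hb => ?_
    simp [hG' a ha.2 b hb.2, hA a ha.1]
  · conv_lhs => rw [e4]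
    rw [← hBB]
    refine cls_union (hd.mono Set.inter_subset_left Set.inter_subset_left)
      fun a ha b hb => ?_
    simp [hG a ha.1 b hb.1, hA' a ha.2]

end MClass

/-! ### Distance-hereditary cones -/

/-- The graph `G` with a new vertex `none` adjacent to `A`. -/
def cone {W : Type} (G : SimpleGraph W) (A : Set W) : SimpleGraph (Option W) where
  Adj a b :=
    match a, b with
    | none, none => False
    | none, some b => b ∈ A
    | some a, none => a ∈ A
    | some a, some b => G.Adj a b
  symm := ⟨by rintro (_ | a) (_ | b) h <;> first | exact h | exact SimpleGraph.Adj.symm h⟩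
  loopless := ⟨by rintro (_ | a) h; exacts [h, SimpleGraph.irrefl _ h]⟩

/-- The vertex set `S` together with the apex of the cone. -/
def coneSet {W : Type} (S : Set W) : Set (Option W) := insert none (some '' S)

/-- `u` is an extension of `w`: a pendant vertex or a twin in the cone. -/
def IsExt {W : Type} (G : SimpleGraph W) (S A : Set W) (u w : W) : Prop :=
  (u ∉ A ∧ IsPendant G S u w) ∨ ((u ∈ A ↔ w ∈ A) ∧ IsTwin G S u w)

section Cone

variable {W W' : Type} {G : SimpleGraph W} {G' : SimpleGraph W'} {S T A : Set W} {A' : Set W'}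
  {u w : W}

@[simp] lemma cone_none_some {a : W} : (cone G A).Adj none (some a) ↔ a ∈ A := Iff.rfl
@[simp] lemma cone_some_none {a : W} : (cone G A).Adj (some a) none ↔ a ∈ A := Iff.rfl
@[simp] lemma cone_some_some {a b : W} : (cone G A).Adj (some a) (some b) ↔ G.Adj a b := Iff.rfl
@[simp] lemma none_mem_coneSet : none ∈ coneSet S := .inl rfl
@[simp] lemma some_mem_coneSet {a : W} : some a ∈ coneSet S ↔ a ∈ S := by simp [coneSet]

lemma coneSet_univ : coneSet (Set.univ : Set W) = Set.univ := by
  ext (_ | a) <;> simp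

lemma coneSet_diff : coneSet (S \ {u}) = coneSet S \ {some u} := by
  ext (_ | a) <;> simp

lemma coneSet_mono (h : S ⊆ T) : coneSet S ⊆ coneSet T := by
  rintro (_ | a) <;> simp; exact @h a

lemma IsExt.cone (h : IsExt G S A u w) :
    IsPendant (cone G A) (coneSet S) (some u) (some w) ∨
      IsTwin (cone G A) (coneSet S) (some u) (some w) := by
  rcases h with ⟨hu, h⟩ | ⟨hu, h⟩
  · left
    rintro (_ | c) hc
    · simpa using hu
    · simpa using h c (by simpa using hc)
  · right
    rintro (_ | c) hc
    · simpa using hu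
    · simpa using h c (by simpa using hc)

lemma isExt_of_cone (h : IsPendant (cone G A) (coneSet S) (some u) (some w) ∨
    IsTwin (cone G A) (coneSet S) (some u) (some w)) : IsExt G S A u w := by
  rcases h with h | h
  · left
    exact ⟨by simpa using h none, fun c hc => by simpa using h (some c) (by simpa using hc)⟩
  · right
    exact ⟨by simpa using h none, fun c hc => by simpa using h (some c) (by simpa using hc)⟩

lemma dhOn_cone_iff (f : W' → W) (hf : Function.Injective f) (hS : Set.range f = S)
    (hG : ∀ a b, G.Adj (f a) (f b) ↔ G'.Adj a b) (hA : ∀ a, f a ∈ A ↔ a ∈ A') :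
    DHOn (cone G A) (coneSet S) ↔ DHOn (cone G' A') Set.univ := by
  have : coneSet S = Option.map f '' Set.univ := by
    subst hS
    ext (_ | a) <;> simp
  rw [this]
  refine dhOn_image (Option.map_injective hf).injOn ?_
  rintro (_ | a) - (_ | b) - <;> simp [hG, hA]

end Cone

namespace MClass

variable {W : Type} [Finite W] {G : SimpleGraph W} {S S₁ S₂ A B : Set W} {c : Prop}
  {x y z : MClass} {u w : W}

/-- The cone over the marked vertices is connected and distance-hereditary. -/
def Good (x : MClass) : Prop :=
  ∃ (W : Type) (_ : Finite W) (G : SimpleGraph W) (A : Set W),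
    x = cls G Set.univ A ∧ DHOn (cone G A) Set.univ

lemma good_cls : Good (cls G S A) ↔ DHOn (cone G A) (coneSet S) := by
  constructor
  · rintro ⟨W', _, G', A', h, hd⟩
    obtain ⟨e, h1, h2⟩ := Quotient.exact h.symm
    refine (dhOn_cone_iff (fun a => (e ⟨a, trivial⟩).1) ?_ ?_ (fun a b => h1 _ _)
      fun a => h2 _).2 hd
    · intro a b hab
      exact congrArg Subtype.val (e.injective (Subtype.val_injective hab))
    · ext a
      constructor
      · rintro ⟨b, rfl⟩
        exact (e _).2
      · intro ha
        obtain ⟨b, hb⟩ := e.surjective ⟨a, ha⟩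
        exact ⟨b.1, by simp [hb]⟩
  · intro h
    refine ⟨S, inferInstance, G.induce S, {x | x.1 ∈ A}, ?_, ?_⟩
    · exact cls_eq_mk (X := ⟨(Set.univ : Set S), (G.induce S).induce Set.univ, _⟩) (fun a => a.1.1)
        (Subtype.val_injective.comp Subtype.val_injective) (by ext; simp) (fun _ _ => Iff.rfl)
        fun _ => Iff.rfl
    · exact (dhOn_cone_iff Subtype.val Subtype.val_injective Subtype.range_val
        (fun _ _ => Iff.rfl) fun _ => Iff.rfl).1 h

lemma Good.hasMark (hx : Good x) (h0 : x ≠ 0) : HasMark x := by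
  rintro W _ G S A rfl
  obtain ⟨s, hs⟩ := cls_ne_zero.1 h0
  obtain ⟨n, hn⟩ := (good_cls.1 hx).1 none (by simp) (some s) (by simpa using hs)
  obtain ⟨_, a | a, _, ha, h1, _⟩ := hn.first (by simp)
  · exact absurd h1 (by simp)
  · exact ⟨a, by simpa using ha, h1⟩

open Classical in
lemma Good.of_glue_left (h : Good (glue c x y)) : Good x := by
  obtain ⟨W, _, G, A, hx⟩ := (glue c x y).exists_cls
  obtain ⟨S₁, S₂, B, hs, rfl, rfl⟩ := exists_split hx.symm
  rw [hx, good_cls] at h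
  rw [good_cls]
  refine h.mono (coneSet_mono (hs.union ▸ Set.subset_union_left)) ?_
  set f : Option W → Option W := fun a => if a ∈ coneSet S₁ then a else none
  have hS : ∀ b, b ∉ S₁ → b ∈ S₂ := fun b hb =>
    (show b ∈ S₁ ∪ S₂ from hs.union ▸ trivial).resolve_left hb
  have hf : ∀ a ∈ coneSet S₁, f a = a := fun a ha => if_pos ha
  intro p hp q hq
  obtain ⟨n, hn⟩ := h.1 p (by simp [coneSet_univ]) q (by simp [coneSet_univ])
  refine ⟨n, ?_⟩
  rw [← hf p hp, ← hf q hq]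
  refine hn.fold (G' := cone G A) f ?_ ?_
  · intro a _
    simp only [f]
    split_ifs with h
    · exact h
    · simp
  · rintro (_ | a) - (_ | b) - hab <;> simp only [f, none_mem_coneSet, some_mem_coneSet, if_true]
    · simp
    · split_ifs
      · exact .inr hab
      · simp
    · split_ifs
      · exact .inr hab
      · simp
    · split_ifs with h1 h2 h2
      · exact .inr hab
      · exact .inr ((hs.adj a h1 b (hS b h2)).1 hab).2.1
      · exact .inr ((hs.adj b h2 a (hS a h1)).1 hab.symm).2.1
      · simp

lemma Good.of_add (h : Good (x + y)) : Good x ∧ Good y :=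
  ⟨of_glue_left h, of_glue_left (add_comm x y ▸ h)⟩

open Classical in
lemma Good.of_mul (h : Good (x * y)) (h0 : x ≠ 0) : Good x ∧ Good y := by
  have hx : Good x := of_glue_left h
  refine ⟨hx, ?_⟩
  have hm := hx.hasMark h0
  obtain ⟨W, _, G, A, hxy⟩ := (x * y).exists_cls
  obtain ⟨S₁, S₂, B, hS, hd, hG, hA, rfl, rfl⟩ := exists_split_mul hxy.symm
  obtain ⟨m, hm1, hmA⟩ := hm _ _ _ _ _ rfl
  rw [hxy, good_cls, coneSet_univ] at h
  rw [good_cls]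
  set f : Option W → Option W := fun a => some (a.getD m)
  have hm2 : m ∉ S₂ := Set.disjoint_left.1 hd hm1
  have hS' : ∀ b, b ∉ S₂ → b ∈ S₁ := fun b hb =>
    (show b ∈ S₁ ∪ S₂ from hS ▸ trivial).resolve_right hb
  have hf : Set.InjOn f (coneSet S₂) := by
    rintro (_ | a) ha (_ | b) hb hab
    · rfl
    · simp only [f, Option.getD_none, Option.getD_some, Option.some.injEq] at hab
      exact absurd (some_mem_coneSet.1 hb) (hab ▸ hm2)
    · simp only [f, Option.getD_none, Option.getD_some, Option.some.injEq] at hab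
      exact absurd (some_mem_coneSet.1 ha) (hab ▸ hm2)
    · simpa [f] using hab
  refine (dhOn_image (G := cone G B) (G' := cone G A) hf ?_).1 ?_
  · rintro (_ | a) ha (_ | b) hb
    · simp [f]
    · simp [f, hG m hm1 b (by simpa using hb), hmA]
    · simp [f, G.adj_comm a m, hG m hm1 a (by simpa using ha), hmA]
    · simp [f]
  · refine h.mono (Set.subset_univ _) ?_
    set g : Option W → Option W := fun a => if a ∈ some '' S₂ then a else some m
    have hg : ∀ a ∈ f '' coneSet S₂, g a = a := by
      rintro _ ⟨_ | a, ha, rfl⟩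
      · simp [g, f]
      · simp only [some_mem_coneSet] at ha
        simp [g, f, ha]
    intro p hp q hq
    obtain ⟨n, hn⟩ := h.1 p trivial q trivial
    refine ⟨n, ?_⟩
    rw [← hg p hp, ← hg q hq]
    refine hn.fold (G' := cone G A) g ?_ ?_
    · intro a _
      simp only [g]
      split_ifs with h
      · obtain ⟨b, hb, rfl⟩ := h
        exact ⟨some b, by simpa using hb, rfl⟩
      · exact ⟨none, by simp, rfl⟩
    · rintro (_ | a) - (_ | b) - hab <;> simp only [g, Set.mem_image, Option.some.injEq,
        exists_eq_right, reduceCtorEq, and_false, exists_false, if_false]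
      · simp
      · split_ifs with h
        · exact absurd hab (hA b h)
        · simp
      · split_ifs with h
        · exact absurd hab (hA a h)
        · simp
      · split_ifs with h1 h2 h2
        · exact .inr hab
        · right
          have := (hG b (hS' b h2) a h1).1 hab.symm
          exact ((hG m hm1 a h1).2 ⟨hmA, this.2⟩).symm
        · right
          have := (hG a (hS' a h1) b h2).1 hab
          exact (hG m hm1 b h2).2 ⟨hmA, this.2⟩
        · simp

end MClass

/-! ### Generating distance-hereditary cones -/

namespace MClass

variable {W : Type} [Finite W] {G : SimpleGraph W} {S S₁ S₂ A B : Set W} {c : Prop}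
  {x y z : MClass} {u w : W}

/-- The classes generated from the one-vertex class by gluing and complementation. -/
inductive Dec : MClass → Prop
  | zero : Dec 0
  | one : Dec 1
  | glue {c : Prop} {x y : MClass} : Dec x → Dec y → x ≠ 0 → Dec (glue c x y)
  | tau {x : MClass} : Dec x → Dec (tau x)

lemma one_ne_zero' : (1 : MClass) ≠ 0 := fun h => by simpa using congrArg size h

lemma tau_eq_zero : tau x = 0 ↔ x = 0 := by
  rw [← size_eq_zero, size_tau, size_eq_zero]

lemma Dec.of_tau (h : Dec (MClass.tau x)) : Dec x := tau_tau (x := x) ▸ h.tau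

lemma Dec.of_flip (h : Dec (cls (flipGraph G A) S A)) : Dec (cls G S A) :=
  Dec.of_tau (by rwa [tau_cls])

lemma _root_.IsExt.flip {W : Type} {G : SimpleGraph W} {S A : Set W} {u w : W} (huw : u ≠ w)
    (h : IsExt G S A u w) : IsExt (flipGraph G A) S A u w := by
  rcases h with ⟨hu, h⟩ | ⟨hu, h⟩
  · refine .inl ⟨hu, fun c hc => ?_⟩
    simp only [flipGraph, hu, h c hc, false_and, not_false_iff, iff_true]
    exact ⟨fun h => h.2, fun h => ⟨h ▸ huw, h⟩⟩
  · refine .inr ⟨hu, fun c hc h1 h2 => ?_⟩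
    simp [flipGraph, hu, h c hc h1 h2, h1.symm, h2.symm]

lemma Dec.extend_singleton (hw : w ∈ A) (huw : u ≠ w) (h : IsExt G {w} A u w) :
    Dec (cls G (insert u {w}) A) := by
  have hd : Disjoint ({w} : Set W) {u} := by simpa using huw.symm
  have key : ∀ G' : SimpleGraph W, ¬ G'.Adj w u → u ∈ A → Dec (cls G' (insert u {w}) A) := by
    intro G' hwu hu
    rw [Set.insert_eq, Set.union_comm, cls_union hd (by simpa using hwu), cls_singleton hw,
      cls_singleton hu]
    exact .glue .one .one one_ne_zero'
  by_cases hu : u ∈ A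
  · by_cases hwu : G.Adj w u
    · exact Dec.of_flip (key _ (by simp [flipGraph, hu, hw, hwu]) hu)
    · exact key G hwu hu
  · have h1 : G.Adj u w := by
      rcases h with ⟨_, h⟩ | ⟨h, _⟩
      · exact (h w rfl).2 rfl
      · exact absurd (h.2 hw) hu
    rw [Set.insert_eq, Set.union_comm, cls_join (B := {u}) hd (by simp [h1.symm, hw]) (by simpa),
      cls_singleton hw, cls_singleton (Set.mem_singleton u)]
    exact .glue .one .one one_ne_zero'

/-- Extensions of generated classes are generated. -/
lemma Dec.extend (hx : Dec x) : ∀ (W : Type) (_ : Finite W) (G : SimpleGraph W) (S A : Set W)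
    (u w : W), cls G S A = x → u ∉ S → w ∈ S → IsExt G S A u w → Dec (cls G (insert u S) A) := by
  induction hx with
  | zero =>
    intro W _ G S A u w h hu hw
    rw [cls_eq_zero] at h
    subst h
    exact absurd hw (Set.notMem_empty _)
  | one =>
    intro W _ G S A u w h hu hw he
    obtain ⟨v, hv, rfl⟩ := cls_eq_one h
    obtain rfl : w = v := hw
    exact .extend_singleton hv hu he
  | tau hx ih =>
    intro W _ G S A u w h hu hw he
    refine Dec.of_flip (ih W _ _ S A u w ?_ hu hw (he.flip fun h => hu (h ▸ hw)))
    rw [← tau_cls, h, tau_tau]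
  | @glue c x y hx hy h0 ihx ihy =>
    intro W _ G S A u w h hu hw he
    obtain ⟨S₁, S₂, B, hs, rfl, rfl⟩ := exists_split h
    have hu1 : u ∉ S₁ := fun h => hu (hs.union ▸ .inl h)
    have hu2 : u ∉ S₂ := fun h => hu (hs.union ▸ .inr h)
    have hS1 : S₁ ⊆ S := hs.union ▸ Set.subset_union_left
    have hS2 : S₂ ⊆ S := hs.union ▸ Set.subset_union_right
    rw [← hs.union] at hw
    rcases hw with hw | hw
    · have hw2 : w ∉ S₂ := Set.disjoint_left.1 hs.disj hw
      have : Split c G (insert u S) A (insert u S₁) S₂ B := by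
        refine ⟨by rw [Set.insert_union, hs.union], ?_, ?_, hs.mark⟩
        · rw [Set.disjoint_insert_left]
          exact ⟨hu2, hs.disj⟩
        · rintro a (rfl | ha) b hb
          · have hbw : b ≠ w := fun h => hw2 (h ▸ hb)
            rcases he with ⟨h1, h2⟩ | ⟨h1, h2⟩
            · simp [h2 b (hS2 hb), h1, hbw]
            · rw [h2 b (hS2 hb) (fun h => hu2 (h ▸ hb)) hbw, hs.adj w hw b hb, h1]
          · exact hs.adj a ha b hb
      rw [this.cls_eq]
      refine .glue (ihx W _ G S₁ A u w rfl hu1 hw ?_) hy ?_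
      · exact he.imp (And.imp_right (·.mono hS1)) (And.imp_right (·.mono hS1))
      · exact cls_ne_zero.2 (Set.insert_nonempty _ _)
    · have hw1 : w ∉ S₁ := Set.disjoint_right.1 hs.disj hw
      obtain ⟨p, hp1, hp2, hp3⟩ : ∃ p : Prop, (∀ a ∈ S₁, G.Adj a u ↔ c ∧ a ∈ A ∧ p) ∧
          (u ∈ A ↔ ¬ c ∧ p) ∧
          ((¬ p ∧ IsPendant G S₂ u w) ∨ ((p ↔ w ∈ B) ∧ IsTwin G S₂ u w)) := by
        rcases he with ⟨h1, h2⟩ | ⟨h1, h2⟩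
        · refine ⟨False, fun a ha => ?_, by simp [h1], .inl ⟨id, h2.mono hS2⟩⟩
          have haw : a ≠ w := fun h => hw1 (h ▸ ha)
          simp [G.adj_comm a, h2 a (hS1 ha), haw]
        · refine ⟨w ∈ B, fun a ha => ?_, h1.trans (hs.mark w hw), .inr ⟨Iff.rfl, h2.mono hS2⟩⟩
          rw [G.adj_comm, h2 a (hS1 ha) (fun h => hu1 (h ▸ ha)) (fun h => hw1 (h ▸ ha)),
            G.adj_comm, hs.adj a ha w hw]
      set B' : Set W := {b | (b ≠ u ∧ b ∈ B) ∨ (b = u ∧ p)}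
      have hB : ∀ b ∈ S₂, b ∈ B' ↔ b ∈ B := fun b hb => by
        have : b ≠ u := fun h => hu2 (h ▸ hb)
        simp [B', this]
      have huB : u ∈ B' ↔ p := by simp [B']
      have : Split c G (insert u S) A S₁ (insert u S₂) B' := by
        refine ⟨by rw [Set.union_insert, hs.union], ?_, ?_, ?_⟩
        · rw [Set.disjoint_insert_right]
          exact ⟨hu1, hs.disj⟩
        · rintro a ha b (rfl | hb)
          · rw [huB]
            exact hp1 a ha
          · rw [hB b hb]
            exact hs.adj a ha b hb
        · rintro b (rfl | hb)
          · rw [huB]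
            exact hp2
          · rw [hB b hb]
            exact hs.mark b hb
      rw [this.cls_eq]
      refine .glue hx (ihy W _ G S₂ B' u w (cls_congr_mark hB) hu2 hw ?_) h0
      rwa [IsExt, huB, hB w hw]

lemma Dec.hasMark (hx : Dec x) (h0 : x ≠ 0) : HasMark x := by
  induction hx with
  | zero => exact absurd rfl h0
  | one =>
    intro W _ G S A h
    obtain ⟨u, hu, rfl⟩ := cls_eq_one h
    exact ⟨u, rfl, hu⟩
  | glue _ _ h1 ih _ =>
    intro W _ G S A h
    obtain ⟨S₁, S₂, B, hs, h2, -⟩ := exists_split h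
    obtain ⟨a, ha, haA⟩ := ih h1 W _ G S₁ A h2
    exact ⟨a, hs.union ▸ .inl ha, haA⟩
  | tau _ ih =>
    intro W _ G S A h
    refine ih (fun h => h0 (tau_eq_zero.2 h)) W inferInstance (flipGraph G A) S A ?_
    rw [← tau_cls, h, tau_tau]

/-- A generated class with at least two vertices is an extension of a generated class. -/
lemma Dec.exists_ext (hx : Dec x) : ∀ (W : Type) (_ : Finite W) (G : SimpleGraph W)
    (S A : Set W), cls G S A = x → 2 ≤ S.ncard →
    ∃ u ∈ S, ∃ w ∈ S, u ≠ w ∧ IsExt G S A u w ∧ Dec (cls G (S \ {u}) A) := by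
  induction hx with
  | zero =>
    intro W _ G S A h hc
    rw [cls_eq_zero] at h
    simp [h] at hc
  | one =>
    intro W _ G S A h hc
    obtain ⟨v, hv, rfl⟩ := cls_eq_one h
    simp at hc
  | tau hx ih =>
    intro W _ G S A h hc
    obtain ⟨u, hu, w, hw, huw, he, hd⟩ := ih W _ (flipGraph G A) S A
      (by rw [← tau_cls, h, tau_tau]) hc
    refine ⟨u, hu, w, hw, huw, ?_, hd.of_flip⟩
    have := he.flip huw
    rwa [flipGraph_flipGraph] at this
  | @glue c x y hx hy h0 ihx ihy =>
    intro W _ G S A h hc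
    obtain ⟨S₁, S₂, B, hs, rfl, rfl⟩ := exists_split h
    have hS1 : S₁ ⊆ S := hs.union ▸ Set.subset_union_left
    have hS2 : S₂ ⊆ S := hs.union ▸ Set.subset_union_right
    by_cases h1 : 2 ≤ S₁.ncard
    · obtain ⟨u, hu, w, hw, huw, he, hd⟩ := ihx W _ G S₁ A rfl h1
      have hne : ∀ v ∈ S₁, ∀ b ∈ S₂, b ≠ v := fun v hv b hb h =>
        Set.disjoint_left.1 hs.disj hv (h ▸ hb)
      refine ⟨u, hS1 hu, w, hS1 hw, huw, ?_, ?_⟩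
      · rcases he with ⟨h1, h2⟩ | ⟨h1, h2⟩
        · refine .inl ⟨h1, fun b hb => ?_⟩
          rcases hs.union ▸ hb with hb | hb
          · exact h2 b hb
          · simp [hs.adj u hu b hb, h1, hne w hw b hb]
        · refine .inr ⟨h1, fun b hb hbu hbw => ?_⟩
          rcases hs.union ▸ hb with hb | hb
          · exact h2 b hb hbu hbw
          · rw [hs.adj u hu b hb, hs.adj w hw b hb, h1]
      · have : Split c G (S \ {u}) A (S₁ \ {u}) S₂ B := by
          refine ⟨?_, hs.disj.mono_left Set.sdiff_subset, fun a ha => hs.adj a ha.1, hs.mark⟩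
          rw [← hs.union, Set.union_sdiff_distrib,
            Set.sdiff_singleton_eq_self (Set.disjoint_left.1 hs.disj hu)]
        rw [this.cls_eq]
        exact .glue hd hy (cls_ne_zero.2 ⟨w, hw, huw.symm⟩)
    by_cases h2 : 2 ≤ S₂.ncard
    · obtain ⟨u, hu, w, hw, huw, he, hd⟩ := ihy W _ G S₂ B rfl h2
      have hne : ∀ v ∈ S₂, ∀ b ∈ S₁, b ≠ v := fun v hv b hb h =>
        Set.disjoint_left.1 hs.disj hb (h ▸ hv)
      refine ⟨u, hS2 hu, w, hS2 hw, huw, ?_, ?_⟩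
      · rcases he with ⟨h1, h2⟩ | ⟨h1, h2⟩
        · refine .inl ⟨by simp [hs.mark u hu, h1], fun b hb => ?_⟩
          rcases hs.union ▸ hb with hb | hb
          · simp [G.adj_comm u, hs.adj b hb u hu, h1, hne w hw b hb]
          · exact h2 b hb
        · refine .inr ⟨by rw [hs.mark u hu, hs.mark w hw, h1], fun b hb hbu hbw => ?_⟩
          rcases hs.union ▸ hb with hb | hb
          · rw [G.adj_comm, hs.adj b hb u hu, G.adj_comm, hs.adj b hb w hw, h1]
          · exact h2 b hb hbu hbw
      · have : Split c G (S \ {u}) A S₁ (S₂ \ {u}) B := by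
          refine ⟨?_, hs.disj.mono_right Set.sdiff_subset, fun a ha b hb => hs.adj a ha b hb.1,
            fun b hb => hs.mark b hb.1⟩
          rw [← hs.union, Set.union_sdiff_distrib,
            Set.sdiff_singleton_eq_self (Set.disjoint_right.1 hs.disj hu)]
        rw [this.cls_eq]
        exact .glue hx hd h0
    · have hle : S.ncard ≤ S₁.ncard + S₂.ncard := hs.union ▸ Set.ncard_union_le _ _
      obtain ⟨u, rfl⟩ := Set.ncard_eq_one.1 (show S₁.ncard = 1 by omega)
      obtain ⟨w, rfl⟩ := Set.ncard_eq_one.1 (show S₂.ncard = 1 by omega)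
      obtain ⟨u', hu', huA⟩ := hx.hasMark h0 _ _ _ _ _ rfl
      obtain ⟨w', hw', hwB⟩ := hy.hasMark (cls_ne_zero.2 ⟨w, rfl⟩) _ _ _ _ _ rfl
      rw [show u' = u from hu'] at huA
      rw [show w' = w from hw'] at hwB
      have huw : u ≠ w := by simpa using hs.disj
      refine ⟨w, hS2 rfl, u, hS1 rfl, huw.symm, ?_, ?_⟩
      · by_cases hc : c
        · refine .inl ⟨by simp [hs.mark w rfl, hc], fun b hb => ?_⟩
          rcases hs.union ▸ hb with rfl | rfl
          · simp [G.adj_comm w, hs.adj b rfl w rfl, hc, huA, hwB]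
          · simp [huw.symm]
        · refine .inr ⟨by simp [hs.mark w rfl, hc, huA, hwB], fun b hb h1 h2 => ?_⟩
          rcases hs.union ▸ hb with rfl | rfl
          · exact absurd rfl h2
          · exact absurd rfl h1
      · have : S \ {w} = {u} := by
          rw [← hs.union, Set.union_sdiff_cancel_right]
          simpa using huw.symm
        rwa [this]

lemma _root_.dhOn_pair {W : Type} {G : SimpleGraph W} {a b : W} (h : a = b ∨ G.Adj a b) :
    DHOn G {a, b} := by
  rcases h with rfl | h
  · rw [Set.pair_eq_singleton]
    refine ⟨conn_singleton a, fun S hS _ x hx y hy n _ => ?_⟩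
    rw [hS hx, ← show y = a from hS hy]
    exact .refl hy
  · refine ⟨conn_pair h, fun S hS _ x hx y hy n hn => ?_⟩
    by_cases hxy : x = y
    · exact hxy ▸ .refl hx
    · obtain ⟨k, _, rfl, -⟩ := hn.first hxy
      refine Rch.step hx ?_ (.refl hy)
      rcases hS hx with rfl | rfl <;> rcases hS hy with rfl | rfl
      · exact absurd rfl hxy
      · exact h
      · exact h.symm
      · exact absurd rfl hxy

lemma Dec.good (hx : Dec x) : Good x := by
  induction hn : size x using Nat.strong_induction_on generalizing x with
  | _ n ih =>
  obtain ⟨W, _, G, A, h⟩ := x.exists_cls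
  subst h hn
  rw [size_cls] at ih
  rcases Nat.lt_or_ge (Set.univ : Set W).ncard 2 with h | h
  · rcases (Set.univ : Set W).eq_empty_or_nonempty with h0 | h0
    · rw [good_cls, h0]
      have := dhOn_pair (G := cone G A) (a := none) (b := none) (.inl rfl)
      simpa [coneSet] using this
    · obtain ⟨a, ha⟩ := Set.ncard_eq_one.1
        (show (Set.univ : Set W).ncard = 1 by have := (Set.ncard_pos (Set.toFinite _)).2 h0; omega)
      obtain ⟨b, hb, hbA⟩ := hx.hasMark (cls_ne_zero.2 h0) _ _ _ _ _ rfl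
      obtain rfl : b = a := by rw [ha] at hb; exact hb
      rw [good_cls, ha]
      have := dhOn_pair (G := cone G A) (a := none) (b := some b) (.inr hbA)
      simpa [coneSet] using this
  · obtain ⟨u, hu, w, hw, huw, he, hd⟩ := hx.exists_ext W _ G Set.univ A rfl h
    rw [good_cls]
    refine DHOn.extend (u := some u) (w := some w) ?_ (by simp) (by simp) (by simpa) he.cone
      ⟨none, by simp⟩
    rw [← coneSet_diff, ← good_cls]
    exact ih _ (Set.ncard_sdiff_singleton_lt_of_mem hu) hd rfl

lemma Good.dec (hx : Good x) : Dec x := by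
  induction hn : size x using Nat.strong_induction_on generalizing x with
  | _ n ih =>
  obtain ⟨W, _, G, A, h⟩ := x.exists_cls
  subst h hn
  rcases (Set.univ : Set W).eq_empty_or_nonempty with h0 | ⟨v, hv⟩
  · exact cls_eq_zero.2 h0 ▸ .zero
  have hm := hx.hasMark (cls_ne_zero.2 ⟨v, hv⟩)
  rw [good_cls] at hx
  obtain ⟨u, w, hu, huw, he⟩ := exists_pendant_or_twin (coneSet_univ ▸ hx) none ⟨some v, by simp⟩
  obtain ⟨u, rfl⟩ := Option.ne_none_iff_exists'.1 hu
  rw [← coneSet_univ] at he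
  have hd : Dec (cls G (Set.univ \ {u}) A) := by
    refine ih _ (Set.ncard_sdiff_singleton_lt_of_mem (Set.mem_univ u)) ?_ rfl
    rw [good_cls, coneSet_diff]
    exact hx.remove (w := w) (by simp [coneSet_univ]) huw he
  have hins : insert u (Set.univ \ {u}) = (Set.univ : Set W) := by
    rw [Set.insert_sdiff_singleton, Set.insert_eq_of_mem (Set.mem_univ u)]
  have hdisj : Disjoint {u} (Set.univ \ {u}) := Set.disjoint_sdiff_right
  have isolated : ∀ G' : SimpleGraph W, u ∈ A → (∀ c, ¬ G'.Adj u c) →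
      Dec (cls G' (Set.univ \ {u}) A) → Dec (cls G' Set.univ A) := by
    intro G' huA hG' hd'
    rw [← hins, Set.insert_eq, cls_union hdisj (by simpa using fun b _ => hG' b),
      cls_singleton huA]
    exact .glue .one hd' one_ne_zero'
  rcases w with _ | w
  · rcases he with h | h
    · refine isolated G ((h none (by simp)).2 rfl) (fun c hc => ?_) hd
      exact absurd ((h (some c) (by simp)).1 hc) (by simp)
    · have hadj : ∀ c, c ≠ u → (G.Adj u c ↔ c ∈ A) := fun c hc =>
        h (some c) (by simp) (by simpa) (by simp)
      by_cases huA : u ∈ A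
      · refine Dec.of_flip (isolated _ huA (fun c hc => ?_) (by rw [← tau_cls]; exact hd.tau))
        have := hadj c hc.1.symm
        have h2 := hc.2
        simp only [huA, true_and] at h2
        tauto
      · obtain ⟨m, -, hm⟩ := hm _ _ _ _ _ rfl
        rw [← hins, Set.insert_eq, Set.union_comm, cls_join (B := {u}) hdisj.symm]
        · refine .glue hd ?_ (cls_ne_zero.2 ⟨m, trivial, fun h => huA (h ▸ hm)⟩)
          rw [cls_singleton (Set.mem_singleton u)]
          exact .one
        · rintro a ha _ rfl
          simp [G.adj_comm a, hadj a ha.2]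
        · simpa
  · have := hd.extend W _ G _ A u w rfl (by simp) ⟨trivial, by simpa using huw.symm⟩
      ((isExt_of_cone he).imp (And.imp_right (·.mono Set.sdiff_subset))
        (And.imp_right (·.mono Set.sdiff_subset)))
    rwa [hins] at this

lemma Good.glue (hx : Good x) (hy : Good y) (h0 : x ≠ 0) : Good (glue c x y) :=
  (Dec.glue hx.dec hy.dec h0).good

lemma Good.tau (hx : Good x) : Good (tau x) := hx.dec.tau.good

end MClass

/-! ### Unique decomposition -/

namespace MClass

variable {x y z w p : MClass}

/-- A sum of two nonempty classes. -/
def IsSum (x : MClass) : Prop := ∃ y z, y ≠ 0 ∧ z ≠ 0 ∧ x = y + z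

/-- A product of two nonempty classes. -/
def IsProd (x : MClass) : Prop := ∃ y z, y ≠ 0 ∧ z ≠ 0 ∧ x = y * z

lemma good_zero : Good 0 := Dec.zero.good
lemma good_one : Good 1 := Dec.one.good

lemma Good.add (hx : Good x) (hy : Good y) : Good (x + y) := by
  by_cases h : x = 0
  · rwa [h, zero_add]
  · exact hx.glue hy h

lemma Good.mul (hx : Good x) (hy : Good y) (h : x ≠ 0) : Good (x * y) := hx.glue hy h

lemma add_eq_zero' : x + y = 0 ↔ x = 0 ∧ y = 0 := by
  simp only [← size_eq_zero, size_add, Nat.add_eq_zero_iff]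

lemma mul_eq_zero' : x * y = 0 ↔ x = 0 ∧ y = 0 := by
  simp only [← size_eq_zero, size_mul, Nat.add_eq_zero_iff]

lemma size_pos (h : x ≠ 0) : 0 < size x := Nat.pos_of_ne_zero (size_eq_zero.not.2 h)

lemma not_isSum_one : ¬ IsSum 1 := by
  rintro ⟨y, z, hy, hz, h⟩
  have := congrArg size h
  rw [size_add, size_one] at this
  have := size_pos hy
  have := size_pos hz
  omega

lemma not_isProd_one : ¬ IsProd 1 := by
  rintro ⟨y, z, hy, hz, h⟩
  have := congrArg size h
  rw [size_mul, size_one] at this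
  have := size_pos hy
  have := size_pos hz
  omega

lemma tau_one : tau 1 = 1 := by
  have h : cls (⊥ : SimpleGraph Unit) {()} Set.univ = 1 := cls_singleton trivial
  rw [← h, tau_cls]
  exact (cls_singleton (Set.mem_univ ())).trans h.symm

lemma IsProd.tau (h : IsProd x) : IsProd (tau x) := by
  obtain ⟨y, z, hy, hz, rfl⟩ := h
  exact ⟨MClass.tau y, z, tau_eq_zero.not.2 hy, hz, tau_mul⟩

lemma Good.cases (hx : Good x) (h0 : x ≠ 0) : x = 1 ∨ IsSum x ∨ IsSum (MClass.tau x) ∨ IsProd x := by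
  induction hx.dec with
  | zero => exact absurd rfl h0
  | one => exact .inl rfl
  | @glue c y z hy hz hy0 ihy ihz =>
    by_cases hc : c
    · rw [eq_true hc] at h0 hx ⊢
      by_cases hz0 : z = 0
      · subst hz0
        rw [← mul_def, mul_zero']
        exact ihy hy.good hy0
      · exact .inr (.inr (.inr ⟨y, z, hy0, hz0, rfl⟩))
    · rw [eq_false hc] at h0 hx ⊢
      by_cases hz0 : z = 0
      · subst hz0
        rw [← add_def, add_zero]
        exact ihy hy.good hy0
      · exact .inr (.inl ⟨y, z, hy0, hz0, rfl⟩)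
  | @tau y hy ih =>
    rw [tau_tau]
    rcases ih hy.good (tau_eq_zero.not.1 h0) with rfl | h | h | h
    · exact .inl tau_one
    · exact .inr (.inr (.inl h))
    · exact .inr (.inl h)
    · exact .inr (.inr (.inr h.tau))

lemma IsProd.not_isSum (hg : Good x) (h : IsProd x) : ¬ IsSum x := by
  rintro ⟨v, w, hv, hw, hvw⟩
  obtain ⟨y, z, hy, hz, hyz⟩ := h
  have hv' := (hvw ▸ hg).of_add.1.hasMark hv
  have hw' := (hvw ▸ hg).of_add.2.hasMark hw
  have hz' := ((hyz ▸ hg).of_mul hy).2.hasMark hz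
  obtain ⟨W, _, G, A, rfl⟩ := x.exists_cls
  obtain ⟨S₁, S₂, B, hS, hd, hG, hA, rfl, rfl⟩ := exists_split_mul hyz
  obtain ⟨S₃, S₄, hS', hd', hG', rfl, rfl⟩ := exists_split_add hvw
  obtain ⟨m₃, hm₃, hm₃A⟩ := hv' _ _ _ _ _ rfl
  obtain ⟨m₄, hm₄, hm₄A⟩ := hw' _ _ _ _ _ rfl
  obtain ⟨b, hb, hbB⟩ := hz' _ _ _ _ _ rfl
  have hm : ∀ m ∈ A, G.Adj m b := fun m hm =>
    (hG m ((show m ∈ S₁ ∪ S₂ from hS ▸ trivial).resolve_right fun h => hA m h hm) b hb).2 ⟨hm, hbB⟩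
  rcases (show b ∈ S₃ ∪ S₄ from hS' ▸ trivial) with h | h
  · exact hG' b h m₄ hm₄ (hm _ hm₄A).symm
  · exact hG' m₃ hm₃ b h (hm _ hm₃A)

lemma IsSum.not_isSum_tau (hg : Good x) (h : IsSum x) : ¬ IsSum (tau x) := by
  rintro ⟨v, w, hv, hw, hvw⟩
  obtain ⟨y, z, hy, hz, hyz⟩ := h
  have hg' := hg.tau
  have hv' := (hvw ▸ hg').of_add.1.hasMark hv
  have hw' := (hvw ▸ hg').of_add.2.hasMark hw
  have hy' := (hyz ▸ hg).of_add.1.hasMark hy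
  have hz' := (hyz ▸ hg).of_add.2.hasMark hz
  obtain ⟨W, _, G, A, rfl⟩ := x.exists_cls
  rw [tau_cls] at hvw
  obtain ⟨S₁, S₂, hS, hd, hG, rfl, rfl⟩ := exists_split_add hyz
  obtain ⟨S₃, S₄, hS', hd', hG', rfl, rfl⟩ := exists_split_add hvw
  obtain ⟨m₁, hm₁, hm₁A⟩ := hy' _ _ _ _ _ rfl
  obtain ⟨m₂, hm₂, hm₂A⟩ := hz' _ _ _ _ _ rfl
  obtain ⟨m₃, hm₃, hm₃A⟩ := hv' _ _ _ _ _ rfl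
  obtain ⟨m₄, hm₄, hm₄A⟩ := hw' _ _ _ _ _ rfl
  have adj : ∀ a ∈ S₃, a ∈ A → ∀ b ∈ S₄, b ∈ A → G.Adj a b := by
    intro a ha haA b hb hbA
    have hab : a ≠ b := fun h => Set.disjoint_left.1 hd' ha (h ▸ hb)
    have := hG' a ha b hb
    simpa [flipGraph, hab, haA, hbA] using this
  have c12 : ∀ a, a ∈ S₁ ∪ S₂ := fun a => hS ▸ trivial
  have c34 : ∀ a, a ∈ S₃ ∪ S₄ := fun a => hS' ▸ trivial
  have h34 := adj m₃ hm₃ hm₃A m₄ hm₄ hm₄A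
  have n12 : ∀ a ∈ S₂, ∀ b ∈ S₁, ¬ G.Adj a b := fun a ha b hb h => hG b hb a ha h.symm
  rcases c12 m₃ with h3 | h3 <;> rcases c12 m₄ with h4 | h4
  · rcases c34 m₂ with h2 | h2
    · exact n12 _ hm₂ _ h4 (adj _ h2 hm₂A _ hm₄ hm₄A)
    · exact hG _ h3 _ hm₂ (adj _ hm₃ hm₃A _ h2 hm₂A)
  · exact hG _ h3 _ h4 h34
  · exact n12 _ h3 _ h4 h34
  · rcases c34 m₁ with h1 | h1
    · exact hG _ hm₁ _ h4 (adj _ h1 hm₁A _ hm₄ hm₄A)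
    · exact n12 _ h3 _ hm₁ (adj _ hm₃ hm₃A _ h1 hm₁A)

lemma IsProd.not_isSum_tau (hg : Good x) (h : IsProd x) : ¬ IsSum (MClass.tau x) :=
  h.tau.not_isSum hg.tau

/-- Every product has a left factor which is not a product. -/
lemma exists_mul_of_isProd (h : IsProd x) :
    ∃ y z, y ≠ 0 ∧ z ≠ 0 ∧ ¬ IsProd y ∧ x = y * z := by
  induction hn : size x using Nat.strong_induction_on generalizing x with
  | _ n ih =>
  obtain ⟨y, z, hy, hz, rfl⟩ := h
  by_cases hp : IsProd y
  · have := size_pos hz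
    rw [size_mul] at hn
    obtain ⟨y', z', hy', hz', hp', rfl⟩ := ih (size y) (by omega) hp rfl
    exact ⟨y', z' + z, hy', fun h => hz (add_eq_zero'.1 h).2, hp', mul_mul_eq⟩
  · exact ⟨y, z, hy, hz, hp, rfl⟩

lemma not_hasMark_zero_mul : ¬ HasMark (0 * x) := by
  intro h
  obtain ⟨W, _, G, A, hx⟩ := (0 * x).exists_cls
  obtain ⟨a, -, ha⟩ := h _ _ _ _ _ hx.symm
  obtain ⟨S₁, S₂, B, hS, hd, hG, hA, h1, -⟩ := exists_split_mul hx.symm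
  rw [cls_eq_zero] at h1
  subst h1
  rcases (show a ∈ ∅ ∪ S₂ from hS ▸ trivial) with h | h
  · exact h
  · exact hA a h ha

/-- The decomposition of a product with left factor not a product is unique. -/
lemma mul_inj (hx : HasMark x) (hx' : ¬ IsProd x) (hz : ¬ IsProd z) (h : x * y = z * w) :
    x = z ∧ y = w := by
  obtain ⟨e, f, g, k, rfl, rfl, rfl, rfl⟩ := mul_eq_mul h hx
  have he : e ≠ 0 := by
    rintro rfl
    exact not_hasMark_zero_mul hx
  obtain rfl : f = 0 := by_contra fun hf => hx' ⟨e, f, he, hf, rfl⟩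
  obtain rfl : g = 0 := by_contra fun hg => hz ⟨e, g, he, hg, rfl⟩
  exact ⟨rfl, rfl⟩

/-- An indecomposable summand of a sum is a summand of one of the terms. -/
lemma summand_cases (hp : ¬ IsSum p) (h : p + x = z + w) :
    (∃ z', z = p + z' ∧ x = z' + w) ∨ ∃ w', w = p + w' ∧ x = z + w' := by
  obtain ⟨e, f, g, k, rfl, rfl, rfl, rfl⟩ := add_eq_add h
  by_cases hf : f = 0
  · subst hf
    exact .inl ⟨g, by rw [add_zero], by rw [zero_add]⟩
  · obtain rfl : e = 0 := by_contra fun he => hp ⟨e, f, he, hf, rfl⟩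
    exact .inr ⟨k, by rw [zero_add], by rw [zero_add]⟩

open Classical in
lemma mem_of_add_eq_sum (hp : ¬ IsSum p) (hp0 : p ≠ 0) (M : Multiset MClass) :
    (∀ q ∈ M, ¬ IsSum q) → ∀ x, p + x = M.sum → p ∈ M ∧ x = (M.erase p).sum := by
  induction M using Multiset.induction_on with
  | empty =>
    intro _ x h
    exact absurd (add_eq_zero'.1 h).1 hp0
  | cons q M ih =>
    intro hM x h
    rw [Multiset.sum_cons] at h
    rcases summand_cases hp h with ⟨z', h1, h2⟩ | ⟨w', h1, h2⟩
    · have hz' : z' = 0 := by_contra fun hz => hM q (by simp) ⟨p, z', hp0, hz, h1⟩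
      subst hz'
      rw [add_zero] at h1
      subst h1
      simpa using h2
    · obtain ⟨h3, h4⟩ := ih (fun r hr => hM r (by simp [hr])) w' h1.symm
      refine ⟨by simp [h3], ?_⟩
      by_cases hq : q = p
      · subst hq
        rw [Multiset.erase_cons_head, h2, h1]
      · rw [Multiset.erase_cons_tail _ (by simpa using hq), Multiset.sum_cons, ← h4, h2]

/-- Decompositions into indecomposable summands are unique. -/
lemma sum_injective (M : Multiset MClass) : ∀ M' : Multiset MClass,
    (∀ q ∈ M, ¬ IsSum q ∧ q ≠ 0) → (∀ q ∈ M', ¬ IsSum q ∧ q ≠ 0) → M.sum = M'.sum → M = M' := by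
  classical
  induction M using Multiset.induction_on with
  | empty =>
    intro M' _ h' h
    induction M' using Multiset.induction_on with
    | empty => rfl
    | cons q M' _ =>
      rw [Multiset.sum_cons] at h
      exact absurd (add_eq_zero'.1 h.symm).1 (h' q (by simp)).2
  | cons p M ih =>
    intro M' hM hM' h
    rw [Multiset.sum_cons] at h
    obtain ⟨h1, h2⟩ := mem_of_add_eq_sum (hM p (by simp)).1 (hM p (by simp)).2 M'
      (fun q hq => (hM' q hq).1) _ h
    rw [ih (M'.erase p) (fun q hq => hM q (by simp [hq]))
      (fun q hq => hM' q (Multiset.mem_of_mem_erase hq)) h2, Multiset.cons_erase h1]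

/-- Every class is a sum of indecomposable ones. -/
lemma exists_sum (x : MClass) : ∃ M : Multiset MClass, (∀ q ∈ M, ¬ IsSum q ∧ q ≠ 0) ∧ M.sum = x := by
  induction hn : size x using Nat.strong_induction_on generalizing x with
  | _ n ih =>
  by_cases h0 : x = 0
  · exact ⟨0, by simp [h0]⟩
  by_cases hx : IsSum x
  · obtain ⟨y, z, hy, hz, rfl⟩ := hx
    have := size_pos hy
    have := size_pos hz
    rw [size_add] at hn
    obtain ⟨M, hM, rfl⟩ := ih _ (by omega) y rfl
    obtain ⟨M', hM', rfl⟩ := ih _ (by omega) z rfl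
    refine ⟨M + M', fun q hq => ?_, by simp⟩
    rcases Multiset.mem_add.1 hq with h | h
    · exact hM q h
    · exact hM' q h
  · exact ⟨{x}, by simpa using ⟨hx, h0⟩, by simp⟩

lemma good_of_mem {M : Multiset MClass} (h : Good M.sum) {q : MClass} (hq : q ∈ M) : Good q := by
  obtain ⟨M', rfl⟩ := Multiset.exists_cons_of_mem hq
  rw [Multiset.sum_cons] at h
  exact h.of_add.1

lemma size_le_of_mem {M : Multiset MClass} {q : MClass} (hq : q ∈ M) : size q ≤ size M.sum := by
  obtain ⟨M', rfl⟩ := Multiset.exists_cons_of_mem hq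
  rw [Multiset.sum_cons, size_add]
  omega

end MClass

/-! ### Rooted graphs as marked graphs -/

namespace MClass

/-- The class of `G` with the vertex `v` removed and its neighbours marked. -/
def link {W : Type} [Finite W] (G : SimpleGraph W) (v : W) : MClass :=
  cls G {b | b ≠ v} {b | G.Adj v b}

variable {W W' : Type} [Finite W] [Finite W'] {G : SimpleGraph W} {G' : SimpleGraph W'} {v : W}
  {v' : W'}

lemma good_link : Good (link G v) ↔ G.Connected ∧ DistanceHereditary G := by
  have : Nonempty W := ⟨v⟩
  rw [← dhOn_univ_iff, link, good_cls]
  have himg : (fun a : Option W => a.getD v) '' coneSet {b | b ≠ v} = Set.univ := by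
    ext b
    simp only [Set.mem_image, Set.mem_univ, iff_true]
    by_cases hb : b = v
    · exact ⟨none, by simp, hb.symm⟩
    · exact ⟨some b, by simpa using hb, rfl⟩
  rw [← himg]
  refine (dhOn_image ?_ ?_).symm
  · rintro (_ | a) ha (_ | b) hb hab
    · rfl
    · exact absurd hab.symm (by simpa using hb)
    · exact absurd hab (by simpa using ha)
    · simpa using hab
  · rintro (_ | a) ha (_ | b) hb
    · simp
    · simp
    · simp [G.adj_comm a]
    · simp

lemma link_eq (φ : G ≃g G') (h : φ v = v') : link G v = link G' v' := by
  subst h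
  refine Eq.symm (cls_eq_mk (X := ⟨{b | b ≠ v}, G.induce _, _⟩) (fun a => φ a.1)
    (φ.injective.comp Subtype.val_injective) ?_ (fun a b => φ.map_adj_iff) fun a => φ.map_adj_iff)
  ext b
  constructor
  · rintro ⟨a, rfl⟩
    exact fun h => a.2 (φ.injective h)
  · intro hb
    exact ⟨⟨φ.symm b, fun h => hb (by simp [← h])⟩, by simp⟩

open Classical in
lemma exists_iso_of_link_eq (h : link G v = link G' v') : ∃ φ : G ≃g G', φ v = v' := by
  obtain ⟨e, h1, h2⟩ := Quotient.exact h
  set f : W ≃ W' := (Equiv.optionSubtypeNe v).symm.trans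
    ((Equiv.optionCongr e).trans (Equiv.optionSubtypeNe v'))
  have hv : f v = v' := by
    simp only [f, Equiv.trans_apply, Equiv.optionSubtypeNe_symm_self]
    rfl
  have hf : ∀ a (ha : a ≠ v), f a = (e ⟨a, ha⟩).1 := fun a ha => by
    simp only [f, Equiv.trans_apply, Equiv.optionSubtypeNe_symm_of_ne ha]
    rfl
  refine ⟨⟨f, fun {a b} => ?_⟩, hv⟩
  by_cases ha : a = v <;> by_cases hb : b = v
  · subst ha; subst hb; simp
  · subst ha
    rw [hv, hf b hb]
    exact h2 ⟨b, hb⟩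
  · subst hb
    rw [hv, hf a ha, G.adj_comm, G'.adj_comm]
    exact h2 ⟨a, ha⟩
  · rw [hf a ha, hf b hb]
    exact h1 ⟨a, ha⟩ ⟨b, hb⟩

lemma exists_link (x : MClass) : ∃ (G : SimpleGraph (Fin (size x + 1))) (v : Fin (size x + 1)),
    link G v = x := by
  induction x using Quotient.inductionOn with
  | _ X =>
  obtain ⟨e⟩ : Nonempty (Option X.V ≃ Fin (Nat.card X.V + 1)) := by
    refine ⟨Finite.equivFinOfCardEq ?_⟩
    rw [Finite.card_option]
  refine ⟨(cone X.graph X.mark).map e.toEmbedding, e none, ?_⟩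
  refine cls_eq_mk (fun a => e (some a)) (fun a b h => Option.some_injective _ (e.injective h)) ?_
    (fun a b => ?_) fun a => ?_
  · ext b
    constructor
    · rintro ⟨a, rfl⟩
      exact fun h => Option.some_ne_none a (e.injective h)
    · intro hb
      obtain ⟨_ | a, rfl⟩ := e.surjective b
      · exact absurd rfl hb
      · exact ⟨a, rfl⟩
  · exact SimpleGraph.map_adj_apply (f := e.toEmbedding)
  · exact SimpleGraph.map_adj_apply (f := e.toEmbedding)

/-- The good classes with `n` vertices. -/
def goodClasses (n : ℕ) : Set MClass := {x | Good x ∧ size x = n}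

lemma size_link : size (link G v) + 1 = Nat.card W := by
  rw [link, size_cls, ← Set.ncard_univ, ← Set.ncard_sdiff_singleton_add_one (Set.mem_univ v)]
  congr 2
  ext
  simp

theorem numRootedConnDH_succ (n : ℕ) : numRootedConnDH (n + 1) = (goodClasses n).ncard := by
  have hsize : ∀ (G : SimpleGraph (Fin (n + 1))) v, size (link G v) = n := fun G v => by
    have := size_link (G := G) (v := v)
    rw [Nat.card_fin] at this
    omega
  rw [← Nat.card_coe_set_eq]
  refine Nat.card_congr (Equiv.ofBijective (Quot.lift (fun p => ⟨link p.1.1 p.1.2, ?_⟩) ?_) ⟨?_, ?_⟩)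
  · exact ⟨good_link.2 p.2, hsize _ _⟩
  · rintro p q ⟨φ, h⟩
    exact Subtype.ext (link_eq φ h)
  · rintro ⟨p⟩ ⟨q⟩ h
    exact Quot.sound (exists_iso_of_link_eq (congrArg Subtype.val h))
  · rintro ⟨x, hx, rfl⟩
    obtain ⟨G, v, h⟩ := exists_link x
    exact ⟨Quot.mk _ ⟨(G, v), good_link.1 (h.symm ▸ hx)⟩, Subtype.ext h⟩

lemma finite_size_le (n : ℕ) : {x : MClass | size x ≤ n}.Finite := by
  refine Set.Finite.subset (Set.finite_range fun p : (Σ m : Fin (n + 1),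
    SimpleGraph (Fin (m.1 + 1)) × Fin (m.1 + 1)) => link p.2.1 p.2.2) fun x hx => ?_
  obtain ⟨G, v, h⟩ := exists_link x
  exact ⟨⟨⟨size x, Nat.lt_succ_of_le hx⟩, G, v⟩, h⟩

end MClass

/-! ### Generating functions of sets of marked graphs -/

open scoped ENNReal

namespace MClass

/-- The size generating function of `S` at `w`. -/
noncomputable def gf (S : Set MClass) (w : ℝ≥0∞) : ℝ≥0∞ := ∑' x : S, w ^ size x.1

variable {S S' : Set MClass} {w : ℝ≥0∞} {n : ℕ∞} {x y : MClass}

lemma gf_mono (h : S ⊆ S') : gf S w ≤ gf S' w :=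
  ENNReal.tsum_mono_subtype (fun x => w ^ size x) h

lemma gf_union_le : gf (S ∪ S') w ≤ gf S w + gf S' w :=
  ENNReal.tsum_union_le (fun x => w ^ size x) S S'

lemma gf_union (h : Disjoint S S') : gf (S ∪ S') w = gf S w + gf S' w :=
  ENNReal.summable.tsum_union_disjoint (f := fun x => w ^ size x) h ENNReal.summable

lemma gf_singleton : gf {x} w = w ^ size x := tsum_singleton x fun x => w ^ size x

lemma gf_image {α : Type*} {f : α → MClass} {A : Set α} (h : A.InjOn f) :
    gf (f '' A) w = ∑' a : A, w ^ size (f a) := tsum_image (fun x => w ^ size x) h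

lemma gf_image_tau : gf (tau '' S) w = gf S w := by
  rw [gf_image tau_injective.injOn]
  simp only [size_tau, gf]

lemma tsum_prod_pow (S S' : Set MClass) :
    ∑' a : S ×ˢ S', w ^ size (a.1.1 * a.1.2) = gf S w * gf S' w := by
  rw [← (Equiv.Set.prod S S').symm.tsum_eq]
  simp only [gf, size_mul, pow_add]
  rw [← ENNReal.tsum_mul_right]
  simp only [← ENNReal.tsum_mul_left]
  exact ENNReal.tsum_prod (f := fun (a : S) (b : S') => w ^ size a.1 * w ^ size b.1)

lemma gf_image2_mul_le : gf (Set.image2 (· * ·) S S') w ≤ gf S w * gf S' w := by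
  rw [← tsum_prod_pow, ← Set.image_prod]
  exact ENNReal.tsum_le_tsum_comp_of_surjective Set.imageFactorization_surjective
    fun x : (fun p : MClass × MClass => p.1 * p.2) '' S ×ˢ S' => w ^ size x.1

lemma gf_image2_mul (h : (S ×ˢ S').InjOn fun p : MClass × MClass => p.1 * p.2) :
    gf (Set.image2 (· * ·) S S') w = gf S w * gf S' w := by
  rw [← tsum_prod_pow, ← Set.image_prod, gf_image h]

/-- The nonempty good classes of size at most `n`. -/
def goodsLE (n : ℕ∞) : Set MClass := {x | Good x ∧ x ≠ 0 ∧ size x ≤ n}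

/-- The sums in `goodsLE n`. -/
def sumsLE (n : ℕ∞) : Set MClass := {x | x ∈ goodsLE n ∧ IsSum x}

/-- The classes in `goodsLE n` that are not sums. -/
def nonSumsLE (n : ℕ∞) : Set MClass := {x | x ∈ goodsLE n ∧ ¬ IsSum x}

/-- The classes in `goodsLE n` that are not products. -/
def nonProdsLE (n : ℕ∞) : Set MClass := {x | x ∈ goodsLE n ∧ ¬ IsProd x}

lemma mul_mem_goodsLE (hx : x ≠ 0) (h : x * y ∈ goodsLE n) (hy : y ≠ 0) :
    x ∈ goodsLE n ∧ y ∈ goodsLE n := by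
  obtain ⟨hg, -, hn⟩ := h
  rw [size_mul, Nat.cast_add] at hn
  exact ⟨⟨(hg.of_mul hx).1, hx, le_self_add.trans hn⟩, (hg.of_mul hx).2, hy,
    le_add_self.trans hn⟩

lemma tau_mem_goodsLE (h : x ∈ goodsLE n) : tau x ∈ goodsLE n :=
  ⟨h.1.tau, tau_eq_zero.not.2 h.2.1, by simpa using h.2.2⟩

lemma mem_image_tau (h : x ∈ goodsLE n) (h' : IsSum (tau x)) : x ∈ tau '' sumsLE n :=
  ⟨tau x, ⟨tau_mem_goodsLE h, h'⟩, tau_tau⟩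

lemma mem_image2_mul (h : x ∈ goodsLE n) (h' : IsProd x) :
    x ∈ Set.image2 (· * ·) (nonProdsLE n) (goodsLE n) := by
  obtain ⟨y, z, hy, hz, hp, rfl⟩ := exists_mul_of_isProd h'
  obtain ⟨h1, h2⟩ := mul_mem_goodsLE hy h hz
  exact ⟨y, ⟨h1, hp⟩, z, h2, rfl⟩

lemma gf_goodsLE_le_mul :
    gf (goodsLE n) w ≤ gf (nonProdsLE n) w + gf (nonProdsLE n) w * gf (goodsLE n) w := by
  refine (gf_mono fun x hx => ?_).trans
    (gf_union_le.trans (add_le_add_right gf_image2_mul_le _))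
  by_cases h : IsProd x
  · exact .inr (mem_image2_mul hx h)
  · exact .inl ⟨hx, h⟩

lemma gf_goodsLE_le_add : gf (goodsLE n) w ≤ gf (nonSumsLE n) w + gf (sumsLE n) w := by
  refine (gf_mono fun x hx => ?_).trans gf_union_le
  by_cases h : IsSum x
  · exact .inr ⟨hx, h⟩
  · exact .inl ⟨hx, h⟩

lemma gf_nonProdsLE_le : gf (nonProdsLE n) w ≤ w + 2 * gf (sumsLE n) w := by
  have : nonProdsLE n ⊆ {1} ∪ (sumsLE n ∪ tau '' sumsLE n) := by
    rintro x ⟨hx, h⟩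
    rcases hx.1.cases hx.2.1 with h1 | h1 | h1 | h1
    · exact .inl h1
    · exact .inr (.inl ⟨hx, h1⟩)
    · exact .inr (.inr (mem_image_tau hx h1))
    · exact absurd h1 h
  calc gf (nonProdsLE n) w
    _ ≤ gf {1} w + (gf (sumsLE n) w + gf (tau '' sumsLE n) w) :=
      (gf_mono this).trans (gf_union_le.trans (by gcongr; exact gf_union_le))
    _ = _ := by rw [gf_image_tau, gf_singleton, size_one, pow_one, two_mul]

lemma nonSumsLE_subset : nonSumsLE n ⊆
    {1} ∪ (tau '' sumsLE n ∪ Set.image2 (· * ·) (nonProdsLE n) (goodsLE n)) := by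
  rintro x ⟨hx, h⟩
  rcases hx.1.cases hx.2.1 with h1 | h1 | h1 | h1
  · exact .inl h1
  · exact absurd h1 h
  · exact .inr (.inl (mem_image_tau hx h1))
  · exact .inr (.inr (mem_image2_mul hx h1))

lemma gf_nonSumsLE_le : gf (nonSumsLE n) w ≤
    w + (gf (sumsLE n) w + gf (nonProdsLE n) w * gf (goodsLE n) w) := by
  calc gf (nonSumsLE n) w
    _ ≤ gf {1} w + (gf (tau '' sumsLE n) w +
        gf (Set.image2 (· * ·) (nonProdsLE n) (goodsLE n)) w) :=
      (gf_mono nonSumsLE_subset).trans (gf_union_le.trans (by gcongr; exact gf_union_le))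
    _ ≤ _ := by
      rw [gf_image_tau, gf_singleton, size_one, pow_one]
      gcongr
      exact gf_image2_mul_le

lemma injOn_mul : (nonProdsLE n ×ˢ goodsLE n).InjOn fun p : MClass × MClass => p.1 * p.2 := by
  rintro ⟨x, y⟩ hx ⟨z, w⟩ hz h
  obtain ⟨h1, h2⟩ := mul_inj (hx.1.1.1.hasMark hx.1.1.2.1) hx.1.2 hz.1.2 h
  exact Prod.ext h1 h2

lemma le_gf_nonSumsLE_top : w + (gf (sumsLE ⊤) w + gf (nonProdsLE ⊤) w * gf (goodsLE ⊤) w) ≤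
    gf (nonSumsLE ⊤) w := by
  have hprod : ∀ x ∈ Set.image2 (· * ·) (nonProdsLE ⊤) (goodsLE ⊤), IsProd x := by
    rintro _ ⟨y, hy, z, hz, rfl⟩
    exact ⟨y, z, hy.1.2.1, hz.2.1, rfl⟩
  have hone : gf {1} w = w := by rw [gf_singleton, size_one, pow_one]
  rw [← gf_image2_mul injOn_mul, ← gf_image_tau (S := sumsLE ⊤), ← gf_union]
  nth_rewrite 1 [← hone]
  rw [← gf_union]
  · refine gf_mono ?_
    rintro x (rfl | ⟨y, hy, rfl⟩ | hx)
    · exact ⟨⟨good_one, one_ne_zero', le_top⟩, not_isSum_one⟩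
    · exact ⟨tau_mem_goodsLE hy.1, hy.2.not_isSum_tau hy.1.1⟩
    · have hp := hprod x hx
      obtain ⟨y, hy, z, hz, rfl⟩ := hx
      have hg := hy.1.1.mul hz.1 hy.1.2.1
      exact ⟨⟨hg, fun h => hy.1.2.1 (mul_eq_zero'.1 h).1, le_top⟩, hp.not_isSum hg⟩
  · rw [Set.disjoint_singleton_left]
    rintro (⟨y, hy, h⟩ | h)
    · rw [← tau_one] at h
      exact not_isSum_one (tau_injective h ▸ hy.2)
    · exact not_isProd_one (hprod 1 h)
  · rw [Set.disjoint_left]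
    rintro _ ⟨y, hy, rfl⟩ h
    exact (hprod _ h).not_isSum_tau hy.1.1.tau (by rw [tau_tau]; exact hy.2)

/-- The sums of classes in `F`. -/
def sumsOf (F : Finset MClass) : Set MClass := {x | ∃ M : Multiset MClass, (∀ q ∈ M, q ∈ F) ∧ M.sum = x}

open Classical in
theorem gf_sumsOf (F : Finset MClass) (hF : ∀ q ∈ F, ¬ IsSum q ∧ q ≠ 0) :
    gf (sumsOf F) w = ∏ q ∈ F, (1 - w ^ size q)⁻¹ := by
  induction F using Finset.induction_on with
  | empty =>
    have : sumsOf ∅ = {0} := by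
      ext x
      constructor
      · rintro ⟨M, hM, rfl⟩
        rw [Multiset.eq_zero_of_forall_notMem fun q hq => Finset.notMem_empty q (hM q hq)]
        rfl
      · rintro rfl
        exact ⟨0, by simp⟩
    simp [this, gf_singleton]
  | insert p F hp ih =>
    set f : ℕ × MClass → MClass := fun a => a.1 • p + a.2
    have himg : f '' (Set.univ ×ˢ sumsOf F) = sumsOf (insert p F) := by
      ext x
      constructor
      · rintro ⟨⟨n, _⟩, ⟨-, M, hM, rfl⟩, rfl⟩
        refine ⟨Multiset.replicate n p + M, fun q hq => ?_, by simp [f]⟩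
        rcases Multiset.mem_add.1 hq with h | h
        · exact Multiset.eq_of_mem_replicate h ▸ Finset.mem_insert_self _ _
        · exact Finset.mem_insert_of_mem (hM q h)
      · rintro ⟨M, hM, rfl⟩
        refine ⟨(M.count p, (M.filter (p ≠ ·)).sum), ⟨trivial, _, fun q hq => ?_, rfl⟩, ?_⟩
        · obtain ⟨h1, h2⟩ := Multiset.mem_filter.1 hq
          exact (Finset.mem_insert.1 (hM q h1)).resolve_left h2.symm
        · conv_rhs => rw [← Multiset.filter_add_not (p = ·) M]
          simp [f, Multiset.filter_eq]
    have hinj : (Set.univ ×ˢ sumsOf F).InjOn f := by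
      rintro ⟨n, _⟩ ⟨-, M, hM, rfl⟩ ⟨m, _⟩ ⟨-, M', hM', rfl⟩ h
      have aux : ∀ (k : ℕ) (N : Multiset MClass), (∀ q ∈ N, q ∈ F) →
          ∀ q ∈ Multiset.replicate k p + N, ¬ IsSum q ∧ q ≠ 0 := fun k N hN q hq => by
        refine hF q ?_
        rcases Multiset.mem_add.1 hq with h | h
        · exact Multiset.eq_of_mem_replicate h ▸ Finset.mem_insert_self _ _
        · exact Finset.mem_insert_of_mem (hN q h)
      have hc : ∀ (N : Multiset MClass), (∀ q ∈ N, q ∈ F) → N.count p = 0 := fun N hN =>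
        Multiset.count_eq_zero.2 fun h => hp (hN p h)
      have heq := sum_injective _ _ (aux n M hM) (aux m M' hM') (by simpa [f] using h)
      have hnm := congrArg (Multiset.count p) heq
      simp only [Multiset.count_add, Multiset.count_replicate_self, hc M hM, hc M' hM',
        add_zero] at hnm
      subst hnm
      rw [add_left_cancel heq]
    have hsize : ∀ (k : ℕ) (x : MClass), size (k • p + x) = k * size p + size x := fun k x => by
      induction k with
      | zero => simp
      | succ k ih => rw [succ_nsmul', add_assoc, size_add, ih]; ring
    rw [Finset.prod_insert hp, ← ih fun q hq => hF q (Finset.mem_insert_of_mem hq), ← himg,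
      gf_image hinj, ← ENNReal.tsum_geometric, ← ENNReal.tsum_mul_right]
    rw [← (Equiv.Set.prod Set.univ (sumsOf F)).symm.tsum_eq, ENNReal.tsum_prod',
      ← (Equiv.Set.univ ℕ).symm.tsum_eq]
    refine tsum_congr fun k => ?_
    rw [gf, ← ENNReal.tsum_mul_left]
    refine tsum_congr fun a => ?_
    rw [← pow_mul, ← pow_add, mul_comm (size p)]
    exact congrArg (w ^ ·) (hsize k a)

lemma prod_le_gf_goodsLE (F : Finset MClass) (hF : ∀ q ∈ F, q ∈ nonSumsLE ⊤) :
    ∏ q ∈ F, (1 - w ^ size q)⁻¹ ≤ 1 + gf (goodsLE ⊤) w := by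
  rw [← gf_sumsOf F fun q hq => ⟨(hF q hq).2, (hF q hq).1.2.1⟩]
  have h : gf {0} w = 1 := by rw [gf_singleton, size_zero, pow_zero]
  rw [← h]
  refine (gf_mono ?_).trans gf_union_le
  rintro _ ⟨M, hM, rfl⟩
  by_cases h0 : M.sum = 0
  · exact .inl h0
  · refine .inr ⟨?_, h0, le_top⟩
    exact Multiset.sum_induction _ _ (fun _ _ => Good.add) good_zero fun q hq => (hF q (hM q hq)).1.1

lemma gf_sumsLE_succ_le (n : ℕ) (F : Finset MClass) (hF : (F : Set MClass) = nonSumsLE n) :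
    1 + (gf (nonSumsLE n) w + gf (sumsLE (n + 1 : ℕ)) w) ≤ ∏ q ∈ F, (1 - w ^ size q)⁻¹ := by
  have hF' : ∀ q, q ∈ F ↔ q ∈ nonSumsLE n := fun q => by rw [← hF, Finset.mem_coe]
  rw [← gf_sumsOf F fun q hq => ⟨((hF' q).1 hq).2, ((hF' q).1 hq).1.2.1⟩]
  have h : gf {0} w = 1 := by rw [gf_singleton, size_zero, pow_zero]
  rw [← h, ← gf_union, ← gf_union]
  · refine gf_mono ?_
    rintro x (rfl | hx | hx)
    · exact ⟨0, by simp⟩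
    · exact ⟨{x}, by simpa using (hF' x).2 hx, by simp⟩
    · obtain ⟨y, z, hy, hz, rfl⟩ := hx.2
      obtain ⟨M, hM, rfl⟩ := exists_sum y
      obtain ⟨N, hN, rfl⟩ := exists_sum z
      have hs := hx.1.2.2
      rw [size_add, Nat.cast_le] at hs
      have hg := hx.1.1
      have := size_pos hy
      have := size_pos hz
      refine ⟨M + N, fun q hq => (hF' q).2 ?_, by simp⟩
      rcases Multiset.mem_add.1 hq with h | h
      · refine ⟨⟨good_of_mem hg.of_add.1 h, (hM q h).2, ?_⟩, (hM q h).1⟩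
        have := size_le_of_mem h
        exact_mod_cast (by omega : size q ≤ n)
      · refine ⟨⟨good_of_mem hg.of_add.2 h, (hN q h).2, ?_⟩, (hN q h).1⟩
        have := size_le_of_mem h
        exact_mod_cast (by omega : size q ≤ n)
  · rw [Set.disjoint_singleton_left]
    rintro (h | h)
    · exact h.1.2.1 rfl
    · exact h.1.2.1 rfl
  · rw [Set.disjoint_left]
    exact fun x hx hx' => hx.2 hx'.2

end MClass

/-! ### Real generating functions -/

open scoped ENNReal

namespace MClass

/-- The real-valued size generating function. -/
noncomputable def gfR (S : Set MClass) (z : ℝ) : ℝ := (gf S (ENNReal.ofReal z)).toReal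

variable {S S' : Set MClass} {z : ℝ} {n : ℕ∞}

lemma gfR_nonneg : 0 ≤ gfR S z := ENNReal.toReal_nonneg

lemma pow_size_ne_top (x : MClass) : ENNReal.ofReal z ^ size x ≠ ∞ :=
  ENNReal.pow_ne_top ENNReal.ofReal_ne_top

lemma toReal_pow_size (hz : 0 ≤ z) (x : MClass) : (ENNReal.ofReal z ^ size x).toReal = z ^ size x := by
  rw [ENNReal.toReal_pow, ENNReal.toReal_ofReal hz]

lemma hasSum_gfR (hz : 0 ≤ z) (h : gf S (ENNReal.ofReal z) ≠ ∞) :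
    HasSum (fun x : S => z ^ size x.1) (gfR S z) := by
  have := (ENNReal.summable_toReal h).hasSum
  rw [gfR, gf, ENNReal.tsum_toReal_eq fun x : S => pow_size_ne_top x.1]
  simpa only [toReal_pow_size hz] using this

lemma finite_goodsLE (n : ℕ) : (goodsLE n).Finite :=
  (finite_size_le n).subset fun x hx => by
    have := hx.2.2
    exact_mod_cast this

lemma gf_ne_top_of_finite (h : S.Finite) : gf S (ENNReal.ofReal z) ≠ ∞ := by
  have := h.fintype
  rw [gf, tsum_fintype]
  exact ENNReal.sum_ne_top.2 fun x _ => pow_size_ne_top x.1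

lemma gf_ne_top_mono (h : S ⊆ S') (h' : gf S' (ENNReal.ofReal z) ≠ ∞) :
    gf S (ENNReal.ofReal z) ≠ ∞ := ne_top_of_le_ne_top h' (gf_mono h)

lemma gf_ne_top_of_le {z' : ℝ} (hz : z' ≤ z) (h : gf S (ENNReal.ofReal z) ≠ ∞) :
    gf S (ENNReal.ofReal z') ≠ ∞ := by
  refine ne_top_of_le_ne_top h (ENNReal.tsum_le_tsum fun x => ?_)
  gcongr

/-- The non-sums in `goodsLE n`, as a finset. -/
noncomputable def nonSumsFinset (n : ℕ) : Finset MClass :=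
  ((finite_goodsLE n).subset (t := nonSumsLE n) fun _ h => h.1).toFinset

lemma mem_nonSumsFinset {n : ℕ} {x : MClass} : x ∈ nonSumsFinset n ↔ x ∈ nonSumsLE n := by
  simp [nonSumsFinset]

lemma gfR_nonSumsLE (hz : 0 ≤ z) (n : ℕ) :
    gfR (nonSumsLE n) z = ∑ x ∈ nonSumsFinset n, z ^ size x := by
  have h := hasSum_gfR hz (gf_ne_top_of_finite (z := z)
    ((finite_goodsLE n).subset (t := nonSumsLE n) fun _ h => h.1))
  have h2 := (nonSumsFinset n).hasSum fun x => z ^ size x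
  have h3 : ((nonSumsFinset n : Finset MClass) : Set MClass) = nonSumsLE n := by
    ext
    exact mem_nonSumsFinset
  rw [← Finset.sum_coe_sort]
  refine h.unique ?_
  rw [← h3]
  exact hasSum_fintype _

lemma nonSumsLE_ne_top (h : gf (goodsLE n) (ENNReal.ofReal z) ≠ ∞) :
    gf (nonSumsLE n) (ENNReal.ofReal z) ≠ ∞ :=
  gf_ne_top_mono (fun _ h => h.1) h

lemma sumsLE_ne_top (h : gf (goodsLE n) (ENNReal.ofReal z) ≠ ∞) :
    gf (sumsLE n) (ENNReal.ofReal z) ≠ ∞ :=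
  gf_ne_top_mono (fun _ h => h.1) h

lemma nonProdsLE_ne_top (h : gf (goodsLE n) (ENNReal.ofReal z) ≠ ∞) :
    gf (nonProdsLE n) (ENNReal.ofReal z) ≠ ∞ :=
  gf_ne_top_mono (fun _ h => h.1) h

lemma gfR_goodsLE_le_mul (h : gf (goodsLE n) (ENNReal.ofReal z) ≠ ∞) :
    gfR (goodsLE n) z ≤ gfR (nonProdsLE n) z + gfR (nonProdsLE n) z * gfR (goodsLE n) z := by
  have hq := nonProdsLE_ne_top h
  rw [gfR, gfR, ← ENNReal.toReal_mul, ← ENNReal.toReal_add hq (ENNReal.mul_ne_top hq h)]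
  exact ENNReal.toReal_mono (ENNReal.add_ne_top.2 ⟨hq, ENNReal.mul_ne_top hq h⟩) gf_goodsLE_le_mul

lemma gfR_goodsLE_le_add (h : gf (goodsLE n) (ENNReal.ofReal z) ≠ ∞) :
    gfR (goodsLE n) z ≤ gfR (nonSumsLE n) z + gfR (sumsLE n) z := by
  have hp := nonSumsLE_ne_top h
  have hk := sumsLE_ne_top h
  rw [gfR, gfR, gfR, ← ENNReal.toReal_add hp hk]
  exact ENNReal.toReal_mono (ENNReal.add_ne_top.2 ⟨hp, hk⟩) gf_goodsLE_le_add

lemma gfR_nonProdsLE_le (h : gf (goodsLE n) (ENNReal.ofReal z) ≠ ∞)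
    (hz : 0 ≤ z) : gfR (nonProdsLE n) z ≤ z + 2 * gfR (sumsLE n) z := by
  have hk := ENNReal.mul_ne_top ENNReal.ofNat_ne_top (sumsLE_ne_top h) (a := 2)
  nth_rewrite 2 [← ENNReal.toReal_ofReal hz]
  rw [gfR, gfR, ← ENNReal.toReal_ofNat, ← ENNReal.toReal_mul,
    ← ENNReal.toReal_add ENNReal.ofReal_ne_top hk]
  exact ENNReal.toReal_mono (ENNReal.add_ne_top.2 ⟨ENNReal.ofReal_ne_top, hk⟩) gf_nonProdsLE_le

lemma toReal_nonSums (h : gf (goodsLE n) (ENNReal.ofReal z) ≠ ∞)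
    (hz : 0 ≤ z) : (ENNReal.ofReal z + (gf (sumsLE n) (ENNReal.ofReal z) +
    gf (nonProdsLE n) (ENNReal.ofReal z) * gf (goodsLE n) (ENNReal.ofReal z))).toReal =
    z + (gfR (sumsLE n) z + gfR (nonProdsLE n) z * gfR (goodsLE n) z) := by
  have hm := ENNReal.mul_ne_top (nonProdsLE_ne_top h) h
  have hk := sumsLE_ne_top h
  rw [ENNReal.toReal_add ENNReal.ofReal_ne_top (ENNReal.add_ne_top.2 ⟨hk, hm⟩),
    ENNReal.toReal_add hk hm, ENNReal.toReal_mul, ENNReal.toReal_ofReal hz]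
  rfl

lemma gfR_nonSumsLE_le (h : gf (goodsLE n) (ENNReal.ofReal z) ≠ ∞)
    (hz : 0 ≤ z) : gfR (nonSumsLE n) z ≤
    z + (gfR (sumsLE n) z + gfR (nonProdsLE n) z * gfR (goodsLE n) z) := by
  rw [← toReal_nonSums h hz]
  refine ENNReal.toReal_mono ?_ gf_nonSumsLE_le
  exact ENNReal.add_ne_top.2 ⟨ENNReal.ofReal_ne_top, ENNReal.add_ne_top.2 ⟨sumsLE_ne_top h,
    ENNReal.mul_ne_top (nonProdsLE_ne_top h) h⟩⟩

lemma le_gfR_nonSumsLE_top (hz : 0 ≤ z) (h : gf (goodsLE ⊤) (ENNReal.ofReal z) ≠ ∞) :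
    z + (gfR (sumsLE ⊤) z + gfR (nonProdsLE ⊤) z * gfR (goodsLE ⊤) z) ≤ gfR (nonSumsLE ⊤) z := by
  rw [← toReal_nonSums h hz]
  exact ENNReal.toReal_mono (nonSumsLE_ne_top h) le_gf_nonSumsLE_top

lemma pow_size_le (hz : 0 ≤ z) (hz1 : z < 1) {x : MClass} (hx : x ≠ 0) : z ^ size x ≤ z :=
  pow_le_of_le_one hz hz1.le (size_pos hx).ne'

lemma one_sub_pow_size_pos (hz : 0 ≤ z) (hz1 : z < 1) {x : MClass} (hx : x ≠ 0) :
    0 < 1 - z ^ size x := sub_pos.2 ((pow_size_le hz hz1 hx).trans_lt hz1)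

lemma prod_eq_ofReal (hz : 0 ≤ z) (hz1 : z < 1) (F : Finset MClass) (hF : ∀ q ∈ F, q ≠ 0) :
    ∏ q ∈ F, (1 - ENNReal.ofReal z ^ size q)⁻¹ =
      ENNReal.ofReal (∏ q ∈ F, (1 - z ^ size q)⁻¹) := by
  rw [ENNReal.ofReal_prod_of_nonneg fun q hq =>
    (inv_pos.2 (one_sub_pow_size_pos hz hz1 (hF q hq))).le]
  refine Finset.prod_congr rfl fun q hq => ?_
  rw [ENNReal.ofReal_inv_of_pos (one_sub_pow_size_pos hz hz1 (hF q hq)),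
    ENNReal.ofReal_sub _ (by positivity), ENNReal.ofReal_one, ENNReal.ofReal_pow hz]

lemma prod_le_gfR_goodsLE (hz : 0 ≤ z) (hz1 : z < 1) (h : gf (goodsLE ⊤) (ENNReal.ofReal z) ≠ ∞)
    (F : Finset MClass) (hF : ∀ q ∈ F, q ∈ nonSumsLE ⊤) :
    ∏ q ∈ F, (1 - z ^ size q)⁻¹ ≤ 1 + gfR (goodsLE ⊤) z := by
  have h1 := prod_le_gf_goodsLE (w := ENNReal.ofReal z) F hF
  rw [prod_eq_ofReal hz hz1 F fun q hq => (hF q hq).1.2.1] at h1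
  have h2 := (ENNReal.ofReal_le_iff_le_toReal (ENNReal.add_ne_top.2 ⟨ENNReal.one_ne_top, h⟩)).1 h1
  rwa [ENNReal.toReal_add ENNReal.one_ne_top h, ENNReal.toReal_one] at h2

lemma gfR_sumsLE_succ_le (hz : 0 ≤ z) (hz1 : z < 1) (n : ℕ) :
    1 + (gfR (nonSumsLE n) z + gfR (sumsLE (n + 1 : ℕ)) z) ≤
      ∏ q ∈ nonSumsFinset n, (1 - z ^ size q)⁻¹ := by
  have h1 := gf_sumsLE_succ_le (w := ENNReal.ofReal z) n (nonSumsFinset n)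
    (Set.ext fun q => mem_nonSumsFinset)
  have h0 : ∀ q ∈ nonSumsFinset n, q ≠ 0 := fun q hq => (mem_nonSumsFinset.1 hq).1.2.1
  rw [prod_eq_ofReal hz hz1 _ h0] at h1
  have hp := nonSumsLE_ne_top (gf_ne_top_of_finite (z := z) (finite_goodsLE n))
  have hk := sumsLE_ne_top (gf_ne_top_of_finite (z := z) (finite_goodsLE (n + 1)))
  have h2 := ENNReal.toReal_mono ENNReal.ofReal_ne_top h1
  rw [ENNReal.toReal_ofReal (Finset.prod_nonneg fun q hq =>
    (inv_pos.2 (one_sub_pow_size_pos hz hz1 (h0 q hq))).le),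
    ENNReal.toReal_add ENNReal.one_ne_top (ENNReal.add_ne_top.2 ⟨hp, hk⟩),
    ENNReal.toReal_add hp hk, ENNReal.toReal_one] at h2
  exact h2

/-! ### Upper bounds -/

lemma neg_log_one_sub_le {x : ℝ} (hx : 0 ≤ x) (hx1 : x < 1) (m : ℕ) :
    -Real.log (1 - x) ≤ ∑ i ∈ Finset.range m, x ^ (i + 1) / (i + 1) + x ^ (m + 1) / (1 - x) := by
  have h := (abs_le.1 (Real.abs_log_sub_add_sum_range_le (abs_lt.2 ⟨by linarith, hx1⟩) m)).1
  rw [abs_of_nonneg hx] at h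
  linarith

lemma sum_le_neg_log_one_sub {x : ℝ} (hx : 0 ≤ x) (hx1 : x < 1) (m : ℕ) :
    ∑ i ∈ Finset.range m, x ^ (i + 1) / (i + 1) ≤ -Real.log (1 - x) :=
  sum_le_hasSum _ (fun i _ => by positivity)
    (Real.hasSum_pow_div_log_of_abs_lt_one (abs_lt.2 ⟨by linarith, hx1⟩))

lemma inv_eq_exp {x : ℝ} (hx : 0 < 1 - x) : (1 - x)⁻¹ = Real.exp (-Real.log (1 - x)) := by
  rw [Real.exp_neg, Real.exp_log hx]

lemma prod_le_exp (hz : 0 ≤ z) (hz1 : z < 1) (n m : ℕ) :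
    ∏ q ∈ nonSumsFinset n, (1 - z ^ size q)⁻¹ ≤
      Real.exp (∑ i ∈ Finset.range m, gfR (nonSumsLE n) (z ^ (i + 1)) / (i + 1) +
        gfR (nonSumsLE n) (z ^ (m + 1)) / (1 - z)) := by
  have h0 : ∀ q ∈ nonSumsFinset n, q ≠ 0 := fun q hq => (mem_nonSumsFinset.1 hq).1.2.1
  rw [Finset.prod_congr rfl fun q hq => inv_eq_exp (one_sub_pow_size_pos hz hz1 (h0 q hq)),
    ← Real.exp_sum, Real.exp_le_exp]
  simp only [gfR_nonSumsLE (pow_nonneg hz _), Finset.sum_div]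
  rw [Finset.sum_comm, ← Finset.sum_add_distrib]
  refine Finset.sum_le_sum fun q hq => ?_
  have hle := pow_size_le hz hz1 (h0 q hq)
  refine (neg_log_one_sub_le (by positivity) (hle.trans_lt hz1) m).trans ?_
  simp only [← pow_mul, mul_comm (size q)]
  gcongr

lemma gfR_pow_le (hz : 0 ≤ z) (hz1 : z < 1) (n k j : ℕ) :
    gfR (nonSumsLE n) (z ^ (k + j)) ≤ z ^ j * gfR (nonSumsLE n) (z ^ k) := by
  rw [gfR_nonSumsLE (pow_nonneg hz _), gfR_nonSumsLE (pow_nonneg hz _), Finset.mul_sum]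
  refine Finset.sum_le_sum fun q hq => ?_
  rw [pow_add, mul_pow, mul_comm]
  gcongr
  exact pow_le_of_le_one (by positivity) (pow_le_one₀ hz hz1.le)
    (size_pos (mem_nonSumsFinset.1 hq).1.2.1).ne'

/-- If the functional equation has a supersolution at `z`, the generating functions are bounded
there. -/
theorem upper_bound {κ q p e : ℝ} (hz : 0 < z) (hz1 : z < 1) (hκ : 0 ≤ κ) (hqdef : q = z + 2 * κ)
    (hq1 : q < 1) (hp : p = z + κ + q ^ 2 / (1 - q)) (he : 0 ≤ e)
    (hE : ∀ n : ℕ, gfR (nonSumsLE n) z ≤ p → ∏ x ∈ nonSumsFinset n, (1 - z ^ size x)⁻¹ ≤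
      Real.exp (gfR (nonSumsLE n) z + e))
    (hu : Real.exp (p + e) ≤ 1 / (1 - q)) (n : ℕ) :
    gfR (nonSumsLE n) z ≤ p ∧ gfR (goodsLE n) z ≤ q / (1 - q) := by
  have hq0 : 0 < 1 - q := by linarith
  have key : ∀ n : ℕ, gfR (sumsLE n) z ≤ κ →
      gfR (nonSumsLE n) z ≤ p ∧ gfR (goodsLE n) z ≤ q / (1 - q) := fun n hn => by
    have htop := gf_ne_top_of_finite (z := z) (finite_goodsLE n)
    have h1 := gfR_goodsLE_le_mul htop
    have h2 := gfR_nonProdsLE_le htop hz.le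
    have h3 := gfR_nonSumsLE_le htop hz.le
    have hQ : gfR (nonProdsLE n) z ≤ q := by linarith
    have hT0 : 0 ≤ gfR (goodsLE n) z := gfR_nonneg
    have hQ0 : 0 ≤ gfR (nonProdsLE n) z := gfR_nonneg
    have hT : gfR (goodsLE n) z ≤ q / (1 - q) := by
      rw [le_div_iff₀ hq0]
      nlinarith [mul_le_mul_of_nonneg_right hQ hT0]
    refine ⟨?_, hT⟩
    have h4 : gfR (nonProdsLE n) z * gfR (goodsLE n) z ≤ q * (q / (1 - q)) :=
      mul_le_mul hQ hT hT0 (by linarith)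
    rw [hp, sq, mul_div_assoc]
    linarith
  refine key n ?_
  induction n with
  | zero =>
    have : sumsLE ((0 : ℕ) : ℕ∞) = ∅ := by
      ext x
      simp only [Set.mem_empty_iff_false, iff_false]
      intro hx
      have := hx.1.2.2
      have h0 : size x ≤ 0 := by exact_mod_cast this
      exact hx.1.2.1 (size_eq_zero.1 (Nat.le_zero.1 h0))
    rw [this]
    simpa [gfR, gf] using hκ
  | succ n ih =>
    have h1 := (gfR_sumsLE_succ_le hz.le hz1 n).trans (hE n (key n ih).1)
    set a := gfR (nonSumsLE n) z
    have ha : a ≤ p := (key n ih).1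
    have ha0 : 0 ≤ a := gfR_nonneg
    have h2 : Real.exp (p + e) = Real.exp (a + e) * Real.exp (p - a) := by
      rw [← Real.exp_add]
      ring_nf
    have h3 : 1 ≤ Real.exp (a + e) := Real.one_le_exp (by linarith)
    have h4 := Real.add_one_le_exp (p - a)
    have h5 : Real.exp (a + e) + (p - a) ≤ Real.exp (p + e) := by
      rw [h2]
      nlinarith
    have h6 : 1 / (1 - q) = 1 + p + κ := by
      rw [hp]
      field_simp
      rw [hqdef]
      ring
    linarith

/-! ### Lower bounds -/

theorem lower_bound (hz : 0 ≤ z) (hz1 : z < 1) (h : gf (goodsLE ⊤) (ENNReal.ofReal z) ≠ ∞) (m : ℕ) :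
    ∑ i ∈ Finset.range m, gfR (nonSumsLE ⊤) (z ^ (i + 1)) / (i + 1) ≤
      Real.log (1 + gfR (goodsLE ⊤) z) := by
  have hs : HasSum (fun x : nonSumsLE ⊤ => ∑ i ∈ Finset.range m, (z ^ (i + 1)) ^ size x.1 / (i + 1))
      (∑ i ∈ Finset.range m, gfR (nonSumsLE ⊤) (z ^ (i + 1)) / (i + 1)) :=
    hasSum_sum fun i _ => (hasSum_gfR (pow_nonneg hz _) (gf_ne_top_of_le
      (pow_le_of_le_one hz hz1.le i.succ_ne_zero) (nonSumsLE_ne_top h))).div_const _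
  have hpos : 0 < 1 + gfR (goodsLE ⊤) z := add_pos_of_pos_of_nonneg one_pos gfR_nonneg
  refine hasSum_le_of_sum_le hs fun F => ?_
  rw [Real.le_log_iff_exp_le hpos]
  refine le_trans ?_ (prod_le_gfR_goodsLE hz hz1 h (F.map (Function.Embedding.subtype _)) ?_)
  · rw [Finset.prod_map, Real.exp_sum]
    refine Finset.prod_le_prod (fun _ _ => (Real.exp_pos _).le) fun x _ => ?_
    have hx := x.2.1.2.1
    simp only [Function.Embedding.subtype_apply]
    rw [inv_eq_exp (one_sub_pow_size_pos hz hz1 hx), Real.exp_le_exp]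
    refine le_trans (le_of_eq ?_) (sum_le_neg_log_one_sub (by positivity)
      ((pow_size_le hz hz1 hx).trans_lt hz1) m)
    simp only [← pow_mul, mul_comm (size x.1)]
  · intro q hq
    obtain ⟨x, -, rfl⟩ := Finset.mem_map.1 hq
    exact x.2

end MClass

/-! ### Numerical bounds -/

open scoped ENNReal

namespace MClass

lemma gfR_four_le (n : ℕ) :
    gfR (nonSumsLE n) ((137931035 / 10 ^ 9) ^ 4) ≤ 3622809 / 10 ^ 10 := by
  set z : ℝ := (137931035 / 10 ^ 9) ^ 4 with hz
  clear_value z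
  refine (upper_bound (z := z) (κ := 2 / 10 ^ 7) (e := 13118 / 10 ^ 11) (by positivity)
    (by norm_num [hz]) (by norm_num) rfl (by norm_num [hz]) rfl (by norm_num) (fun n hn => ?_) ?_
    n).1.trans (by norm_num [hz])
  · refine (prod_le_exp (by positivity) (by norm_num [hz]) n 1).trans (Real.exp_le_exp.2 ?_)
    simp only [Finset.sum_range_one, zero_add, pow_one, Nat.cast_zero, div_one]
    have := gfR_pow_le (z := z) (by positivity) (by norm_num [hz]) n 1 1
    simp only [pow_one] at this
    refine add_le_add_right ((div_le_iff₀ (by norm_num [hz])).2 ?_) _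
    refine this.trans ((mul_le_mul_of_nonneg_left hn (by positivity)).trans ?_)
    norm_num [hz]
  · refine (Real.exp_le_exp.2 (?_ : _ ≤ (36241208 / 10 ^ 11 : ℝ))).trans
      ((Real.exp_bound' (by norm_num) (by norm_num) (n := 3) (by norm_num)).trans ?_)
    · norm_num [hz]
    · norm_num [hz, Finset.sum_range_succ, Nat.factorial]

lemma gfR_three_le (n : ℕ) :
    gfR (nonSumsLE n) ((137931035 / 10 ^ 9) ^ 3) ≤ 2638092 / 10 ^ 9 := by
  set z : ℝ := (137931035 / 10 ^ 9) ^ 3 with hz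
  clear_value z
  refine (upper_bound (z := z) (κ := 698 / 10 ^ 8) (e := 34796 / 10 ^ 10) (by positivity)
    (by norm_num [hz]) (by norm_num) rfl (by norm_num [hz]) rfl (by norm_num) (fun n hn => ?_) ?_
    n).1.trans (by norm_num [hz])
  · refine (prod_le_exp (by positivity) (by norm_num [hz]) n 2).trans (Real.exp_le_exp.2 ?_)
    have h1 := gfR_pow_le (z := z) (by positivity) (by norm_num [hz]) n 1 1
    have h2 := gfR_pow_le (z := z) (by positivity) (by norm_num [hz]) n 1 2
    have h3 : gfR (nonSumsLE n) (z ^ 3) / (1 - z) ≤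
        z ^ 2 * gfR (nonSumsLE n) (z ^ 1) / (1 - z) := by
      have : 0 ≤ 1 - z := by norm_num [hz]
      gcongr
    have h4 : (z / 2 + z ^ 2 / (1 - z)) * gfR (nonSumsLE n) z ≤ 34796 / 10 ^ 10 :=
      (mul_le_mul_of_nonneg_left hn (by norm_num [hz])).trans (by norm_num [hz])
    simp only [Finset.sum_range_succ, Finset.sum_range_zero, zero_add, pow_one, Nat.cast_zero,
      div_one, Nat.cast_one, Nat.reduceAdd] at h1 h3 ⊢
    rw [mul_div_right_comm] at h3
    generalize gfR (nonSumsLE n) (z ^ 3) / (1 - z) = r at h3 ⊢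
    generalize z ^ 2 / (1 - z) = s at h3 h4
    linarith
  · refine (Real.exp_le_exp.2 (?_ : _ ≤ (26415716 / 10 ^ 10 : ℝ))).trans
      ((Real.exp_bound' (by norm_num) (by norm_num) (n := 4) (by norm_num)).trans ?_)
    · norm_num [hz]
    · norm_num [hz, Finset.sum_range_succ, Nat.factorial]

lemma gfR_two_le (n : ℕ) :
    gfR (nonSumsLE n) ((137931035 / 10 ^ 9) ^ 2) ≤ 1980962 / 10 ^ 8 := by
  have h4 := gfR_four_le
  set z : ℝ := (137931035 / 10 ^ 9) ^ 2 with hz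
  clear_value z
  have hz2 : (137931035 / 10 ^ 9 : ℝ) ^ 4 = z ^ 2 := by rw [hz, ← pow_mul]
  rw [hz2] at h4
  refine (upper_bound (z := z) (κ := 3849 / 10 ^ 7) (e := 183572 / 10 ^ 9) (by positivity)
    (by norm_num [hz]) (by norm_num) rfl (by norm_num [hz]) rfl (by norm_num) (fun n hn => ?_) ?_
    n).1.trans (by norm_num [hz])
  · refine (prod_le_exp (by positivity) (by norm_num [hz]) n 3).trans (Real.exp_le_exp.2 ?_)
    have h1 := gfR_pow_le (z := z) (by positivity) (by norm_num [hz]) n 2 1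
    have h2 := gfR_pow_le (z := z) (by positivity) (by norm_num [hz]) n 2 2
    have h3 : gfR (nonSumsLE n) (z ^ 4) / (1 - z) ≤
        z ^ 2 * gfR (nonSumsLE n) (z ^ 2) / (1 - z) := by
      have : 0 ≤ 1 - z := by norm_num [hz]
      gcongr
    have h5 : (1 / 2 + z / 3 + z ^ 2 / (1 - z)) * gfR (nonSumsLE n) (z ^ 2) ≤ 183572 / 10 ^ 9 :=
      (mul_le_mul_of_nonneg_left (h4 n) (by norm_num [hz])).trans (by norm_num [hz])
    simp only [Finset.sum_range_succ, Finset.sum_range_zero, zero_add, pow_one, Nat.cast_zero,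
      div_one, Nat.cast_one, Nat.reduceAdd, Nat.cast_ofNat] at h1 h3 ⊢
    rw [mul_div_right_comm] at h3
    generalize gfR (nonSumsLE n) (z ^ 4) / (1 - z) = r at h3 ⊢
    generalize z ^ 2 / (1 - z) = s at h3 h5
    linarith
  · refine (Real.exp_le_exp.2 (?_ : _ ≤ (19993192 / 10 ^ 9 : ℝ))).trans
      ((Real.exp_bound' (by norm_num) (by norm_num) (n := 5) (by norm_num)).trans ?_)
    · norm_num [hz]
    · norm_num [hz, Finset.sum_range_succ, Nat.factorial]

theorem gfR_goodsLE_le_one (n : ℕ) : gfR (goodsLE n) (137931035 / 10 ^ 9) ≤ 1 := by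
  have h2 := gfR_two_le
  have h3 := gfR_three_le
  have h4 := gfR_four_le
  set z : ℝ := 137931035 / 10 ^ 9 with hz
  clear_value z
  refine (upper_bound (z := z) (κ := 650094825 / 10 ^ 10) (q := 26795 / 10 ^ 5)
    (e := 10886175 / 10 ^ 9) (by positivity)
    (by norm_num [hz]) (by norm_num) (by norm_num [hz]) (by norm_num) rfl (by norm_num)
    (fun n hn => ?_) ?_ n).2.trans (by norm_num)
  · refine (prod_le_exp (by positivity) (by norm_num [hz]) n 7).trans (Real.exp_le_exp.2 ?_)
    have h5 := gfR_pow_le (z := z) (by positivity) (by norm_num [hz]) n 4 1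
    have h6 := gfR_pow_le (z := z) (by positivity) (by norm_num [hz]) n 4 2
    have h7 := gfR_pow_le (z := z) (by positivity) (by norm_num [hz]) n 4 3
    have h8 : gfR (nonSumsLE n) (z ^ 8) / (1 - z) ≤
        z ^ 4 * gfR (nonSumsLE n) (z ^ 4) / (1 - z) := by
      refine div_le_div_of_nonneg_right ?_ (by norm_num [hz])
      exact gfR_pow_le (z := z) (by positivity) (by norm_num [hz]) n 4 4
    have h9 : (1 / 4 + z / 5 + z ^ 2 / 6 + z ^ 3 / 7 + z ^ 4 / (1 - z)) *
        gfR (nonSumsLE n) (z ^ 4) ≤ 10886175 / 10 ^ 9 - 1980962 / 10 ^ 8 / 2 -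
          2638092 / 10 ^ 9 / 3 :=
      (mul_le_mul_of_nonneg_left (h4 n) (by norm_num [hz])).trans (by norm_num [hz])
    have h2 := h2 n
    have h3 := h3 n
    simp only [Finset.sum_range_succ, Finset.sum_range_zero, zero_add, pow_one, Nat.cast_zero,
      div_one, Nat.cast_one, Nat.reduceAdd, Nat.cast_ofNat] at h5 h6 h7 h8 ⊢
    rw [mul_div_right_comm] at h8
    generalize gfR (nonSumsLE n) (z ^ 8) / (1 - z) = r at h8 ⊢
    generalize z ^ 4 / (1 - z) = s at h8 h9
    linarith
  · refine (Real.exp_le_exp.2 (?_ : _ ≤ (311903605 / 10 ^ 9 : ℝ))).trans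
      ((Real.exp_bound' (by norm_num) (by norm_num) (n := 8) (by norm_num)).trans ?_)
    · norm_num [hz]
    · norm_num [Finset.sum_range_succ, Nat.factorial]

section

variable {z : ℝ}

lemma le_nonProds_mul_goods (h : gf (goodsLE ⊤) (ENNReal.ofReal z) ≠ ∞)
    {t c : ℝ} (ht : 0 ≤ t) (htT : t ≤ gfR (goodsLE ⊤) z)
    (hc : c * (1 + t) ≤ t ^ 2) : c ≤ gfR (nonProdsLE ⊤) z * gfR (goodsLE ⊤) z := by
  have h1 := gfR_goodsLE_le_mul h
  set T := gfR (goodsLE ⊤) z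
  set Q := gfR (nonProdsLE ⊤) z
  have hT : 0 ≤ T := ht.trans htT
  have h2 : c * (1 + T) * (1 + t) ≤ T ^ 2 * (1 + t) := by
    nlinarith [mul_nonneg (sub_nonneg.2 htT) (by positivity : 0 ≤ T + t + T * t),
      mul_le_mul_of_nonneg_right hc (by positivity : 0 ≤ 1 + T)]
  have h3 : c * (1 + T) ≤ T ^ 2 := le_of_mul_le_mul_right h2 (by positivity)
  have h4 : c * (1 + T) ≤ Q * T * (1 + T) := by nlinarith
  exact le_of_mul_le_mul_right h4 (by positivity)

lemma le_gfR_nonSumsLE (hz : 0 < z) (h : gf (goodsLE ⊤) (ENNReal.ofReal z) ≠ ∞) :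
    z ≤ gfR (nonSumsLE ⊤) z := by
  have h1 := le_gfR_nonSumsLE_top hz.le h
  have h2 := gfR_nonneg (S := sumsLE ⊤) (z := z)
  have h3 := mul_nonneg (gfR_nonneg (S := nonProdsLE ⊤) (z := z))
    (gfR_nonneg (S := goodsLE ⊤) (z := z))
  linarith

lemma gf_pow_ne_top (hz : 0 < z) (hz1 : z < 1) (h : gf (goodsLE ⊤) (ENNReal.ofReal z) ≠ ∞)
    {k : ℕ} (hk : k ≠ 0) : gf (goodsLE ⊤) (ENNReal.ofReal (z ^ k)) ≠ ∞ :=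
  gf_ne_top_of_le (pow_le_of_le_one hz.le hz1.le hk) h

lemma le_gfR_sumsLE (hz : 0 < z) (hz1 : z < 1) (h : gf (goodsLE ⊤) (ENNReal.ofReal z) ≠ ∞)
    {p : ℝ} (hp : 0 ≤ p) (hpP : p ≤ gfR (nonSumsLE ⊤) z) :
    z ^ 2 / 2 + z ^ 3 / 3 + (p + z ^ 2 / 2) ^ 2 / 2 + (p + z ^ 2 / 2) ^ 3 / 6 ≤
      gfR (goodsLE ⊤) z - gfR (nonSumsLE ⊤) z := by
  have h1 := lower_bound hz.le hz1 h 3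
  have h2 := le_gfR_nonSumsLE (pow_pos hz 2) (gf_pow_ne_top hz hz1 h two_ne_zero)
  have h3 := le_gfR_nonSumsLE (pow_pos hz 3) (gf_pow_ne_top hz hz1 h three_ne_zero)
  have hpos : 0 < 1 + gfR (goodsLE ⊤) z := add_pos_of_pos_of_nonneg one_pos gfR_nonneg
  rw [Real.le_log_iff_exp_le hpos] at h1
  simp only [Finset.sum_range_succ, Finset.sum_range_zero, zero_add, pow_one, Nat.cast_zero,
    div_one, Nat.cast_one, Nat.reduceAdd, Nat.cast_ofNat] at h1
  set x := gfR (nonSumsLE ⊤) z + gfR (nonSumsLE ⊤) (z ^ 2) / (1 + 1) +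
    gfR (nonSumsLE ⊤) (z ^ 3) / (2 + 1) with hx
  have hx0 : p + z ^ 2 / 2 ≤ x := by
    have : 0 < z ^ 3 := by positivity
    linarith
  have hy0 : 0 ≤ p + z ^ 2 / 2 := by positivity
  have h4 := (Real.sum_le_exp_of_nonneg (hy0.trans hx0) 4).trans h1
  simp only [Finset.sum_range_succ, Finset.sum_range_zero, zero_add, pow_one, pow_zero,
    Nat.factorial, Nat.cast_one, div_one, Nat.reduceAdd, Nat.cast_ofNat, Nat.reduceMul,
    Nat.succ_eq_add_one] at h4
  have h5 := pow_le_pow_left₀ hy0 hx0 2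
  have h6 := pow_le_pow_left₀ hy0 hx0 3
  linarith

lemma le_gfR_nonSumsLE_cubic (hz : 0 < z) (hz1 : z < 1) (h : gf (goodsLE ⊤) (ENNReal.ofReal z) ≠ ∞)
    (hz' : z ≤ 1 / 15) :
    z + 2 * z ^ 2 + 8 * z ^ 3 ≤ gfR (nonSumsLE ⊤) z := by
  have hP := le_gfR_nonSumsLE hz h
  have hup := gfR_goodsLE_le_add h
  have hlow := le_gfR_nonSumsLE_top hz.le h
  have hz2 : 0 < z ^ 2 := by positivity
  have hz3 : 0 < z ^ 3 := by positivity
  have hz4 : 0 < z ^ 4 := by positivity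
  have hz5 : 0 < z ^ 5 := by positivity
  have hz6 : 0 < z ^ 6 := by positivity
  have hK := le_gfR_sumsLE hz hz1 h hz.le hP
  have hT : z + z ^ 2 ≤ gfR (goodsLE ⊤) z := by nlinarith
  have hQT := le_nonProds_mul_goods h (c := z ^ 2) (by positivity) hT (by nlinarith)
  have hP' : z + 2 * z ^ 2 ≤ gfR (nonSumsLE ⊤) z := by nlinarith
  have hK' := le_gfR_sumsLE hz hz1 h (by positivity) hP'
  have hT' : z + 3 * z ^ 2 ≤ gfR (goodsLE ⊤) z := by nlinarith
  have hQT' := le_nonProds_mul_goods h (c := z ^ 2 * (1 + 5 * z)) (by positivity) hT'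
    (by nlinarith)
  nlinarith

end

lemma two_div_sub_le_one_div {u v : ℝ} (hu : 0 < u) : 2 / v - u / v ^ 2 ≤ 1 / u := by
  rw [le_div_iff₀ hu]
  have : (2 / v - u / v ^ 2) * u = 1 - (u / v - 1) ^ 2 := by ring
  linarith [sq_nonneg (u / v - 1)]

theorem gf_goodsLE_eq_top : gf (goodsLE ⊤) (ENNReal.ofReal (137949 / 10 ^ 6)) = ∞ := by
  by_contra h
  set z : ℝ := 137949 / 10 ^ 6 with hz
  clear_value z
  have hz0 : 0 < z := by positivity
  have hz1 : z < 1 := by norm_num [hz]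
  have hlog := lower_bound hz0.le hz1 h 6
  have hpow : ∀ k : ℕ, 2 ≤ k → z ^ k + 2 * (z ^ k) ^ 2 + 8 * (z ^ k) ^ 3 ≤
      gfR (nonSumsLE ⊤) (z ^ k) := fun k hk =>
    le_gfR_nonSumsLE_cubic (by positivity) (pow_lt_one₀ hz0.le hz1 (by omega))
      (gf_pow_ne_top hz0 hz1 h (by omega))
      ((pow_le_pow_of_le_one hz0.le hz1.le hk).trans (by norm_num [hz]))
  have h2 := hpow 2 (by norm_num)
  have h3 := hpow 3 (by norm_num)
  have h4 := hpow 4 (by norm_num)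
  have h5 := hpow 5 (by norm_num)
  have h6 := hpow 6 (by norm_num)
  have hQ := gfR_nonProdsLE_le h hz0.le
  have hP := le_gfR_nonSumsLE_top hz0.le h
  have hT := gfR_goodsLE_le_mul h
  have hT0 : 0 ≤ gfR (goodsLE ⊤) z := gfR_nonneg
  simp only [Finset.sum_range_succ, Finset.sum_range_zero, zero_add, pow_one, Nat.cast_zero,
    div_one, Nat.cast_one, Nat.reduceAdd, Nat.cast_ofNat] at hlog
  set T := gfR (goodsLE ⊤) z
  set Q := gfR (nonProdsLE ⊤) z
  set P := gfR (nonSumsLE ⊤) z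
  clear_value T Q P
  have hu : 0 < 1 + T := by positivity
  have hQ' : 1 - 1 / (1 + T) ≤ Q := by
    rw [one_sub_div hu.ne', div_le_iff₀ hu]
    linarith
  have hP' : z / 2 + (1 + T) - 3 / 2 + 1 / 2 * (1 / (1 + T)) ≤ P := by
    have : (1 - 1 / (1 + T)) * (1 / 2 + T) = (1 + T) - 3 / 2 + 1 / 2 * (1 / (1 + T)) := by
      field_simp
      ring
    have h7 := mul_le_mul_of_nonneg_right hQ' (by positivity : 0 ≤ 1 / 2 + T)
    rw [this] at h7
    generalize 1 / (1 + T) = r at h7 ⊢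
    linarith
  have hlog2 : Real.log (1 + T) ≤ Real.log (13660254 / 10 ^ 7) + (1 + T) / (13660254 / 10 ^ 7) - 1 := by
    have := Real.log_le_sub_one_of_pos (div_pos hu (by norm_num : (0 : ℝ) < 13660254 / 10 ^ 7))
    rw [Real.log_div hu.ne' (by norm_num)] at this
    linarith
  have hlog3 : Real.log (13660254 / 10 ^ 7) ≤ 3119054 / 10 ^ 7 := by
    rw [Real.log_le_iff_le_exp (by norm_num)]
    refine le_trans ?_ (Real.sum_le_exp_of_nonneg (by norm_num) 8)
    norm_num [Finset.sum_range_succ, Nat.factorial]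
  have hinv : 2 / (1366026 / 10 ^ 6) - (1 + T) / (1366026 / 10 ^ 6) ^ 2 ≤ 1 / (1 + T) :=
    two_div_sub_le_one_div hu
  norm_num [hz] at h2 h3 h4 h5 h6
  norm_num [hz] at hlog hP' hlog2 hlog3 hinv
  linarith

end MClass

/-! ### Growth of the number of rooted graphs -/

open scoped ENNReal

namespace MClass

variable {m n : ℕ} {x y : MClass}

lemma finite_goodClasses (n : ℕ) : (goodClasses n).Finite :=
  (finite_size_le n).subset fun _ hx => hx.2.le

lemma ne_zero_of_mem_goodClasses (hn : n ≠ 0) (hx : x ∈ goodClasses n) : x ≠ 0 := by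
  rintro rfl
  exact hn (hx.2.symm.trans size_zero)

lemma gf_goodClasses (n : ℕ) (w : ℝ≥0∞) :
    gf (goodClasses n) w = (goodClasses n).ncard * w ^ n := by
  have : gf (goodClasses n) w = ∑' _ : goodClasses n, w ^ n :=
    tsum_congr fun x => by rw [x.2.2]
  rw [this, ENNReal.tsum_set_const, ← (finite_goodClasses n).cast_ncard_eq]
  norm_cast

lemma ncard_goodClasses_mul_pow_le (hn : n ≠ 0) :
    (goodClasses n).ncard * (137931035 / 10 ^ 9 : ℝ) ^ n ≤ 1 := by
  have h : gf (goodClasses n) (ENNReal.ofReal (137931035 / 10 ^ 9)) ≤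
      gf (goodsLE n) (ENNReal.ofReal (137931035 / 10 ^ 9)) :=
    gf_mono fun x hx => ⟨hx.1, ne_zero_of_mem_goodClasses hn hx, by exact_mod_cast hx.2.le⟩
  have := (ENNReal.toReal_mono (gf_ne_top_of_finite (finite_goodsLE n)) h).trans
    (gfR_goodsLE_le_one n)
  rwa [gf_goodClasses, ENNReal.toReal_mul, ENNReal.toReal_natCast, ENNReal.toReal_pow,
    ENNReal.toReal_ofReal (by norm_num)] at this

lemma ncard_goodClasses_pos (hn : n ≠ 0) : 0 < (goodClasses n).ncard := by
  rw [Set.ncard_pos (finite_goodClasses n)]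
  obtain ⟨k, rfl⟩ := Nat.exists_eq_succ_of_ne_zero hn
  clear hn
  induction k with
  | zero => exact ⟨1, good_one, size_one⟩
  | succ k ih =>
    obtain ⟨x, hx⟩ := ih
    exact ⟨x + 1, hx.1.add good_one, by rw [size_add, hx.2, size_one]⟩

lemma isProd_one_mul (hx : x ≠ 0) : IsProd (1 * x) := ⟨1, x, one_ne_zero', hx, rfl⟩

lemma good_one_mul_add_one (hx : Good x) : Good (1 * x + 1) :=
  (good_one.mul hx one_ne_zero').add good_one

lemma not_isProd_one_mul_add_one (hx : Good x) : ¬ IsProd (1 * x + 1) := fun h =>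
  h.not_isSum (good_one_mul_add_one hx)
    ⟨1 * x, 1, fun h => one_ne_zero' (mul_eq_zero'.1 h).1, one_ne_zero', rfl⟩

lemma one_mul_add_one_injective (hx : Good x) (hx0 : x ≠ 0) (hy : Good y) (hy0 : y ≠ 0)
    (h : 1 * x + 1 = 1 * y + 1) : x = y := by
  have key : ∀ z : MClass, Good z → z ≠ 0 →
      ∀ q ∈ ({1 * z, 1} : Multiset MClass), ¬ IsSum q ∧ q ≠ 0 := by
    intro z hz hz0 q hq
    simp only [Multiset.insert_eq_cons, Multiset.mem_cons, Multiset.mem_singleton] at hq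
    rcases hq with rfl | rfl
    · exact ⟨(isProd_one_mul hz0).not_isSum (good_one.mul hz one_ne_zero'),
        fun h => one_ne_zero' (mul_eq_zero'.1 h).1⟩
    · exact ⟨not_isSum_one, one_ne_zero'⟩
  have hM := sum_injective {1 * x, 1} {1 * y, 1} (key x hx hx0) (key y hy hy0) (by simpa using h)
  have hxy : 1 * x = 1 * y := by simpa [Multiset.insert_eq_cons, Multiset.cons_inj_left] using hM
  exact (mul_inj (good_one.hasMark one_ne_zero') not_isProd_one not_isProd_one hxy).2

lemma ncard_goodClasses_mul_le (n : ℕ) (hm : m ≠ 0) :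
    (goodClasses m).ncard * (goodClasses n).ncard ≤ (goodClasses (m + 2 + n)).ncard := by
  rw [← Set.ncard_prod]
  refine Set.ncard_le_ncard_of_injOn (fun p => (1 * p.1 + 1) * p.2) ?_ ?_ (finite_goodClasses _)
  · rintro ⟨x, y⟩ ⟨hx, hy⟩
    refine ⟨(good_one_mul_add_one hx.1).mul hy.1 fun h => one_ne_zero' (add_eq_zero'.1 h).2, ?_⟩
    simp only [size_mul, size_add, size_one, hx.2, hy.2]
    omega
  · rintro ⟨x, y⟩ ⟨hx, hy⟩ ⟨x', y'⟩ ⟨hx', hy'⟩ h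
    obtain ⟨h1, rfl⟩ := mul_inj ((good_one_mul_add_one hx.1).hasMark fun h =>
      one_ne_zero' (add_eq_zero'.1 h).2) (not_isProd_one_mul_add_one hx.1)
      (not_isProd_one_mul_add_one hx'.1) h
    have := one_mul_add_one_injective hx.1 (ne_zero_of_mem_goodClasses hm hx) hx'.1
      (ne_zero_of_mem_goodClasses hm hx') h1
    exact Prod.ext this rfl

lemma exists_pow_le_ncard_goodClasses :
    ∃ m ≠ 0, (7.249 : ℝ) ^ (m + 2) ≤ (goodClasses m).ncard := by
  by_contra! h
  have hsub : goodsLE ⊤ ⊆ ⋃ n, goodClasses (n + 1) := fun x hx =>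
    Set.mem_iUnion.2 ⟨size x - 1, hx.1, (Nat.sub_add_cancel (size_pos hx.2.1)).symm⟩
  have hle := (gf_mono (w := ENNReal.ofReal (137949 / 10 ^ 6)) hsub).trans
    (ENNReal.tsum_iUnion_le_tsum (fun x => ENNReal.ofReal (137949 / 10 ^ 6) ^ size x)
      fun n => goodClasses (n + 1))
  rw [gf_goodsLE_eq_top, top_le_iff] at hle
  have hs : Summable fun n : ℕ => (7.249 ^ 2 : ℝ) * (7.249 * (137949 / 10 ^ 6)) ^ (n + 1) :=
    ((summable_nat_add_iff 1).2
      (summable_geometric_of_lt_one (by norm_num) (by norm_num))).mul_left _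
  refine ne_top_of_le_ne_top hs.tsum_ofReal_ne_top (ENNReal.tsum_le_tsum fun n => ?_) hle
  have := gf_goodClasses (n + 1) (ENNReal.ofReal (137949 / 10 ^ 6))
  rw [gf] at this
  rw [this, ← ENNReal.ofReal_natCast, ← ENNReal.ofReal_pow (by norm_num),
    ← ENNReal.ofReal_mul (by positivity), mul_pow, ← mul_assoc, ← pow_add, add_comm 2]
  gcongr
  exact (h (n + 1) n.succ_ne_zero).le

lemma exists_pow_le_ncard_goodClasses_mul :
    ∃ M : ℕ, ∀ n ≠ 0, (7.249 : ℝ) ^ n ≤ (goodClasses n).ncard * 7.249 ^ M := by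
  obtain ⟨m, hm, h⟩ := exists_pow_le_ncard_goodClasses
  refine ⟨m + 2, fun n => ?_⟩
  induction n using Nat.strong_induction_on with
  | _ n ih =>
  intro hn
  by_cases hnm : n ≤ m + 2
  · have : (1 : ℝ) ≤ (goodClasses n).ncard := by exact_mod_cast ncard_goodClasses_pos hn
    calc (7.249 : ℝ) ^ n ≤ 1 * 7.249 ^ (m + 2) := by
          rw [one_mul]
          exact pow_le_pow_right₀ (by norm_num) hnm
      _ ≤ _ := by gcongr
  · obtain ⟨k, rfl⟩ := Nat.exists_eq_add_of_le (Nat.le_of_not_le hnm)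
    have hk : k ≠ 0 := by rintro rfl; simp at hnm
    have h2 : ((goodClasses m).ncard : ℝ) * (goodClasses k).ncard ≤
        (goodClasses (m + 2 + k)).ncard := by
      exact_mod_cast ncard_goodClasses_mul_le k hm
    calc (7.249 : ℝ) ^ (m + 2 + k) = 7.249 ^ (m + 2) * 7.249 ^ k := pow_add _ _ _
      _ ≤ (goodClasses m).ncard * ((goodClasses k).ncard * 7.249 ^ (m + 2)) := by
          gcongr
          exact ih k (by omega) hk
      _ = ((goodClasses m).ncard * (goodClasses k).ncard) * 7.249 ^ (m + 2) := by ring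
      _ ≤ _ := by gcongr

end MClass

/-- A geometric sequence of ratio below one is `O(n ^ (-3/2))`. -/
lemma exists_pow_le_mul_rpow {r : ℝ} (hr : 0 ≤ r) (hr' : r < 1) :
    ∃ C > 0, ∀ n : ℕ, n ≠ 0 → r ^ n ≤ C * (n : ℝ) ^ (-(3 : ℝ) / 2) := by
  obtain ⟨C, hC⟩ := (tendsto_pow_const_mul_const_pow_of_abs_lt_one 2
    (by rwa [abs_of_nonneg hr])).bddAbove_range
  refine ⟨max C 1, by positivity, fun n hn => ?_⟩
  have h1 : (1 : ℝ) ≤ n := by exact_mod_cast Nat.one_le_iff_ne_zero.2 hn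
  have h2 : (n : ℝ) ^ 2 * r ^ n ≤ max C 1 := (hC ⟨n, rfl⟩).trans (le_max_left _ _)
  have h3 : (n : ℝ) ^ (-2 : ℝ) ≤ (n : ℝ) ^ (-(3 : ℝ) / 2) :=
    Real.rpow_le_rpow_of_exponent_le h1 (by norm_num)
  calc r ^ n = ((n : ℝ) ^ 2 * r ^ n) * (n : ℝ) ^ (-2 : ℝ) := by
        rw [Real.rpow_neg (by positivity), Real.rpow_ofNat]
        field_simp
    _ ≤ _ := by gcongr

theorem numRootedConnDH_asymptotics :
    ∃ (c C : ℝ), 0 < c ∧ 0 < C ∧ ∃ N : ℕ, ∀ n : ℕ, N ≤ n →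
      c * 7.249 ^ n * (n : ℝ) ^ (-(3 : ℝ) / 2) ≤ (numRootedConnDH n : ℝ) ∧
      (numRootedConnDH n : ℝ) ≤ C * 7.25 ^ n * (n : ℝ) ^ (-(3 : ℝ) / 2) := by
  obtain ⟨M, hM⟩ := MClass.exists_pow_le_ncard_goodClasses_mul
  have hz : (0 : ℝ) < 7.25 * (137931035 / 10 ^ 9) := by norm_num
  obtain ⟨C, hC, hCn⟩ := exists_pow_le_mul_rpow
    (inv_nonneg.2 hz.le) (inv_lt_one_of_one_lt₀ (by norm_num))
  refine ⟨(7.249 ^ (M + 1))⁻¹, C, by positivity, hC, 2, fun n hn => ?_⟩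
  obtain ⟨k, rfl⟩ : ∃ k, n = k + 1 := ⟨n - 1, by omega⟩
  have hk : k ≠ 0 := by omega
  rw [MClass.numRootedConnDH_succ]
  have h1 : (1 : ℝ) ≤ (k + 1 : ℕ) := by simp
  constructor
  · calc (7.249 ^ (M + 1))⁻¹ * 7.249 ^ (k + 1) * ((k + 1 : ℕ) : ℝ) ^ (-(3 : ℝ) / 2)
        ≤ (7.249 ^ (M + 1))⁻¹ * 7.249 ^ (k + 1) * 1 := by
          gcongr
          exact Real.rpow_le_one_of_one_le_of_nonpos h1 (by norm_num)
      _ ≤ _ := by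
          rw [mul_one, inv_mul_le_iff₀ (by positivity), pow_succ, pow_succ]
          linarith [hM k hk]
  · have h2 := MClass.ncard_goodClasses_mul_pow_le hk
    have h3 := hCn (k + 1) (by omega)
    set s := ((k + 1 : ℕ) : ℝ) ^ (-(3 : ℝ) / 2)
    set t : ℝ := ((MClass.goodClasses k).ncard : ℝ)
    have h4 : t * (137931035 / 10 ^ 9) ^ (k + 1) ≤ 1 := by
      rw [pow_succ, ← mul_assoc]
      exact mul_le_one₀ h2 (by norm_num) (by norm_num)
    rw [inv_pow, inv_le_iff_one_le_mul₀ (by positivity), mul_pow] at h3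
    refine le_of_mul_le_mul_right ((h4.trans h3).trans_eq ?_)
      (by positivity : (0 : ℝ) < (137931035 / 10 ^ 9) ^ (k + 1))
    ring
end

section
/- Every 3-leaf power simple graph is distance-hereditary. -/
/-- A vertex of a simple graph is a leaf if it has exactly one neighbour. -/
def IsLeafVert {V : Type} (T : SimpleGraph V) (v : V) : Prop :=
  ∃! u, T.Adj v u

/-- A simple graph `G` is a 3-leaf power if there are a finite tree `T` and a bijection
from the vertices of `G` onto the leaves of `T` such that two distinct vertices of `G`
are adjacent iff the corresponding leaves are at distance at most 3 in `T`. -/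
def IsThreeLeafPower {V : Type} (G : SimpleGraph V) : Prop :=
  ∃ (m : ℕ) (T : SimpleGraph (Fin m)), T.IsTree ∧
    ∃ f : V → Fin m,
      Function.Injective f ∧
      (∀ v : V, IsLeafVert T (f v)) ∧
      (∀ w : Fin m, IsLeafVert T w → ∃ v : V, f v = w) ∧
      (∀ x y : V, x ≠ y → (G.Adj x y ↔ T.dist (f x) (f y) ≤ 3))

/-- `H` is obtained from an induced subgraph of `T` by replacing vertices with cliques:
`p` sends every vertex of `H` to the vertex of `T` it replaces. -/
def IsCliqueBlowup {U W : Type} (H : SimpleGraph U) (T : SimpleGraph W) (p : U → W) : Prop :=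
  ∀ x y, H.Adj x y ↔ x ≠ y ∧ (p x = p y ∨ T.Adj (p x) (p y))

namespace IsCliqueBlowup

variable {U W : Type} {H : SimpleGraph U} {T : SimpleGraph W} {p : U → W}

lemma induce (hp : IsCliqueBlowup H T p) (S : Set U) :
    IsCliqueBlowup (H.induce S) T (fun x => p x.val) := by
  intro x y
  rw [SimpleGraph.induce_adj, hp, Ne, Ne, Subtype.ext_iff]

lemma exists_walk_map (hp : IsCliqueBlowup H T p) {u v : U} (w : H.Walk u v) :
    ∃ q : T.Walk (p u) (p v), q.length ≤ w.length ∧ ∀ z ∈ q.support, z ∈ Set.range p := by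
  induction w with
  | nil => exact ⟨.nil, le_rfl, by simp⟩
  | @cons a b c h w ih =>
    obtain ⟨q, hq, hs⟩ := ih
    rcases ((hp _ _).1 h).2 with e | e
    · refine ⟨q.copy e.symm rfl, ?_, ?_⟩
      · simp only [SimpleGraph.Walk.length_copy, SimpleGraph.Walk.length_cons]
        omega
      · simpa using hs
    · refine ⟨.cons e q, by simpa using hq, ?_⟩
      simpa using hs

lemma exists_walk_lift (hp : IsCliqueBlowup H T p) {a b : W} (r : T.Walk a b)
    (hr : ∀ z ∈ r.support, z ∈ Set.range p) (hab : a ≠ b) {u v : U} (hu : p u = a)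
    (hv : p v = b) : ∃ w : H.Walk u v, w.length ≤ r.length := by
  induction r generalizing u with
  | nil => exact absurd rfl hab
  | @cons a c b h r ih =>
    have hr' : ∀ z ∈ r.support, z ∈ Set.range p := fun z hz => hr z (by simp [hz])
    by_cases hcb : c = b
    · subst hu hv hcb
      refine ⟨.cons ((hp u v).2 ⟨?_, .inr h⟩) .nil, by simp⟩
      rintro rfl
      exact hab rfl
    · obtain ⟨x, hx⟩ := hr' c r.start_mem_support
      obtain ⟨w, hw⟩ := ih hr' hcb hx hv
      subst hu hx
      refine ⟨.cons ((hp u x).2 ⟨?_, .inr h⟩) w, by simpa using hw⟩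
      rintro rfl
      exact h.ne rfl

lemma dist_eq_one (hp : IsCliqueBlowup H T p) {u v : U} (huv : u ≠ v) (h : p u = p v) :
    H.dist u v = 1 :=
  SimpleGraph.dist_eq_one_iff_adj.2 ((hp u v).2 ⟨huv, .inl h⟩)

lemma dist_eq (hp : IsCliqueBlowup H T p) (hT : T.IsAcyclic) {u v : U}
    (huv : H.Reachable u v) (hne : p u ≠ p v) : H.dist u v = T.dist (p u) (p v) := by
  classical
  obtain ⟨w, hw⟩ := huv.exists_walk_length_eq_dist
  obtain ⟨q, hq, hs⟩ := hp.exists_walk_map w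
  apply le_antisymm
  · obtain ⟨r, hr, hrl⟩ := q.reachable.exists_path_of_dist
    have hrq : r = q.bypass := congrArg Subtype.val
      ((hT.subsingleton_path _ _).elim ⟨r, hr⟩ ⟨q.bypass, q.bypass_isPath⟩)
    obtain ⟨w', hw'⟩ := hp.exists_walk_lift r
      (fun z hz => hs z (q.support_bypass_subset_support (hrq ▸ hz))) hne rfl rfl
    exact (SimpleGraph.dist_le w').trans (hw'.trans hrl.le)
  · exact (SimpleGraph.dist_le q).trans (hq.trans hw.le)

theorem distanceHereditary (hp : IsCliqueBlowup H T p) (hT : T.IsAcyclic) :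
    DistanceHereditary H := by
  intro S hS u v
  by_cases huv : u = v
  · simp [huv]
  by_cases h : p u = p v
  · rw [(hp.induce S).dist_eq_one huv h, hp.dist_eq_one (fun e => huv (Subtype.ext e)) h]
  · have hr : (H.induce S).Reachable u v := hS u v
    have hr' : H.Reachable u.val v.val := hr.map (SimpleGraph.Embedding.induce S).toHom
    rw [(hp.induce S).dist_eq hT hr h, hp.dist_eq hT hr' h]

end IsCliqueBlowup

/-- Two distinct leaves are at distance at most 3 if and only if their neighbours coincide or
are adjacent. -/
lemma dist_le_three_iff_of_isLeafVert {W : Type} {T : SimpleGraph W} (hT : T.Connected)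
    {a b a' b' : W} (hab : a ≠ b) (ha : IsLeafVert T a) (hb : IsLeafVert T b)
    (haa : T.Adj a a') (hbb : T.Adj b b') :
    T.dist a b ≤ 3 ↔ a' = b' ∨ T.Adj a' b' := by
  constructor
  · intro h
    obtain ⟨w, hw⟩ := hT.exists_walk_length_eq_dist a b
    rw [← hw] at h
    clear hw
    match w, h with
    | .nil, _ => exact absurd rfl hab
    | .cons h₁ .nil, _ =>
      rw [ha.unique haa h₁, hb.unique hbb h₁.symm]
      exact .inr h₁.symm
    | .cons h₁ (.cons h₂ .nil), _ =>
      exact .inl ((ha.unique haa h₁).trans (hb.unique hbb h₂.symm).symm)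
    | .cons h₁ (.cons h₂ (.cons h₃ .nil)), _ =>
      rw [ha.unique haa h₁, hb.unique hbb h₃.symm]
      exact .inr h₂
    | .cons _ (.cons _ (.cons _ (.cons _ _))), h =>
      simp only [SimpleGraph.Walk.length_cons] at h
      omega
  · rintro (rfl | h)
    · exact (SimpleGraph.dist_le (.cons haa (.cons hbb.symm .nil))).trans (by simp)
    · exact (SimpleGraph.dist_le (.cons haa (.cons h (.cons hbb.symm .nil)))).trans (by simp)

/-- Every 3-leaf power simple graph is distance-hereditary. -/
theorem threeLeafPower_distanceHereditary {V : Type} [Fintype V]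
    (G : SimpleGraph V) (hG : IsThreeLeafPower G) : DistanceHereditary G := by
  obtain ⟨m, T, hT, f, hf, hleaf, -, hadj⟩ := hG
  choose p hp using fun v => (hleaf v).exists
  refine IsCliqueBlowup.distanceHereditary (p := p) (fun x y => ?_) hT.isAcyclic
  by_cases hxy : x = y
  · simp [hxy]
  · rw [hadj x y hxy, dist_le_three_iff_of_isLeafVert hT.connected (hf.ne hxy) (hleaf x)
      (hleaf y) (hp x) (hp y)]
    simp [hxy]
end
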